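/- There is a constant q₀ depending only on n such that the following holds whenever q ≥ q₀: if 𝓕 is an EKR-set of chambers of maximum cardinality among all EKR-sets of chambers, then there exist s ∈ {1, n} and an EKR-set 𝓕_s of totally isotropic s-spaces of maximum cardinality among all EKR-sets of s-spaces such that 𝓕 = { C : C is a chamber and C_s ∈ 𝓕_s }. -/

import Mathlib

open scoped Classical

open Module

section Defs

variable {F V : Type} [Field F] [AddCommGroup V] [Module F V]

/-- The orthogonal complement of a subspace with respect to a bilinear form. -/
def bperp (B : V →ₗ[F] V →ₗ[F] F) (W : Submodule F V) : Submodule F V :=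
  ⨅ w ∈ W, LinearMap.ker (B w)

/-- A subspace is totally isotropic for `B`. -/
def IsTotIso (B : V →ₗ[F] V →ₗ[F] F) (W : Submodule F V) : Prop :=
  ∀ u ∈ W, ∀ w ∈ W, B u w = 0

/-- `B` is an alternating form. -/
def IsAltForm (B : V →ₗ[F] V →ₗ[F] F) : Prop := ∀ v, B v v = 0

/-- `B` is nondegenerate. -/
def NondegForm (B : V →ₗ[F] V →ₗ[F] F) : Prop := ∀ v, (∀ w, B v w = 0) → v = 0

/-- A flag of type `J` of totally isotropic subspaces: entries outside `J` are `⊥`. -/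
structure SFlag (B : V →ₗ[F] V →ₗ[F] F) (J : Finset ℕ) where
  space : ℕ → Submodule F V
  isotropic : ∀ i ∈ J, IsTotIso B (space i)
  finrank_eq : ∀ i ∈ J, Module.finrank F (space i) = i
  mono : ∀ i ∈ J, ∀ j ∈ J, i ≤ j → space i ≤ space j
  eq_bot : ∀ i, i ∉ J → space i = ⊥

/-- Two flags of type `J` are opposite. -/
def FlagOpp {B : V →ₗ[F] V →ₗ[F] F} {J : Finset ℕ} (C C' : SFlag B J) : Prop :=
  ∀ i ∈ J, bperp B (C.space i) ⊓ C'.space i = ⊥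

/-- An EKR-set of flags of type `J`: no two members are opposite. -/
def IsEKRFlags {B : V →ₗ[F] V →ₗ[F] F} {J : Finset ℕ} (𝓕 : Set (SFlag B J)) : Prop :=
  ∀ C ∈ 𝓕, ∀ C' ∈ 𝓕, ¬ FlagOpp C C'

/-- Two subspaces are opposite. -/
def SpaceOpp (B : V →ₗ[F] V →ₗ[F] F) (S T : Submodule F V) : Prop :=
  bperp B S ⊓ T = ⊥

/-- An EKR-set of totally isotropic `s`-spaces: no two members are opposite. -/
def IsEKRSpaces (B : V →ₗ[F] V →ₗ[F] F) (s : ℕ) (𝓕 : Set (Submodule F V)) : Prop :=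
  (∀ S ∈ 𝓕, IsTotIso B S ∧ Module.finrank F S = s) ∧
    ∀ S ∈ 𝓕, ∀ T ∈ 𝓕, ¬ SpaceOpp B S T

/-- An `s`-space `S` is heavy with respect to a set `𝓕` of flags: every flag whose
`s`-th entry equals `S` belongs to `𝓕`. -/
def Heavy {B : V →ₗ[F] V →ₗ[F] F} {J : Finset ℕ} (𝓕 : Set (SFlag B J)) (s : ℕ)
    (S : Submodule F V) : Prop :=
  ∀ C : SFlag B J, C.space s = S → C ∈ 𝓕

end Defs

/-- `z_k = ∏_{i=1}^k (q^i-1)/(q-1)`. -/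
noncomputable def zpol (q k : ℕ) : ℝ :=
  ∏ i ∈ Finset.Icc 1 k, ((q : ℝ) ^ i - 1) / ((q : ℝ) - 1)

/-- The Gaussian binomial coefficient `[m choose k]_q` as a real number. -/
noncomputable def gaussq (q m k : ℕ) : ℝ :=
  ∏ i ∈ Finset.Icc 1 k, ((q : ℝ) ^ (m - k + i) - 1) / ((q : ℝ) ^ i - 1)

/-- `Φ_m^s` in `PS(n,1,q)`: the number of totally isotropic `s`-spaces containing a
fixed totally isotropic `m`-space. -/
noncomputable def PhiP (q n m s : ℕ) : ℝ :=
  gaussq q (n - m) (s - m) * ∏ i ∈ Finset.Icc 1 (s - m), ((q : ℝ) ^ (n - m + 1 - i) + 1)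


namespace Hk

variable {H : Type*} [NormedAddCommGroup H] [InnerProductSpace ℝ H]

/-- A representation of the type `B` Hecke algebra by symmetric operators. -/
structure HeckeSys (n : ℕ) (q : ℝ) (R : ℕ → Module.End ℝ H) : Prop where
  hq : 1 < q
  sym : ∀ k < n, (R k).IsSymmetric
  quad : ∀ k < n, R k * R k = (q - 1) • R k + q • (1 : Module.End ℝ H)
  comm : ∀ j k, j + 2 ≤ k → k < n → R j * R k = R k * R j
  braid : ∀ k, 1 ≤ k → k + 1 < n → R k * R (k+1) * R k = R (k+1) * R k * R (k+1)
  b2 : 1 < n → R 0 * R 1 * R 0 * R 1 = R 1 * R 0 * R 1 * R 0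

/-- Jucys-Murphy elements. -/
def LL (R : ℕ → Module.End ℝ H) : ℕ → Module.End ℝ H
  | 0 => R 0
  | k+1 => R (k+1) * LL R k * R (k+1)

/-- The longest element. -/
def TT (R : ℕ → Module.End ℝ H) : ℕ → Module.End ℝ H
  | 0 => 1
  | m+1 => LL R m * TT R m

variable {n : ℕ} {q : ℝ} {R : ℕ → Module.End ℝ H}

lemma comm_hi (h : HeckeSys n q R) (k j : ℕ) (hkj : k + 2 ≤ j) (hj : j < n) :
    Commute (R j) (LL R k) := by
  induction k with
  | zero => exact (h.comm 0 j hkj hj).symm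
  | succ k ih =>
    have h1 : Commute (R j) (R (k+1)) := (h.comm (k+1) j hkj hj).symm
    exact (h1.mul_right (ih (by omega))).mul_right h1

lemma comm_lo (h : HeckeSys n q R) (k j : ℕ) (hkj : j < k) (hk : k < n) :
    Commute (R j) (LL R k) := by
  induction k with
  | zero => omega
  | succ k ih =>
    rcases Nat.lt_or_ge j k with hlt | hge
    · have h1 : Commute (R j) (R (k+1)) := h.comm j (k+1) (by omega) hk
      exact (h1.mul_right (ih hlt (by omega))).mul_right h1
    · have : j = k := by omega
      subst this
      rcases j with _ | j
      · have := h.b2 (by omega)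
        simp only [Commute, SemiconjBy, LL]
        simpa [mul_assoc] using this
      · have hb := h.braid (j+1) (by omega) hk
        have hc : Commute (R (j+2)) (LL R j) := comm_hi h j (j+2) le_rfl hk
        have hc' := hc.eq
        simp only [Commute, SemiconjBy, LL]
        set A := R (j+1)
        set B := R (j+1+1)
        set X := LL R j
        calc A * (B * (A * X * A) * B) = (A * B * A) * X * A * B := by simp only [mul_assoc]
          _ = B * A * (B * X) * A * B := by rw [hb]; simp only [mul_assoc]
          _ = B * A * X * (B * A * B) := by rw [hc']; simp only [mul_assoc]
          _ = _ := by rw [← hb]; simp only [mul_assoc]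

lemma LL_comm_lt (h : HeckeSys n q R) (j k : ℕ) (hjk : j < k) (hk : k < n) :
    Commute (LL R j) (LL R k) := by
  induction j with
  | zero => exact comm_lo h k 0 hjk hk
  | succ j ih =>
    have h1 := comm_lo h k (j+1) hjk hk
    exact (h1.mul_left (ih (by omega))).mul_left h1

lemma LL_comm (h : HeckeSys n q R) (j k : ℕ) (hj : j < n) (hk : k < n) :
    Commute (LL R j) (LL R k) := by
  rcases lt_trichotomy j k with h1 | h1 | h1
  · exact LL_comm_lt h j k h1 hk
  · subst h1; exact Commute.refl _
  · exact (LL_comm_lt h k j h1 hj).symm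

lemma LL_sym (h : HeckeSys n q R) (k : ℕ) (hk : k < n) : (LL R k).IsSymmetric := by
  induction k with
  | zero => exact h.sym 0 hk
  | succ k ih =>
    intro x y
    simp only [LL, Module.End.mul_apply]
    rw [h.sym _ hk, ih (by omega), h.sym _ hk]

lemma R_quad (h : HeckeSys n q R) {k : ℕ} (hk : k < n) (v : H) :
    R k (R k v) = (q - 1) • R k v + q • v := by
  have := congrArg (fun f => f v) (h.quad k hk)
  simpa using this

lemma R_inj (h : HeckeSys n q R) {k : ℕ} (hk : k < n) {v : H} (hv : R k v = 0) : v = 0 := by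
  have := R_quad h hk v
  rw [hv] at this
  have hq := h.hq
  have h2 : q • v = 0 := by simpa using this.symm
  rcases smul_eq_zero.1 h2 with h3 | h3
  · linarith
  · exact h3

lemma LL_inj (h : HeckeSys n q R) {k : ℕ} (hk : k < n) {v : H} (hv : LL R k v = 0) : v = 0 := by
  induction k generalizing v with
  | zero => exact R_inj h hk hv
  | succ k ih =>
    simp only [LL, Module.End.mul_apply] at hv
    exact R_inj h hk (ih (by omega) (R_inj h hk hv))

/-- symmetric operators: eigenvectors for different eigenvalues are orthogonal -/
lemma orth_of_ne {A : Module.End ℝ H} (hA : A.IsSymmetric) {x y : H} {a b : ℝ}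
    (hx : A x = a • x) (hy : A y = b • y) (hab : a ≠ b) : inner ℝ x y = 0 := by
  have := hA x y
  rw [hx, hy, inner_smul_left, inner_smul_right] at this
  simp at this
  rcases this with h | h
  · exact absurd h hab
  · exact h

/-- swap constant -/
noncomputable def kap (q a b : ℝ) : ℝ := (q - 1) * b / (b - a)

lemma LL_succ_R (h : HeckeSys n q R) {m : ℕ} (hm : m + 1 < n) {v : H} {a b : ℝ}
    (h1 : LL R m v = (q ^ m * a) • v) (h2 : LL R (m+1) v = (q ^ (m+1) * b) • v) :
    LL R (m+1) (R (m+1) v) = q ^ (m+1) • (((q-1) * b) • v + a • R (m+1) v) := by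
  have e : LL R (m+1) (R (m+1) v) = R (m+1) (LL R m (R (m+1) (R (m+1) v))) := by
    simp [LL]
  have e2 : R (m+1) (LL R m (R (m+1) v)) = (q ^ (m+1) * b) • v := by rw [← h2]; simp [LL]
  rw [e, R_quad h hm, map_add, map_smul, map_smul, map_add, map_smul, map_smul, e2, h1, map_smul]
  simp only [smul_add, smul_smul]
  congr 2 <;> ring

lemma LL_R (h : HeckeSys n q R) {m : ℕ} (hm : m + 1 < n) {v : H} {b : ℝ}
    (h2 : LL R (m+1) v = (q ^ (m+1) * b) • v) :
    LL R m (R (m+1) v) = (q ^ m * b) • (R (m+1) v - (q-1) • v) := by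
  have hq := h.hq
  have e2 : R (m+1) (LL R m (R (m+1) v)) = (q ^ (m+1) * b) • v := by rw [← h2]; simp [LL]
  have e3 := R_quad h hm (LL R m (R (m+1) v))
  rw [e2, map_smul] at e3
  have hq0 : q ≠ 0 := by linarith
  have : q • LL R m (R (m+1) v) = q • ((q ^ m * b) • (R (m+1) v - (q-1) • v)) := by
    have e4 := (sub_eq_iff_eq_add'.2 e3)
    rw [← e4]
    simp only [smul_sub, smul_smul, pow_succ]
    congr 2 <;> ring
  exact smul_right_injective H hq0 this

lemma eig_ne (h : HeckeSys n q R) {m : ℕ} (hm : m + 1 < n) {v : H} (hv : v ≠ 0) {a b : ℝ}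
    (h1 : LL R m v = (q ^ m * a) • v) (h2 : LL R (m+1) v = (q ^ (m+1) * b) • v) : a ≠ b := by
  rintro rfl
  have hq := h.hq
  have e := LL_succ_R h hm h1 h2
  have s := LL_sym h (m+1) hm (R (m+1) v) v
  rw [e, h2] at s
  simp only [inner_smul_left, inner_smul_right, inner_add_left, smul_add, smul_smul] at s
  simp only [conj_trivial] at s
  have : q ^ (m+1) * ((q-1) * a) * inner ℝ v v = 0 := by linarith
  have hvv : inner ℝ v v ≠ 0 := by simpa using hv
  have hqp : q ^ (m+1) ≠ 0 := by positivity
  have ha : a = 0 := by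
    have : q - 1 ≠ 0 := by linarith
    simp_all
  subst ha
  apply hv
  apply LL_inj h hm
  rw [h2]; simp

lemma swap_hi (h : HeckeSys n q R) {m : ℕ} (hm : m + 1 < n) {v : H} {a b : ℝ}
    (h1 : LL R m v = (q ^ m * a) • v) (h2 : LL R (m+1) v = (q ^ (m+1) * b) • v) (hab : a ≠ b) :
     LL R (m+1) (R (m+1) v - kap q a b • v)
      = (q ^ (m+1) * a) • (R (m+1) v - kap q a b • v) := by
  have hba : b - a ≠ 0 := sub_ne_zero.2 (Ne.symm hab)
  rw [map_sub, LL_succ_R h hm h1 h2, map_smul, h2]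
  simp only [smul_add, smul_sub, smul_smul]
  have : q ^ (m+1) * ((q-1)*b) = kap q a b * (q^(m+1) * b) - q^(m+1)*a*kap q a b := by
    unfold kap; field_simp
  rw [this, sub_smul]; abel

lemma swap_lo (h : HeckeSys n q R) {m : ℕ} (hm : m + 1 < n) {v : H} {a b : ℝ}
    (h1 : LL R m v = (q ^ m * a) • v) (h2 : LL R (m+1) v = (q ^ (m+1) * b) • v) (hab : a ≠ b) :
     LL R m (R (m+1) v - kap q a b • v)
      = (q ^ m * b) • (R (m+1) v - kap q a b • v) := by
  have hba : b - a ≠ 0 := sub_ne_zero.2 (Ne.symm hab)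
  rw [map_sub, LL_R h hm h2, map_smul, h1]
  simp only [smul_sub, smul_smul]
  have : q ^ m * b * (q-1) = q^m * b * kap q a b - kap q a b * (q^m * a) := by
    unfold kap; field_simp
  rw [this, sub_smul]; abel

lemma swap_orth (h : HeckeSys n q R) {m : ℕ} (hm : m + 1 < n) {v : H} {a b : ℝ}
    (h1 : LL R m v = (q ^ m * a) • v) (h2 : LL R (m+1) v = (q ^ (m+1) * b) • v) (hab : a ≠ b) :
     inner ℝ (R (m+1) v - kap q a b • v) v = 0 := by
  have hq := h.hq
  refine orth_of_ne (LL_sym h (m+1) hm) (swap_hi h hm h1 h2 hab) h2 ?_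
  have : q ^ (m+1) ≠ 0 := by positivity
  exact fun e => hab (mul_left_cancel₀ this e)

lemma swap_inner (h : HeckeSys n q R) {m : ℕ} (hm : m + 1 < n) {v : H} {a b : ℝ}
    (h1 : LL R m v = (q ^ m * a) • v) (h2 : LL R (m+1) v = (q ^ (m+1) * b) • v) (hab : a ≠ b) :
     inner ℝ (R (m+1) v) v = kap q a b * ‖v‖^2 := by
  have := swap_orth h hm h1 h2 hab
  rw [inner_sub_left, inner_smul_left, real_inner_self_eq_norm_sq] at this
  simp at this; linarith

lemma swap_norm (h : HeckeSys n q R) {m : ℕ} (hm : m + 1 < n) {v : H} {a b : ℝ}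
    (h1 : LL R m v = (q ^ m * a) • v) (h2 : LL R (m+1) v = (q ^ (m+1) * b) • v) (hab : a ≠ b) :
     ‖R (m+1) v - kap q a b • v‖^2
    = (q + kap q a b * (q - 1 - kap q a b)) * ‖v‖^2 := by
  have h3 := swap_inner h hm h1 h2 hab
  have h4 : inner ℝ (R (m+1) v) (R (m+1) v) = (q-1) * (kap q a b * ‖v‖^2) + q * ‖v‖^2 := by
    rw [h.sym _ hm, R_quad h hm, inner_add_right, inner_smul_right, inner_smul_right,
      real_inner_comm, h3, real_inner_self_eq_norm_sq]
  rw [@norm_sub_sq_real, ← real_inner_self_eq_norm_sq (R (m+1) v), h4, inner_smul_right, h3,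
    norm_smul, mul_pow]
  simp; ring

lemma R_eq_of_ratio (h : HeckeSys n q R) {m : ℕ} (hm : m + 1 < n) {v : H} {a b : ℝ}
    (h1 : LL R m v = (q ^ m * a) • v) (h2 : LL R (m+1) v = (q ^ (m+1) * b) • v)
    (hv : v ≠ 0) (hb : b = q * a) : R (m+1) v = q • v := by
  have hab := eig_ne h hm hv h1 h2
  have hq := h.hq
  have hk : kap q a b = q := by
    unfold kap; subst hb
    have : a ≠ 0 := by rintro rfl; simp at hab
    have : q - 1 ≠ 0 := by linarith
    rw [show q * a - a = (q-1) * a by ring]; field_simp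
  have := swap_norm h hm h1 h2 hab
  rw [hk] at this
  have h5 : ‖R (m+1) v - q • v‖^2 = 0 := by rw [this]; ring
  have h6 : R (m+1) v - q • v = 0 := by simpa using h5
  exact sub_eq_zero.1 h6

lemma R_eq_of_ratio' (h : HeckeSys n q R) {m : ℕ} (hm : m + 1 < n) {v : H} {a b : ℝ}
    (h1 : LL R m v = (q ^ m * a) • v) (h2 : LL R (m+1) v = (q ^ (m+1) * b) • v)
    (hv : v ≠ 0) (hb : a = q * b) : R (m+1) v = - v := by
  have hab := eig_ne h hm hv h1 h2
  have hq := h.hq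
  have hk : kap q a b = -1 := by
    unfold kap; subst hb
    have : b ≠ 0 := by rintro rfl; simp at hab
    have : q - 1 ≠ 0 := by linarith
    rw [show b - q * b = -((q-1) * b) by ring]; field_simp
  have := swap_norm h hm h1 h2 hab
  rw [hk] at this
  have h5 : ‖R (m+1) v - (-1:ℝ) • v‖^2 = 0 := by rw [this]; ring
  have h6 : R (m+1) v - (-1:ℝ) • v = 0 := by simpa using h5
  simpa using sub_eq_zero.1 h6

/-- joint eigenvectors of the first `m` Jucys-Murphy elements -/
def JE (q : ℝ) (R : ℕ → Module.End ℝ H) (m : ℕ) (a : ℕ → ℝ) (v : H) : Prop :=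
  v ≠ 0 ∧ ∀ k < m, LL R k v = (q ^ k * a k) • v

lemma JE.mono {m m' : ℕ} {a : ℕ → ℝ} {v : H} (hJ : JE q R m a v) (hm : m' ≤ m) : JE q R m' a v :=
  ⟨hJ.1, fun k hk => hJ.2 k (by omega)⟩

/-- The trichotomy for the last two eigenvalues; the swapped vector is a joint eigenvector for the
first `m+1` elements with last eigenvalue the old one. -/
lemma JE.step (h : HeckeSys n q R) {m : ℕ} (hm : m + 1 < n) {a : ℕ → ℝ} {v : H}
    (hJ : JE q R (m+2) a v) :
    a (m+1) = q * a m ∨ a m = q * a (m+1) ∨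
      (a m ≠ a (m+1) ∧ ∃ v', JE q R (m+1) (Function.update a m (a (m+1))) v') := by
  have h1 := hJ.2 m (by omega)
  have h2 := hJ.2 (m+1) (by omega)
  have hab := eig_ne h hm hJ.1 h1 h2
  by_cases e1 : a (m+1) = q * a m
  · exact Or.inl e1
  by_cases e2 : a m = q * a (m+1)
  · exact Or.inr (Or.inl e2)
  refine Or.inr (Or.inr ⟨hab, R (m+1) v - kap q (a m) (a (m+1)) • v, ?_, ?_⟩)
  · intro h0
    have hn := swap_norm h hm h1 h2 hab
    rw [h0] at hn
    have hv : ‖v‖^2 ≠ 0 := by simpa using hJ.1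
    have h3 : q + kap q (a m) (a (m+1)) * (q - 1 - kap q (a m) (a (m+1))) = 0 := by
      have : (q + kap q (a m) (a (m+1)) * (q - 1 - kap q (a m) (a (m+1)))) * ‖v‖^2 = 0 := by
        rw [← hn]; simp
      exact (mul_eq_zero.1 this).resolve_right hv
    have h4 : (kap q (a m) (a (m+1)) - q) * (kap q (a m) (a (m+1)) + 1) = 0 := by linarith
    have hba : a (m+1) - a m ≠ 0 := sub_ne_zero.2 (Ne.symm hab)
    rcases mul_eq_zero.1 h4 with h5 | h5
    · apply e1
      have : kap q (a m) (a (m+1)) = q := by linarith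
      unfold kap at this; field_simp at this; linarith
    · apply e2
      have : kap q (a m) (a (m+1)) = -1 := by linarith
      unfold kap at this; field_simp at this; linarith
  · intro k hk
    rcases Nat.lt_or_ge k m with hk' | hk'
    · rw [Function.update_of_ne (by omega)]
      have hc := comm_hi h k (m+1) (by omega) hm
      have : LL R k (R (m+1) v) = R (m+1) (LL R k v) := by
        have := congrArg (fun f => f v) hc.eq
        simpa using this.symm
      rw [map_sub, this, hJ.2 k (by omega), map_smul, map_smul, hJ.2 k (by omega), smul_sub,
        smul_comm]
    · have : k = m := by omega
      subst this
      simp only [Function.update_self]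
      exact swap_lo h hm h1 h2 hab

end Hk


namespace Hk

variable {H : Type*} [NormedAddCommGroup H] [InnerProductSpace ℝ H]
variable {n : ℕ} {q : ℝ} {R : ℕ → Module.End ℝ H}

lemma JE.zero (h : HeckeSys n q R) (hn : 0 < n) {a : ℕ → ℝ} {v : H} (hJ : JE q R 1 a v) :
    a 0 = q ∨ a 0 = -1 := by
  have h1 : R 0 v = a 0 • v := by simpa [LL] using hJ.2 0 (by omega)
  have h2 := R_quad h hn v
  rw [h1, map_smul, h1, smul_smul, smul_smul, ← add_smul] at h2
  have h3 : a 0 * a 0 = (q - 1) * a 0 + q := smul_left_injective ℝ hJ.1 h2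
  have h4 : (a 0 - q) * (a 0 + 1) = 0 := by linarith
  rcases mul_eq_zero.1 h4 with h5 | h5
  · left; linarith
  · right; linarith

lemma JE.bound (h : HeckeSys n q R) (m : ℕ) (hm : m < n) {a : ℕ → ℝ} {v : H}
    (hJ : JE q R (m+1) a v) : (∀ j ≤ m, a j = q ^ (j+1)) ∨ |a m| ≤ q ^ m := by
  have hq := h.hq
  induction m generalizing a v with
  | zero =>
    rcases hJ.zero h hm with h1 | h1
    · left; intro j hj; have : j = 0 := by omega
      subst this; simp [h1]
    · right; simp [h1]
  | succ m ih =>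
    have hp : q ^ m ≤ q ^ (m+1) := pow_le_pow_right₀ hq.le (by omega)
    have ih1 := ih (by omega) (hJ.mono (m' := m+1) (by omega))
    rcases hJ.step h hm with h1 | h1 | ⟨-, v', h1⟩
    · rcases ih1 with h2 | h2
      · left; intro j hj
        rcases Nat.lt_or_ge m j with h3 | h3
        · have : j = m+1 := by omega
          subst this; rw [h1, h2 m le_rfl]; ring
        · exact h2 j h3
      · right; rw [h1, abs_mul, abs_of_pos (by linarith : (0:ℝ) < q), pow_succ, mul_comm]
        gcongr
    · right
      have h3 : |a m| ≤ q ^ (m+1) := by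
        rcases ih1 with h2 | h2
        · rw [h2 m le_rfl, abs_of_nonneg (by positivity)]
        · linarith
      have h4 : |a m| = q * |a (m+1)| := by
        rw [h1, abs_mul, abs_of_pos (by linarith : (0:ℝ) < q)]
      have : 0 ≤ |a (m+1)| := abs_nonneg _
      nlinarith
    · right
      have h2 := ih (by omega) h1
      simp only [Function.update_self] at h2
      rcases h2 with h2 | h2
      · have := h2 m le_rfl
        simp at this; rw [this, abs_of_nonneg (by positivity)]
      · linarith

lemma JE.pre_top (h : HeckeSys n q R) (m : ℕ) (hm : m < n) {a : ℕ → ℝ} {v : H}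
    (hJ : JE q R (m+1) a v) (hp : ∀ j < m, a j = q ^ (j+1)) :
    a m = q ^ (m+1) ∨ a m = 1 ∨ a m = -1 := by
  have hq := h.hq
  have hq0 : q ≠ 0 := by linarith
  induction m generalizing a v with
  | zero =>
    rcases hJ.zero h hm with h1 | h1
    · left; simp [h1]
    · right; right; exact h1
  | succ m ih =>
    have hm0 := hp m (by omega)
    rcases hJ.step h hm with h1 | h1 | ⟨hne, v', h1⟩
    · left; rw [h1, hm0]; ring
    · have h2 : a (m+1) = q ^ m := by
        rw [hm0, pow_succ, mul_comm] at h1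
        exact (mul_left_cancel₀ hq0 h1).symm
      rcases m with _ | m
      · right; left; simpa using h2
      · exfalso
        have e1 := R_eq_of_ratio' h hm (hJ.2 (m+1) (by omega)) (hJ.2 (m+2) (by omega)) hJ.1 h1
        have e2 := R_eq_of_ratio h (by omega) (hJ.2 m (by omega)) (hJ.2 (m+1) (by omega)) hJ.1
          (by rw [hm0, hp m (by omega)]; ring)
        have e3 := congrArg (fun f => f v) (h.braid (m+1) (by omega) hm)
        simp only [Module.End.mul_apply, e1, e2, map_smul, map_neg] at e3
        have e4 : (q ^ 2 + q) • v = 0 := by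
          rw [add_smul, pow_two, mul_smul]
          simp only [smul_neg, neg_neg] at e3
          have e6 := neg_eq_iff_add_eq_zero.1 e3
          exact e6
        rcases smul_eq_zero.1 e4 with e5 | e5
        · nlinarith
        · exact hJ.1 e5
    · have h2 := ih (by omega) h1 (fun j hj => by
        rw [Function.update_of_ne (by omega)]; exact hp j (by omega))
      simp only [Function.update_self] at h2
      rcases h2 with h2 | h2
      · exact absurd (h2.trans hm0.symm) (Ne.symm hne)
      · right; exact h2

/-- the bounding sequence -/
noncomputable def bet (q : ℝ) (k j : ℕ) : ℝ := if j < k then q ^ (j+1) else if j = k then 1 else q ^ j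

lemma prod_bet (q : ℝ) (k m : ℕ) : ∏ j ∈ Finset.range m, bet q k j =
    (if m ≤ k then q ^ m else 1) * ∏ j ∈ Finset.range m, q ^ j := by
  induction m with
  | zero => simp
  | succ m ih =>
    rw [Finset.prod_range_succ, Finset.prod_range_succ, ih]
    unfold bet
    rcases lt_trichotomy m k with h | h | h
    · rw [if_pos h.le, if_pos h, if_pos (by omega)]; ring
    · subst h; simp; ring
    · rw [if_neg (by omega), if_neg (by omega), if_neg (by omega), if_neg (by omega)]; ring

lemma prod_pow_sq (q : ℝ) (n : ℕ) :
    (∏ j ∈ Finset.range n, q ^ j) * ∏ j ∈ Finset.range n, q ^ j = q ^ (n * n - n) := by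
  rw [← mul_self_eq_mul_self_iff.2 (Or.inl rfl), Finset.prod_pow_eq_pow_sum, ← pow_add,
    ← mul_two, Finset.sum_range_id_mul_two]
  congr 1
  cases n
  · simp
  · simp only [Nat.add_sub_cancel, ]
    rw [← Nat.mul_sub_one]; simp

lemma JE.first (h : HeckeSys n q R) {m : ℕ} (hm : m ≤ n) {a : ℕ → ℝ} {v : H}
    (hJ : JE q R m a v) : (∀ j < m, a j = q ^ (j+1)) ∨
      ∃ k < m, (∀ j < k, a j = q ^ (j+1)) ∧ (a k = 1 ∨ a k = -1) ∧ ∀ j < m, |a j| ≤ bet q k j := by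
  have hq := h.hq
  by_cases ht : ∀ j < m, a j = q ^ (j+1)
  · exact Or.inl ht
  right
  have hex : ∃ j, j < m ∧ a j ≠ q ^ (j+1) := by push Not at ht; exact ht
  obtain ⟨hk1, hk2⟩ := Nat.find_spec hex
  set k := Nat.find hex with hk
  have hlt : ∀ j < k, a j = q ^ (j+1) := fun j hj => by
    have := Nat.find_min hex hj
    push Not at this
    exact this (by omega)
  have hak := ((hJ.mono (m' := k+1) (by omega)).pre_top h k (by omega) hlt).resolve_left hk2
  refine ⟨k, hk1, hlt, hak, fun j hj => ?_⟩
  unfold bet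
  split_ifs with h1 h2
  · rw [hlt j h1, abs_of_nonneg (by positivity)]
  · subst h2; rcases hak with h3 | h3 <;> rw [h3] <;> simp
  · rcases (hJ.mono (m' := j+1) (by omega)).bound h j (by omega) with h3 | h3
    · exact absurd (h3 k (by omega)) hk2
    · exact h3

/-- the exceptional eigenvalue sequences -/
noncomputable def eig (q : ℝ) (k j : ℕ) : ℝ := if j < k then q ^ (j+1) else if j = k then -1 else q ^ j

lemma bet_pos {q : ℝ} (hq : 1 < q) (k j : ℕ) : 0 < bet q k j := by
  unfold bet; split_ifs <;> positivity

lemma JE.prod_le (h : HeckeSys n q R) {a : ℕ → ℝ} {v : H}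
    (hJ : JE q R n a v) : (∀ j < n, a j = q ^ (j+1)) ∨
      |∏ k ∈ Finset.range n, (q ^ k * a k)| ≤ q ^ (n * n - n) := by
  have hq := h.hq
  rcases hJ.first h le_rfl with h1 | ⟨k, hk, h1, h2, h3⟩
  · exact Or.inl h1
  right
  rw [Finset.prod_mul_distrib, abs_mul, abs_of_nonneg (Finset.prod_nonneg fun i _ => by positivity),
    Finset.abs_prod, ← prod_pow_sq]
  have : ∏ j ∈ Finset.range n, |a j| ≤ ∏ j ∈ Finset.range n, bet q k j :=
    Finset.prod_le_prod (fun _ _ => abs_nonneg _) fun i hi => h3 i (Finset.mem_range.1 hi)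
  rw [prod_bet, if_neg (by omega), one_mul] at this
  exact mul_le_mul_of_nonneg_left this (Finset.prod_nonneg fun i _ => by positivity)

lemma JE.signs (h : HeckeSys n q R) {a : ℕ → ℝ} {v : H}
    (hJ : JE q R n a v) {k : ℕ} (hk : k < n) (hlt : ∀ j < k, a j = q ^ (j+1))
    (hak : a k = 1 ∨ a k = -1) (habs : ∀ j < n, k < j → |a j| = q ^ j) :
    (∀ j < n, k < j → a j = q ^ j) ∨ (k = 0 ∧ a 0 = -1 ∧ ∀ j < n, k < j → a j = - q ^ j) := by
  have hq := h.hq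
  have hq0 : q ≠ 0 := by linarith
  have hnt : a k ≠ q ^ (k+1) := by
    have : 1 < q ^ (k+1) := one_lt_pow₀ hq (by omega)
    rcases hak with h1 | h1 <;> rw [h1] <;> linarith
  have hstart : k + 1 < n → a (k+1) = q ^ (k+1) ∨ (k = 0 ∧ a 0 = -1 ∧ a (k+1) = - q ^ (k+1)) := by
    intro hk1
    have hb := habs (k+1) hk1 (by omega)
    have hak1 : |a k| = 1 := by rcases hak with h1 | h1 <;> rw [h1] <;> simp
    rcases (hJ.mono (m' := k+2) (by omega)).step h hk1 with h1 | h1 | ⟨hne, v', h1⟩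
    · have h2 : q ^ (k+1) = q ^ 1 := by
        rw [← hb, h1, abs_mul, hak1, abs_of_pos (by linarith : (0:ℝ) < q)]; simp
      have hk0 : k + 1 = 1 := pow_right_injective₀ (by linarith : (0:ℝ) < q) hq.ne' h2
      have hk00 : k = 0 := by omega
      subst hk00
      right
      have h3 := (hJ.mono (m' := 1) (by omega)).zero h hk
      have h4 : a 0 = -1 := h3.resolve_left (by simpa using hnt)
      refine ⟨rfl, h4, ?_⟩
      rw [h1, h4]; ring
    · exfalso
      have : |a k| = q * q ^ (k+1) := by
        rw [h1, abs_mul, hb, abs_of_pos (by linarith : (0:ℝ) < q)]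
      rw [hak1] at this
      have : 1 < q ^ (k+1) := one_lt_pow₀ hq (by omega)
      nlinarith
    · have h2 := h1.pre_top h k hk (fun j hj => by
        rw [Function.update_of_ne (by omega)]; exact hlt j hj)
      simp only [Function.update_self] at h2
      have : 1 < q ^ (k+1) := one_lt_pow₀ hq (by omega)
      rcases h2 with h2 | h2 | h2
      · exact Or.inl h2
      · rw [h2] at hb; simp at hb; linarith
      · rw [h2] at hb; simp at hb; linarith
  have hprop : ∀ j, k < j → j + 1 < n → a (j+1) = q * a j := by
    intro j hj hjn
    have hb := habs (j+1) hjn (by omega)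
    have hb' := habs j (by omega) hj
    have hqj : 0 < q ^ j := by positivity
    rcases (hJ.mono (m' := j+2) (by omega)).step h hjn with h1 | h1 | ⟨hne, v', h1⟩
    · exact h1
    · exfalso
      rw [h1, abs_mul, hb, abs_of_pos (by linarith : (0:ℝ) < q), pow_succ] at hb'
      nlinarith [mul_pos hqj (by linarith : (0:ℝ) < q)]
    · exfalso
      rcases h1.bound h j (by omega) with h2 | h2
      · have := h2 k (by omega)
        rw [Function.update_of_ne (by omega)] at this
        exact hnt this
      · simp only [Function.update_self] at h2
        rw [hb, pow_succ] at h2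
        nlinarith
  by_cases hk1 : k + 1 < n
  · rcases hstart hk1 with h1 | ⟨h1, h2, h3⟩
    · left
      intro j hj hkj
      induction j with
      | zero => omega
      | succ j ih =>
        rcases Nat.lt_or_ge k j with h4 | h4
        · rw [hprop j h4 hj, ih (by omega) h4]; ring
        · have : j = k := by omega
          subst this; exact h1
    · right
      refine ⟨h1, h2, ?_⟩
      intro j hj hkj
      induction j with
      | zero => omega
      | succ j ih =>
        rcases Nat.lt_or_ge k j with h4 | h4
        · rw [hprop j h4 hj, ih (by omega) h4]; ring
        · have : j = k := by omega
          subst this; exact h3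
  · left; intro j hj hkj; omega

lemma JE.class (h : HeckeSys n q R) {a : ℕ → ℝ} {v : H}
    (hJ : JE q R n a v) (hprod : ∏ k ∈ Finset.range n, (q ^ k * a k) = - q ^ (n * n - n)) :
    (∃ k < n, ∀ j < n, a j = eig q k j) ∨ (0 < n ∧ ∀ j < n, a j = - q ^ j) := by
  have hq := h.hq
  have hneg : ∏ k ∈ Finset.range n, (q ^ k * a k) < 0 := by
    rw [hprod]; have : 0 < q ^ (n * n - n) := by positivity
    linarith
  rcases hJ.first h le_rfl with h1 | ⟨k, hk, h1, h2, h3⟩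
  · exfalso
    have : 0 ≤ ∏ k ∈ Finset.range n, (q ^ k * a k) := Finset.prod_nonneg fun i hi => by
      rw [h1 i (Finset.mem_range.1 hi)]; positivity
    linarith
  have hpp : 0 < ∏ j ∈ Finset.range n, q ^ j := Finset.prod_pos fun i _ => by positivity
  have heq : ∏ j ∈ Finset.range n, |a j| = ∏ j ∈ Finset.range n, bet q k j := by
    rw [prod_bet, if_neg (by omega), one_mul]
    have := congrArg abs hprod
    rw [Finset.prod_mul_distrib, abs_mul, abs_of_pos hpp, abs_neg, abs_of_nonneg (a := q ^ (n * n - n)) (by positivity),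
      Finset.abs_prod, ← prod_pow_sq] at this
    exact mul_left_cancel₀ hpp.ne' this
  have hapos : ∀ j < n, 0 < |a j| := by
    intro j hj
    rw [abs_pos]
    intro h0
    have : ∏ k ∈ Finset.range n, (q ^ k * a k) = 0 :=
      Finset.prod_eq_zero (Finset.mem_range.2 hj) (by rw [h0]; simp)
    linarith
  have hbeq : ∀ j < n, |a j| = bet q k j := by
    by_contra hcon
    push Not at hcon
    obtain ⟨j, hj, hne⟩ := hcon
    have := Finset.prod_lt_prod (s := Finset.range n) (f := fun j => |a j|) (g := bet q k)
      (fun i hi => hapos i (Finset.mem_range.1 hi))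
      (fun i hi => h3 i (Finset.mem_range.1 hi)) ⟨j, Finset.mem_range.2 hj, lt_of_le_of_ne (h3 j hj) hne⟩
    linarith
  have hs := hJ.signs h hk h1 h2 (fun j hj hkj => by
    rw [hbeq j hj]; unfold bet; rw [if_neg (by omega), if_neg (by omega)])
  rcases hs with hs | ⟨hk0, ha0, hs⟩
  · left
    have hak : a k = -1 := by
      rcases h2 with h2 | h2
      · exfalso
        have : 0 ≤ ∏ k ∈ Finset.range n, (q ^ k * a k) := Finset.prod_nonneg fun i hi => by
          have hi' := Finset.mem_range.1 hi
          rcases lt_trichotomy i k with h4 | h4 | h4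
          · rw [h1 i h4]; positivity
          · rw [h4, h2]; positivity
          · rw [hs i hi' h4]; positivity
        linarith
      · exact h2
    refine ⟨k, hk, fun j hj => ?_⟩
    unfold eig
    split_ifs with h4 h5
    · exact h1 j h4
    · rw [h5, hak]
    · exact hs j hj (by omega)
  · right
    refine ⟨by omega, fun j hj => ?_⟩
    subst hk0
    rcases Nat.eq_zero_or_pos j with h4 | h4
    · subst h4; rw [ha0]; simp
    · exact hs j hj h4

end Hk


namespace Hk

variable {H : Type*} [NormedAddCommGroup H] [InnerProductSpace ℝ H]
variable {n : ℕ} {q : ℝ} {R : ℕ → Module.End ℝ H}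

/-- joint eigenspace -/
def EV (n : ℕ) (q : ℝ) (R : ℕ → Module.End ℝ H) (a : ℕ → ℝ) : Submodule ℝ H where
  carrier := {v | ∀ j < n, LL R j v = (q ^ j * a j) • v}
  add_mem' := by
    intro x y hx hy j hj
    rw [map_add, hx j hj, hy j hj, smul_add]
  zero_mem' := by intro j _; simp
  smul_mem' := by
    intro c x hx j hj
    rw [map_smul, hx j hj, smul_comm]

lemma mem_EV {a : ℕ → ℝ} {v : H} : v ∈ EV n q R a ↔ ∀ j < n, LL R j v = (q ^ j * a j) • v :=
  Iff.rfl

lemma EV_congr {a b : ℕ → ℝ} (hab : ∀ j < n, a j = b j) : EV n q R a = EV n q R b := by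
  ext v; simp only [mem_EV]
  exact forall₂_congr fun j hj => by rw [hab j hj]

lemma EV_orth (h : HeckeSys n q R) {a b : ℕ → ℝ} {x y : H} (hx : x ∈ EV n q R a)
    (hy : y ∈ EV n q R b) {j : ℕ} (hj : j < n) (hab : a j ≠ b j) : inner ℝ x y = 0 := by
  have hq := h.hq
  refine orth_of_ne (LL_sym h j hj) (hx j hj) (hy j hj) ?_
  have : q ^ j ≠ 0 := by positivity
  exact fun e => hab (mul_left_cancel₀ this e)

lemma TT_EV {a : ℕ → ℝ} {v : H} (hv : v ∈ EV n q R a) {m : ℕ} (hm : m ≤ n) :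
    TT R m v = (∏ k ∈ Finset.range m, (q ^ k * a k)) • v := by
  induction m with
  | zero => simp [TT]
  | succ m ih =>
    rw [TT, Module.End.mul_apply, ih (by omega), map_smul, hv m (by omega), smul_smul,
      Finset.prod_range_succ]

lemma inner_orth_sum {ι : Type*} (s : Finset ι) (y : ι → H) 
    (ho : ∀ i ∈ s, ∀ j ∈ s, i ≠ j → inner ℝ (y i) (y j) = 0) (a b : ι → ℝ) :
    inner ℝ (∑ i ∈ s, a i • y i) (∑ i ∈ s, b i • y i) = ∑ i ∈ s, a i * b i * ‖y i‖^2 := by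
  rw [sum_inner]
  refine Finset.sum_congr rfl fun i hi => ?_
  rw [inner_sum, Finset.sum_eq_single i]
  · rw [inner_smul_left, inner_smul_right, real_inner_self_eq_norm_sq]; simp; ring
  · intro j hj hji
    rw [inner_smul_left, inner_smul_right, ho i hi j hj (Ne.symm hji)]; simp
  · intro h; exact absurd hi h

lemma norm_orth_sum {ι : Type*} (s : Finset ι) (y : ι → H) 
    (ho : ∀ i ∈ s, ∀ j ∈ s, i ≠ j → inner ℝ (y i) (y j) = 0) :
    ‖∑ i ∈ s, y i‖^2 = ∑ i ∈ s, ‖y i‖^2 := by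
  have := inner_orth_sum s y ho (fun _ => 1) (fun _ => 1)
  simp only [one_smul, one_mul] at this
  rw [← this, real_inner_self_eq_norm_sq]

lemma decomp [FiniteDimensional ℝ H] (h : HeckeSys n q R) (x : H) :
    ∃ (s : Finset (ℕ → ℝ)) (y : (ℕ → ℝ) → H), x = ∑ a ∈ s, y a ∧
      (∀ a ∈ s, y a ∈ EV n q R a ∧ y a ≠ 0) ∧
      ∀ a ∈ s, ∀ b ∈ s, a ≠ b → inner ℝ (y a) (y b) = 0 := by
  have hq := h.hq
  have htop := LinearMap.IsSymmetric.iSup_iInf_eq_top_of_commute (𝕜 := ℝ) (E := H)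
    (T := fun k : Fin n => LL R k) (fun k => LL_sym h k k.2)
    (fun i j _ => LL_comm h i j i.2 j.2)
  have hx : x ∈ (⨆ χ : Fin n → ℝ, ⨅ i : Fin n, Module.End.eigenspace (LL R (i : ℕ)) (χ i)) := by
    rw [htop]; trivial
  rw [Submodule.mem_iSup_iff_exists_finsupp] at hx
  obtain ⟨f, hf, hsum⟩ := hx
  have hinj : Function.Injective (fun (χ : Fin n → ℝ) (k : ℕ) =>
      if hk : k < n then χ ⟨k, hk⟩ / q ^ k else 0) := by
    intro χ χ' he
    funext k
    have := congrFun he k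
    simp only [k.2, dif_pos] at this
    have hqk : q ^ (k : ℕ) ≠ 0 := by positivity
    field_simp at this
    exact this
  let e : (Fin n → ℝ) ↪ (ℕ → ℝ) := ⟨_, hinj⟩
  have hmem : ∀ χ ∈ f.support, f χ ∈ EV n q R (e χ) ∧ f χ ≠ 0 := by
    intro χ hχ
    refine ⟨fun j hj => ?_, Finsupp.mem_support_iff.1 hχ⟩
    have h1 := hf χ
    rw [Submodule.mem_iInf] at h1
    have h2 := Module.End.mem_eigenspace_iff.1 (h1 ⟨j, hj⟩)
    have hqk : q ^ (j : ℕ) ≠ 0 := by positivity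
    simp only [e, Function.Embedding.coeFn_mk, hj, dif_pos]
    rw [mul_div_cancel₀ _ hqk]
    exact h2
  refine ⟨f.support.map e, fun a => f (Function.invFun e a), ?_, ?_, ?_⟩
  · rw [Finset.sum_map, ← hsum, Finsupp.sum]
    refine Finset.sum_congr rfl fun χ _ => ?_
    rw [Function.leftInverse_invFun e.injective]
  · intro a ha
    obtain ⟨χ, hχ, rfl⟩ := Finset.mem_map.1 ha
    beta_reduce
    rw [Function.leftInverse_invFun e.injective]
    exact hmem χ hχ
  · intro a ha b hb hab
    obtain ⟨χ, hχ, rfl⟩ := Finset.mem_map.1 ha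
    obtain ⟨χ', hχ', rfl⟩ := Finset.mem_map.1 hb
    beta_reduce
    rw [Function.leftInverse_invFun e.injective, Function.leftInverse_invFun e.injective]
    have : ∃ j : Fin n, χ j ≠ χ' j := by
      by_contra hc
      push Not at hc
      exact hab (by rw [funext hc])
    obtain ⟨j, hj⟩ := this
    refine EV_orth h (hmem χ hχ).1 (hmem χ' hχ').1 j.2 ?_
    have hqk : q ^ (j : ℕ) ≠ 0 := by positivity
    simp only [e, Function.Embedding.coeFn_mk, j.2, dif_pos]
    intro h0
    field_simp at h0
    exact hj h0

/-- product eigenvalue -/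
noncomputable def tau (n : ℕ) (q : ℝ) (a : ℕ → ℝ) : ℝ := ∏ k ∈ Finset.range n, (q ^ k * a k)

lemma tau_ge (h : HeckeSys n q R) {a : ℕ → ℝ} {v : H} (hv : v ∈ EV n q R a) (h0 : v ≠ 0) :
    - q ^ (n * n - n) ≤ tau n q a := by
  have hq := h.hq
  have hJ : JE q R n a v := ⟨h0, hv⟩
  rcases hJ.prod_le h with h1 | h1
  · have : 0 ≤ tau n q a := Finset.prod_nonneg fun i hi => by
      rw [h1 i (Finset.mem_range.1 hi)]; positivity
    have : 0 ≤ q ^ (n * n - n) := by positivity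
    linarith
  · exact (abs_le.1 h1).1

theorem A1 [FiniteDimensional ℝ H] (h : HeckeSys n q R) (x : H) :
    0 ≤ inner ℝ x (TT R n x) + q ^ (n * n - n) * ‖x‖^2 ∧
    (inner ℝ x (TT R n x) + q ^ (n * n - n) * ‖x‖^2 = 0 → 
      TT R n x = (- q ^ (n * n - n)) • x) := by
  obtain ⟨s, y, hx, hy, ho⟩ := decomp h x
  have hT : TT R n x = ∑ a ∈ s, tau n q a • y a := by
    conv_lhs => rw [hx]
    rw [map_sum]
    exact Finset.sum_congr rfl fun a ha => TT_EV (hy a ha).1 le_rfl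
  have hx1 : x = ∑ a ∈ s, (1:ℝ) • y a := by simpa using hx
  have e1 : inner ℝ x (TT R n x) = ∑ a ∈ s, tau n q a * ‖y a‖^2 := by
    rw [hT]; conv_lhs => rw [hx1]
    rw [inner_orth_sum s y ho]; simp
  have e2 : ‖x‖^2 = ∑ a ∈ s, ‖y a‖^2 := by
    conv_lhs => rw [hx]
    exact norm_orth_sum s y ho
  have e3 : inner ℝ x (TT R n x) + q ^ (n * n - n) * ‖x‖^2
      = ∑ a ∈ s, (tau n q a + q ^ (n * n - n)) * ‖y a‖^2 := by
    rw [e1, e2, Finset.mul_sum, ← Finset.sum_add_distrib]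
    exact Finset.sum_congr rfl fun a _ => by ring
  have hnn : ∀ a ∈ s, 0 ≤ (tau n q a + q ^ (n * n - n)) * ‖y a‖^2 := fun a ha => by
    have := tau_ge h (hy a ha).1 (hy a ha).2
    have : 0 ≤ tau n q a + q ^ (n * n - n) := by linarith
    positivity
  rw [e3]
  refine ⟨Finset.sum_nonneg hnn, fun h0 => ?_⟩
  rw [Finset.sum_eq_zero_iff_of_nonneg hnn] at h0
  rw [hT]; conv_rhs => rw [hx]
  rw [Finset.smul_sum]
  refine Finset.sum_congr rfl fun a ha => ?_
  rcases mul_eq_zero.1 (h0 a ha) with h1 | h1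
  · congr 1; linarith
  · have : y a = 0 := by simpa using h1
    exact absurd this (hy a ha).2

lemma inv_of_top (h : HeckeSys n q R) {a : ℕ → ℝ} {v : H} (hv : v ∈ EV n q R a) (h0 : v ≠ 0)
    (ha : ∀ j < n, a j = q ^ (j+1)) : ∀ j < n, R j v = q • v := by
  intro j hj
  rcases j with _ | j
  · have := hv 0 hj
    rw [ha 0 hj] at this
    simpa [LL] using this
  · exact R_eq_of_ratio h hj (hv j (by omega)) (hv (j+1) hj) h0
      (by rw [ha j (by omega), ha (j+1) hj]; ring)

theorem A2 [FiniteDimensional ℝ H] (h : HeckeSys n q R) (x : H)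
    (hx0 : ∀ u : H, (∀ j < n, R j u = q • u) → inner ℝ x u = 0) :
    ‖TT R n x‖ ≤ q ^ (n * n - n) * ‖x‖ := by
  have hq := h.hq
  obtain ⟨s, y, hx, hy, ho⟩ := decomp h x
  have hT : TT R n x = ∑ a ∈ s, tau n q a • y a := by
    conv_lhs => rw [hx]
    rw [map_sum]
    exact Finset.sum_congr rfl fun a ha => TT_EV (hy a ha).1 le_rfl
  have e2 : ‖x‖^2 = ∑ a ∈ s, ‖y a‖^2 := by
    conv_lhs => rw [hx]
    exact norm_orth_sum s y ho
  have hx1 : x = ∑ a ∈ s, (1:ℝ) • y a := by simpa using hx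
  have e1 : ‖TT R n x‖^2 = ∑ a ∈ s, (tau n q a)^2 * ‖y a‖^2 := by
    rw [hT, ← real_inner_self_eq_norm_sq, inner_orth_sum s y ho]
    exact Finset.sum_congr rfl fun a _ => by ring
  have hle : ∀ a ∈ s, |tau n q a| ≤ q ^ (n * n - n) := by
    intro a ha
    have hJ : JE q R n a (y a) := ⟨(hy a ha).2, (hy a ha).1⟩
    rcases hJ.prod_le h with h1 | h1
    · exfalso
      have h2 := hx0 _ (inv_of_top h (hy a ha).1 (hy a ha).2 h1)
      rw [hx, sum_inner, Finset.sum_eq_single a] at h2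
      · exact (hy a ha).2 (by simpa using h2)
      · intro b hb hba; exact ho b hb a ha hba
      · intro h3; exact absurd ha h3
    · exact h1
  have hfin : ‖TT R n x‖^2 ≤ (q ^ (n * n - n) * ‖x‖)^2 := by
    rw [e1, mul_pow, e2, Finset.mul_sum]
    refine Finset.sum_le_sum fun a ha => ?_
    have := sq_le_sq' (abs_le.1 (hle a ha)).1 (abs_le.1 (hle a ha)).2
    gcongr
  exact (sq_le_sq₀ (norm_nonneg _) (by positivity)).1 hfin

/-- decomposition of a minimal eigenvector -/
lemma min_decomp [FiniteDimensional ℝ H] (h : HeckeSys n q R) (x : H)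
    (hT : TT R n x = (- q ^ (n * n - n)) • x) :
    ∃ (g : ℕ → H) (gs : H), x = ∑ k ∈ Finset.range n, g k + gs ∧
      (∀ k < n, g k ∈ EV n q R (eig q k)) ∧ gs ∈ EV n q R (fun j => - q ^ j) ∧
      TT R n gs = (- q ^ (n * n - n)) • gs := by
  have hq := h.hq
  obtain ⟨s, y, hx, hy, ho⟩ := decomp h x
  have hT' : TT R n x = ∑ a ∈ s, tau n q a • y a := by
    conv_lhs => rw [hx]
    rw [map_sum]
    exact Finset.sum_congr rfl fun a ha => TT_EV (hy a ha).1 le_rfl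
  have htau : ∀ a ∈ s, tau n q a = - q ^ (n * n - n) := by
    intro a ha
    have e1 : inner ℝ (TT R n x) (y a) = tau n q a * ‖y a‖^2 := by
      rw [hT', sum_inner, Finset.sum_eq_single a]
      · rw [inner_smul_left, real_inner_self_eq_norm_sq]; simp
      · intro b hb hba; rw [inner_smul_left, ho b hb a ha hba]; simp
      · intro h3; exact absurd ha h3
    have e2 : inner ℝ (TT R n x) (y a) = - q ^ (n * n - n) * ‖y a‖^2 := by
      rw [hT, hx, Finset.smul_sum, sum_inner, Finset.sum_eq_single a]
      · rw [inner_smul_left, real_inner_self_eq_norm_sq]; simp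
      · intro b hb hba; rw [inner_smul_left, ho b hb a ha hba]; simp
      · intro h3; exact absurd ha h3
    have h0 : ‖y a‖^2 ≠ 0 := by simpa using (hy a ha).2
    exact mul_right_cancel₀ h0 (e1.symm.trans e2)
  -- classification
  suffices hs : ∀ t : Finset (ℕ → ℝ), t ⊆ s → ∃ (g : ℕ → H) (gs : H),
      ∑ a ∈ t, y a = ∑ k ∈ Finset.range n, g k + gs ∧
      (∀ k < n, g k ∈ EV n q R (eig q k)) ∧ gs ∈ EV n q R (fun j => - q ^ j) ∧
      TT R n gs = (- q ^ (n * n - n)) • gs by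
    rw [hx]; exact hs s (Finset.Subset.refl _)
  intro t
  induction t using Finset.induction_on with
  | empty => 
    intro _
    exact ⟨fun _ => 0, 0, by simp, fun k _ => Submodule.zero_mem _, Submodule.zero_mem _, by simp⟩
  | insert a t hat ih =>
    intro hts
    obtain ⟨g, gs, h1, h2, h3, h4⟩ := ih (fun b hb => hts (Finset.mem_insert_of_mem hb))
    have ha := hts (Finset.mem_insert_self a t)
    have hJ : JE q R n a (y a) := ⟨(hy a ha).2, (hy a ha).1⟩
    rw [Finset.sum_insert hat, h1]
    rcases hJ.class h (htau a ha) with ⟨k, hk, h5⟩ | ⟨hn0, h5⟩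
    · refine ⟨fun j => g j + if j = k then y a else 0, gs, ?_, ?_, h3, h4⟩
      · rw [Finset.sum_add_distrib, Finset.sum_ite_eq' , if_pos (Finset.mem_range.2 hk)]
        abel
      · intro j hj
        refine Submodule.add_mem _ (h2 j hj) ?_
        split_ifs with h6
        · subst h6; rw [← EV_congr h5]; exact (hy a ha).1
        · exact Submodule.zero_mem _
    · refine ⟨g, gs + y a, by abel, h2, Submodule.add_mem _ h3 ?_, ?_⟩
      · rw [← EV_congr h5]; exact (hy a ha).1
      · rw [map_add, h4, TT_EV (hy a ha).1 le_rfl, smul_add]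
        congr 2; exact htau a ha

end Hk


namespace Hk

variable {H : Type*} [NormedAddCommGroup H] [InnerProductSpace ℝ H]
variable {n : ℕ} {q : ℝ} {R : ℕ → Module.End ℝ H}

lemma eig_lt {q : ℝ} {k j : ℕ} (h : j < k) : eig q k j = q ^ (j+1) := by simp [eig, h]
lemma eig_self {q : ℝ} {k : ℕ} : eig q k k = -1 := by simp [eig]
lemma eig_gt {q : ℝ} {k j : ℕ} (h : k < j) : eig q k j = q ^ j := by
  unfold eig; rw [if_neg (by omega), if_neg (by omega)]

lemma E_inv (h : HeckeSys n q R) {k : ℕ} {v : H} (hv : v ∈ EV n q R (eig q k)) {j : ℕ} (hj : j < n)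
    (h1 : j ≠ k) (h2 : j ≠ k + 1) : R j v = q • v := by
  rcases eq_or_ne v 0 with h0 | h0
  · subst h0; simp
  rcases j with _ | j
  · have := hv 0 hj
    rw [eig_lt (by omega)] at this
    simpa [LL] using this
  · refine R_eq_of_ratio h hj (hv j (by omega)) (hv (j+1) hj) h0 ?_
    rcases Nat.lt_or_ge j k with h3 | h3
    · rw [eig_lt (by omega), eig_lt h3]; ring
    · rw [eig_gt (by omega), eig_gt (by omega)]; ring

lemma S_inv (h : HeckeSys n q R) {v : H} (hv : v ∈ EV n q R (fun j => - q ^ j)) {j : ℕ} (hj : j < n)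
    (h1 : j ≠ 0) : R j v = q • v := by
  rcases eq_or_ne v 0 with h0 | h0
  · subst h0; simp
  rcases j with _ | j
  · omega
  · exact R_eq_of_ratio h hj (hv j (by omega)) (hv (j+1) hj) h0 (by ring)

lemma E_orth (h : HeckeSys n q R) {k l : ℕ} {v w : H} (hv : v ∈ EV n q R (eig q k))
    (hw : w ∈ EV n q R (eig q l)) (hk : k < n) (hl : l < n) (hkl : k ≠ l) : inner ℝ v w = 0 := by
  have hq := h.hq
  refine EV_orth h hv hw hk ?_
  rw [eig_self]
  have : ∀ i, 0 < q ^ i := fun i => by positivity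
  rcases Nat.lt_or_gt_of_ne hkl with h1 | h1
  · rw [eig_lt h1]; linarith [this (k+1)]
  · rw [eig_gt h1]; linarith [this k]

lemma tau_eig {k : ℕ} (hk : k < n) : tau n q (eig q k) = - q ^ (n * n - n) := by
  have : ∀ m, ∏ j ∈ Finset.range m, eig q k j
      = (if m ≤ k then 1 else -1) * ∏ j ∈ Finset.range m, bet q k j := by
    intro m
    induction m with
    | zero => simp
    | succ m ih =>
      rw [Finset.prod_range_succ, Finset.prod_range_succ, ih]
      unfold eig bet
      rcases lt_trichotomy m k with h | h | h
      · rw [if_pos h.le, if_pos h, if_pos (by omega)]; simp [h]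
      · subst h; simp
      · rw [if_neg (by omega), if_neg (by omega), if_neg (by omega), if_neg (by omega)]
        simp only [if_neg (show ¬ m < k by omega), if_neg (show ¬ m = k by omega)]; ring
  unfold tau
  rw [Finset.prod_mul_distrib, this, if_neg (by omega), prod_bet, if_neg (by omega), ← prod_pow_sq]
  ring

lemma E_TT {k : ℕ} (hk : k < n) {v : H} (hv : v ∈ EV n q R (eig q k)) :
    TT R n v = (- q ^ (n * n - n)) • v := by
  rw [TT_EV hv le_rfl]; congr 1; exact tau_eig hk

/-- the constant for step `k` -/
noncomputable def kp (q : ℝ) (k : ℕ) : ℝ := kap q (-1) (q ^ (k+1))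

lemma kp_eq (q : ℝ) (k : ℕ) : kp q k = (q-1) * q ^ (k+1) / (q ^ (k+1) + 1) := by
  unfold kp kap; rw [sub_neg_eq_add]

lemma kp_pos {q : ℝ} (hq : 1 < q) (k : ℕ) : 0 ≤ kp q k := by
  rw [kp_eq]
  have : 0 ≤ q - 1 := by linarith
  positivity

/-- chain map -/
noncomputable def nx (q : ℝ) (R : ℕ → Module.End ℝ H) (k : ℕ) (v : H) : H :=
  (1 + kp q k)⁻¹ • (R (k+1) v - kp q k • v)

lemma nx_mem (h : HeckeSys n q R) {k : ℕ} (hk : k + 1 < n) {v : H}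
    (hv : v ∈ EV n q R (eig q k)) : nx q R k v ∈ EV n q R (eig q (k+1)) := by
  have hq := h.hq
  have e1 := hv k (by omega)
  have e2 := hv (k+1) hk
  rw [eig_self] at e1
  rw [eig_gt (by omega)] at e2
  have hab : (-1 : ℝ) ≠ q ^ (k+1) := by
    have : 0 < q ^ (k+1) := by positivity
    linarith
  refine Submodule.smul_mem _ _ ?_
  intro j hj
  have hcomm : Commute (R (k+1)) (LL R j) → LL R j (R (k+1) v - kp q k • v)
      = (q ^ j * eig q k j) • (R (k+1) v - kp q k • v) := by
    intro hc
    have : LL R j (R (k+1) v) = R (k+1) (LL R j v) := by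
      have := congrArg (fun f => f v) hc.eq
      simpa using this.symm
    rw [map_sub, this, map_smul, hv j hj, map_smul, smul_sub, smul_comm]
  rcases lt_trichotomy j k with h1 | h1 | h1
  · rw [hcomm (comm_hi h j (k+1) (by omega) hk), eig_lt h1, eig_lt (by omega)]
  · subst h1
    rw [eig_lt (by omega)]
    exact swap_lo h hk e1 e2 hab
  · rcases Nat.lt_or_ge (k+1) j with h2 | h2
    · rw [hcomm (comm_lo h j (k+1) h2 hj), eig_gt h1, eig_gt h2]
    · have : j = k+1 := by omega
      subst this
      rw [eig_self]
      exact swap_hi h hk e1 e2 hab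

lemma nx_norm (h : HeckeSys n q R) {k : ℕ} (hk : k + 1 < n) {v : H}
    (hv : v ∈ EV n q R (eig q k)) : ‖nx q R k v‖^2 = (q + q ^ (k+1)) / (1 + q * q ^ (k+1)) * ‖v‖^2 := by
  have hq := h.hq
  have e1 := hv k (by omega)
  have e2 := hv (k+1) hk
  rw [eig_self] at e1
  rw [eig_gt (by omega)] at e2
  have hQ : 0 < q ^ (k+1) := by positivity
  have hab : (-1 : ℝ) ≠ q ^ (k+1) := by linarith
  have hn := swap_norm h hk e1 e2 hab
  have hk0 := kp_pos hq k
  unfold nx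
  rw [norm_smul, mul_pow]
  unfold kp at *
  rw [hn, Real.norm_eq_abs, sq_abs, ← mul_assoc]
  congr 1
  have h1 : 1 + kap q (-1) (q ^ (k+1)) ≠ 0 := by linarith
  have h2 : 1 + q * q ^ (k+1) ≠ 0 := by positivity
  have h3 : (1 + kap q (-1) (q ^ (k+1))) * (q ^ (k+1) + 1) = 1 + q * q ^ (k+1) := by
    unfold kap; rw [sub_neg_eq_add]; field_simp; ring
  have h4 : (q - kap q (-1) (q ^ (k+1))) * (q ^ (k+1) + 1) = q + q ^ (k+1) := by
    unfold kap; rw [sub_neg_eq_add]; field_simp; ring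
  have h5 : q ^ (k+1) + 1 ≠ 0 := by positivity
  rw [← h3, ← h4]
  generalize kap q (-1) (q ^ (k+1)) = κ at *
  field_simp
  ring

lemma nx_norm_le (h : HeckeSys n q R) {k : ℕ} (hk : k + 1 < n) {v : H}
    (hv : v ∈ EV n q R (eig q k)) : ‖nx q R k v‖^2 ≤ 2 / q * ‖v‖^2 := by
  have hq := h.hq
  rw [nx_norm h hk hv]
  have hQ : q ^ 1 ≤ q ^ (k+1) := pow_le_pow_right₀ hq.le (by omega)
  rw [pow_one] at hQ
  have : (q + q ^ (k+1)) / (1 + q * q ^ (k+1)) ≤ 2 / q := by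
    rw [div_le_div_iff₀ (by positivity) (by positivity)]
    nlinarith
  gcongr

lemma nx_norm_ge (h : HeckeSys n q R) {k : ℕ} (hk : k + 1 < n) {v : H}
    (hv : v ∈ EV n q R (eig q k)) : ‖v‖^2 ≤ q * ‖nx q R k v‖^2 := by
  have hq := h.hq
  rw [nx_norm h hk hv, ← mul_assoc]
  have hQ : 0 < q ^ (k+1) := by positivity
  have : 1 ≤ q * ((q + q ^ (k+1)) / (1 + q * q ^ (k+1))) := by
    rw [← mul_div_assoc, le_div_iff₀ (by positivity)]
    nlinarith
  nlinarith [sq_nonneg ‖v‖]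

lemma nx_inv (h : HeckeSys n q R) {k : ℕ} (hk : k + 1 < n) {v : H} :
    R (k+1) (v + nx q R k v) = q • (v + nx q R k v) := by
  have hq := h.hq
  have hk0 := kp_pos hq k
  have h1 : 1 + kp q k ≠ 0 := by linarith
  have e : v + nx q R k v = (1 + kp q k)⁻¹ • (R (k+1) v + v) := by
    apply smul_right_injective H h1
    simp only [nx, smul_add]
    rw [smul_inv_smul₀ h1, smul_inv_smul₀ h1, smul_inv_smul₀ h1, add_smul, one_smul]; abel
  rw [e, map_smul, map_add, R_quad h hk, smul_comm q]
  congr 1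
  rw [sub_smul, smul_add, one_smul]; abel

/-- the chain -/
noncomputable def ch (q : ℝ) (R : ℕ → Module.End ℝ H) (k : ℕ) (d : H) : ℕ → H
  | 0 => d
  | i+1 => nx q R (k+i) (ch q R k d i)

lemma ch_mem (h : HeckeSys n q R) {k : ℕ} {d : H} (hd : d ∈ EV n q R (eig q k)) (i : ℕ)
    (hi : k + i < n) : ch q R k d i ∈ EV n q R (eig q (k+i)) := by
  induction i with
  | zero => exact hd
  | succ i ih => exact nx_mem h hi (ih (by omega))

lemma ch_norm_le (h : HeckeSys n q R) {k : ℕ} {d : H} (hd : d ∈ EV n q R (eig q k)) (i : ℕ)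
    (hi : k + i < n) : ‖ch q R k d i‖^2 ≤ (2/q)^i * ‖d‖^2 := by
  have hq := h.hq
  induction i with
  | zero => simp [ch]
  | succ i ih =>
    have h1 := nx_norm_le h hi (ch_mem h hd i (by omega))
    have h2 := ih (by omega)
    calc _ ≤ 2 / q * ‖ch q R k d i‖^2 := h1
      _ ≤ 2 / q * ((2/q)^i * ‖d‖^2) := by gcongr
      _ = _ := by ring

lemma ch_norm_ge (h : HeckeSys n q R) {k : ℕ} {d : H} (hd : d ∈ EV n q R (eig q k)) (i : ℕ)
    (hi : k + i < n) : ‖d‖^2 ≤ q ^ i * ‖ch q R k d i‖^2 := by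
  have hq := h.hq
  induction i with
  | zero => simp [ch]
  | succ i ih =>
    have h1 := nx_norm_ge h hi (ch_mem h hd i (by omega))
    have h2 := ih (by omega)
    calc _ ≤ q ^ i * ‖ch q R k d i‖^2 := h2
      _ ≤ q ^ i * (q * ‖ch q R k d (i+1)‖^2) := by gcongr; exact h1
      _ = _ := by ring

/-- completed vector -/
noncomputable def Psi (n : ℕ) (q : ℝ) (R : ℕ → Module.End ℝ H) (k : ℕ) (d : H) : H :=
  ∑ i ∈ Finset.range (n - k), ch q R k d i

lemma Psi_inv (h : HeckeSys n q R) {k : ℕ} {d : H} (hd : d ∈ EV n q R (eig q k))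
    {j : ℕ} (hj : j < n) (hjk : j ≠ k) : R j (Psi n q R k d) = q • Psi n q R k d := by
  unfold Psi
  rcases Nat.lt_or_ge j k with h1 | h1
  · rw [map_sum, Finset.smul_sum]
    refine Finset.sum_congr rfl fun i hi => ?_
    have hi' := Finset.mem_range.1 hi
    exact E_inv h (ch_mem h hd i (by omega)) hj (by omega) (by omega)
  · obtain ⟨i0, rfl⟩ : ∃ i0, j = k + i0 + 1 := ⟨j - k - 1, by omega⟩
    have hsplit : Finset.range (n-k) = 
        ((Finset.range (n-k)).erase i0).erase (i0+1) ∪ {i0, i0+1} := by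
      ext i; simp only [Finset.mem_range, Finset.mem_union, Finset.mem_erase, Finset.mem_insert,
        Finset.mem_singleton]; omega
    have hdisj : Disjoint (((Finset.range (n-k)).erase i0).erase (i0+1)) {i0, i0+1} := by
      rw [Finset.disjoint_left]
      intro i; simp only [Finset.mem_range, Finset.mem_erase, Finset.mem_insert,
        Finset.mem_singleton]; omega
    rw [hsplit, Finset.sum_union hdisj, Finset.sum_pair (by omega), map_add, smul_add]
    congr 1
    · rw [map_sum, Finset.smul_sum]
      refine Finset.sum_congr rfl fun i hi => ?_
      simp only [Finset.mem_erase, Finset.mem_range] at hi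
      exact E_inv h (ch_mem h hd i (by omega)) hj (by omega) (by omega)
    · exact nx_inv h hj

lemma Psi_TT (h : HeckeSys n q R) {k : ℕ} {d : H} (hd : d ∈ EV n q R (eig q k)) :
    TT R n (Psi n q R k d) = (- q ^ (n * n - n)) • Psi n q R k d := by
  unfold Psi
  rw [map_sum, Finset.smul_sum]
  refine Finset.sum_congr rfl fun i hi => ?_
  have hi' := Finset.mem_range.1 hi
  exact E_TT (by omega) (ch_mem h hd i (by omega))

lemma Psi_norm (h : HeckeSys n q R) (hq4 : 4 ≤ q) {k : ℕ} {d : H}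
    (hd : d ∈ EV n q R (eig q k)) :
    ‖Psi n q R k d‖^2 ≤ (1 + 4/q) * ‖d‖^2 := by
  unfold Psi
  rw [norm_orth_sum]
  · have h1 : ∑ i ∈ Finset.range (n-k), ‖ch q R k d i‖^2 
        ≤ ∑ i ∈ Finset.range (n-k), (2/q)^i * ‖d‖^2 :=
      Finset.sum_le_sum fun i hi => ch_norm_le h hd i (by have := Finset.mem_range.1 hi; omega)
    rw [← Finset.sum_mul] at h1
    refine h1.trans ?_
    gcongr
    have h2 := geom_sum_mul_neg (2/q) (n-k)
    have h3 : 0 ≤ (2/q)^(n-k) := by positivity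
    have h4 : 0 ≤ ∑ i ∈ Finset.range (n-k), (2/q)^i := Finset.sum_nonneg fun i _ => by positivity
    set S := ∑ i ∈ Finset.range (n-k), (2/q)^i
    set t := 1/q with ht
    have e2 : 2/q = 2*t := by rw [ht]; ring
    have e4 : 4/q = 4*t := by rw [ht]; ring
    have ht1 : t ≤ 1/4 := by rw [ht]; exact one_div_le_one_div_of_le (by norm_num) hq4
    have ht0 : 0 ≤ t := by rw [ht]; positivity
    rw [e4]; rw [e2] at h2 h3
    have h5 : S * (1 - 2*t) ≤ 1 := by linarith
    nlinarith [mul_nonneg ht0 h4]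
  · intro i hi j hj hij
    have hi' := Finset.mem_range.1 hi
    have hj' := Finset.mem_range.1 hj
    exact E_orth h (ch_mem h hd i (by omega)) (ch_mem h hd j (by omega)) (by omega) (by omega)
      (by omega)

lemma elim_Psi (h : HeckeSys n q R) (m : ℕ) (g : ℕ → H) (hm : m ≤ n)
    (hg : ∀ k < n, g k ∈ EV n q R (eig q k)) : ∃ d : ℕ → H,
    (∀ k < n, d k ∈ EV n q R (eig q k)) ∧
    ∑ i ∈ Finset.range m, g (n - m + i) = ∑ i ∈ Finset.range m, Psi n q R (n-m+i) (d (n-m+i)) := by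
  induction m generalizing g with
  | zero => exact ⟨g, hg, by simp⟩
  | succ m ih =>
    set k := n - (m+1) with hk
    have hk1 : n - m = k + 1 := by omega
    obtain ⟨d, hd, hs⟩ := ih (fun j => if k < j ∧ j < n then g j - ch q R k (g k) (j-k) else 0) (by omega)
      (by
        intro j hj
        beta_reduce
        split_ifs with h1
        · refine Submodule.sub_mem _ (hg j hj) ?_
          have := ch_mem h (hg k (by omega)) (j-k) (by omega)
          rwa [show k + (j-k) = j by omega] at this
        · exact Submodule.zero_mem _)
    rw [hk1] at hs
    refine ⟨fun j => if j = k then g k else d j, ?_, ?_⟩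
    · intro j hj
      beta_reduce
      split_ifs with h1
      · subst h1; exact hg _ hj
      · exact hd j hj
    · rw [Finset.sum_range_succ', Finset.sum_range_succ']
      simp only [add_zero, if_true]
      have e1 : ∀ i ∈ Finset.range m, Psi n q R (k + (i+1)) 
          (if k + (i+1) = k then g k else d (k+(i+1))) = Psi n q R (k+1+i) (d (k+1+i)) := by
        intro i _
        rw [if_neg (by omega), show k + (i+1) = k+1+i by omega]
      rw [Finset.sum_congr rfl e1, ← hs]
      have e2 : ∀ i ∈ Finset.range m, (if k < k + 1 + i ∧ k + 1 + i < n then 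
          g (k+1+i) - ch q R k (g k) (k+1+i-k) else 0) = g (k+(i+1)) - ch q R k (g k) (i+1) := by
        intro i hi
        have hi' := Finset.mem_range.1 hi
        rw [if_pos (by omega), show k + 1 + i - k = i+1 by omega, show k + 1 + i = k + (i+1) by omega]
      rw [Finset.sum_congr rfl e2, Finset.sum_sub_distrib]
      unfold Psi
      rw [show n - k = m + 1 by omega, Finset.sum_range_succ' _ m]
      simp only [ch]
      abel

end Hk


namespace Hk

variable {H : Type*} [NormedAddCommGroup H] [InnerProductSpace ℝ H]
variable {n : ℕ} {q : ℝ} {R : ℕ → Module.End ℝ H}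

/-- the properties of the components of a minimal eigenvector -/
structure Good (n : ℕ) (q : ℝ) (R : ℕ → Module.End ℝ H) (k : ℕ) (f : H) : Prop where
  inv : ∀ j < n, j ≠ k → R j f = q • f
  tt : TT R n f = (- q ^ (n * n - n)) • f
  nrm : (q - 1) * ‖f‖^2 ≤ (1 + 4/q) * inner ℝ (q • f - R k f) f
  mid : 1 ≤ k → k + 1 < n → ∃ w z, f = w + z ∧ (∀ j < n - 1, R j z = q • z) ∧
    TT R n z = (- q ^ (n * n - n)) • z ∧ LL R (n-1) z = (- q ^ (n-1)) • z ∧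
    LL R (n-1) w = (q ^ (2*n-2)) • w ∧
    (∀ u, (∀ j < n - 1, R j u = q • u) → inner ℝ w u = 0) ∧
    ‖f‖^2 ≤ (1 + 4/q) * (q ^ (n-1-k) * ‖z‖^2)

lemma quad_aux {A : Module.End ℝ H} (hA : A.IsSymmetric) (d r : H) (hr : A r = q • r) :
    inner ℝ (q • (d + r) - A (d + r)) (d + r) = inner ℝ (q • d - A d) d := by
  have e : q • (d + r) - A (d + r) = q • d - A d := by
    rw [map_add, hr, smul_add]; abel
  rw [e, inner_add_right]
  have : inner ℝ (q • d - A d) r = 0 := by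
    rw [inner_sub_left, hA, hr, inner_smul_left, inner_smul_right]; simp
  rw [this, add_zero]

lemma Psi_split {k : ℕ} (hk : k < n) (d : H) : Psi n q R k d =
    d + ∑ i ∈ Finset.range (n-k-1), ch q R k d (i+1) := by
  unfold Psi
  rw [show n - k = (n-k-1) + 1 by omega, Finset.sum_range_succ']
  simp [ch, add_comm]

lemma rest_inv (h : HeckeSys n q R) {k : ℕ} (hk : k < n) {d : H} (hd : d ∈ EV n q R (eig q k)) :
    R k (∑ i ∈ Finset.range (n-k-1), ch q R k d (i+1)) 
      = q • ∑ i ∈ Finset.range (n-k-1), ch q R k d (i+1) := by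
  rw [map_sum, Finset.smul_sum]
  refine Finset.sum_congr rfl fun i hi => ?_
  have hi' := Finset.mem_range.1 hi
  exact E_inv h (ch_mem h hd (i+1) (by omega)) hk (by omega) (by omega)

lemma LL_inv_vec {m : ℕ} {u : H} (hu : ∀ j ≤ m, R j u = q • u) :
    LL R m u = (q ^ (2*m+1)) • u := by
  induction m with
  | zero => simpa [LL] using hu 0 le_rfl
  | succ m ih =>
    simp only [LL, Module.End.mul_apply]
    rw [hu (m+1) le_rfl, map_smul, ih (fun j hj => hu j (by omega)), map_smul, map_smul,
      hu (m+1) le_rfl, smul_smul, smul_smul]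
    congr 1; ring

lemma Good_of_pos (h : HeckeSys n q R) (hq4 : 4 ≤ q) {k : ℕ} (hk : k < n) (hk1 : 1 ≤ k) {d : H}
    (hd : d ∈ EV n q R (eig q k)) : Good n q R k (Psi n q R k d) := by
  have hq := h.hq
  refine ⟨fun j hj hjk => Psi_inv h hd hj hjk, Psi_TT h hd, ?_, ?_⟩
  · have h1 := Psi_norm h hq4 hd
    have h2 : inner ℝ (q • Psi n q R k d - R k (Psi n q R k d)) (Psi n q R k d)
        = inner ℝ (q • d - R k d) d := by
      rw [Psi_split hk]
      exact quad_aux (h.sym k hk) _ _ (rest_inv h hk hd)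
    obtain ⟨m, rfl⟩ : ∃ m, k = m + 1 := ⟨k-1, by omega⟩
    have e1 := hd m (by omega)
    have e2 := hd (m+1) hk
    rw [eig_lt (by omega)] at e1
    rw [eig_self] at e2
    have hQ : 1 ≤ q ^ (m+1) := one_le_pow₀ hq.le
    have hQ' : q ^ 1 ≤ q ^ (m+1) := pow_le_pow_right₀ hq.le (by omega)
    have h3 := swap_inner h hk e1 e2 (by linarith)
    have h4 : kap q (q ^ (m+1)) (-1) ≤ 1 := by
      unfold kap
      rw [show (q-1) * (-1) / (-1 - q ^ (m+1)) = (q-1) / (1 + q ^ (m+1)) by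
        rw [show (-1 - q ^ (m+1)) = -(1 + q ^ (m+1)) by ring, mul_neg_one, neg_div_neg_eq]]
      rw [div_le_one (by positivity)]; linarith
    rw [h2, inner_sub_left, inner_smul_left, real_inner_self_eq_norm_sq, h3]
    simp only [conj_trivial]
    have h5 : (q-1) * ‖d‖^2 ≤ q * ‖d‖^2 - kap q (q ^ (m+1)) (-1) * ‖d‖^2 := by
      nlinarith [sq_nonneg ‖d‖]
    calc (q-1) * ‖Psi n q R (m+1) d‖^2 ≤ (q-1) * ((1+4/q) * ‖d‖^2) := by
          have : 0 ≤ q - 1 := by linarith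
          gcongr
      _ = (1+4/q) * ((q-1) * ‖d‖^2) := by ring
      _ ≤ _ := by gcongr
  · intro _ hkn
    refine ⟨∑ i ∈ Finset.range (n-k-1), ch q R k d i, ch q R k d (n-k-1), ?_, ?_, ?_, ?_, ?_, ?_, ?_⟩
    · unfold Psi
      conv_lhs => rw [show n - k = (n-k-1)+1 by omega]
      rw [Finset.sum_range_succ]
    all_goals have hz := ch_mem h hd (n-k-1) (by omega)
    all_goals rw [show k + (n-k-1) = n-1 by omega] at hz
    · intro j hj; exact E_inv h hz (by omega) (by omega) (by omega)
    · exact E_TT (by omega) hz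
    · rw [hz (n-1) (by omega), eig_self]; congr 1; ring
    · rw [map_sum, Finset.smul_sum]
      refine Finset.sum_congr rfl fun i hi => ?_
      have hi' := Finset.mem_range.1 hi
      rw [ch_mem h hd i (by omega) (n-1) (by omega), eig_gt (by omega), ← pow_add]
      congr 2; omega
    · intro u hu
      rw [sum_inner]
      refine Finset.sum_eq_zero fun i hi => ?_
      have hi' := Finset.mem_range.1 hi
      have h3 := ch_mem h hd i (by omega) (k+i) (by omega)
      rw [eig_self] at h3
      have h4 := LL_inv_vec (m := k+i) (q := q) (R := R) (u := u) (fun j hj => hu j (by omega))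
      refine orth_of_ne (LL_sym h (k+i) (by omega)) h3 h4 ?_
      have : 0 < q ^ (k+i) := by positivity
      have : 0 < q ^ (2*(k+i)+1) := by positivity
      linarith
    · refine (Psi_norm h hq4 hd).trans ?_
      have := ch_norm_ge h hd (n-k-1) (by omega)
      rw [show n - k - 1 = n - 1 - k by omega] at this ⊢
      gcongr

lemma Good_zero (h : HeckeSys n q R) (hq4 : 4 ≤ q) (hn : 2 ≤ n) {d g : H}
    (hd : d ∈ EV n q R (eig q 0)) (hg : g ∈ EV n q R (fun j => - q ^ j)) 
    (hgT : TT R n g = (- q ^ (n * n - n)) • g) : Good n q R 0 (Psi n q R 0 d + g) := by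
  have hq := h.hq
  refine ⟨fun j hj hjk => ?_, ?_, ?_, by omega⟩
  · rw [map_add, Psi_inv h hd hj hjk, S_inv h hg hj hjk, smul_add]
  · rw [map_add, Psi_TT h hd, hgT, smul_add]
  · have horth : ∀ k < n, ∀ v ∈ EV n q R (eig q k), inner ℝ v g = 0 := by
      intro k hk v hv
      rcases Nat.eq_zero_or_pos k with h0 | h0
      · subst h0
        refine EV_orth h hv hg (j := 1) (by omega) ?_
        rw [eig_gt (by omega)]; simp; linarith
      · refine EV_orth h hv hg (j := 0) (by omega) ?_
        rw [eig_lt h0]; simp; linarith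
    have hPg : inner ℝ (Psi n q R 0 d) g = 0 := by
      unfold Psi
      rw [sum_inner]
      refine Finset.sum_eq_zero fun i hi => ?_
      have hi' := Finset.mem_range.1 hi
      exact horth _ (by omega) _ (ch_mem h hd i (by omega))
    have h1 := Psi_norm h hq4 hd
    have hnorm : ‖Psi n q R 0 d + g‖^2 = ‖Psi n q R 0 d‖^2 + ‖g‖^2 := by
      rw [@norm_add_sq_real, hPg]; ring
    have hD : ‖d + g‖^2 = ‖d‖^2 + ‖g‖^2 := by
      rw [@norm_add_sq_real, horth 0 (by omega) d hd]; ring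
    have hRd : R 0 (d + g) = - (d + g) := by
      have e1 := hd 0 (by omega)
      have e2 := hg 0 (by omega)
      rw [eig_self] at e1
      simp [LL] at e1 e2
      rw [map_add, e1, e2, neg_add]
    have h2 : inner ℝ (q • (Psi n q R 0 d + g) - R 0 (Psi n q R 0 d + g)) (Psi n q R 0 d + g)
        = (q+1) * ‖d+g‖^2 := by
      rw [Psi_split (by omega : 0 < n), add_right_comm]
      rw [quad_aux (h.sym 0 (by omega)) _ _ (rest_inv h (by omega) hd), hRd, sub_neg_eq_add,
        inner_add_left, inner_smul_left, real_inner_self_eq_norm_sq]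
      simp; ring
    rw [h2, hnorm, hD]
    have h3 : ‖Psi n q R 0 d‖^2 + ‖g‖^2 ≤ (1+4/q) * (‖d‖^2 + ‖g‖^2) := by
      have : 0 ≤ 4/q * ‖g‖^2 := by positivity
      nlinarith
    have h4 : 0 ≤ (1+4/q) * (‖d‖^2 + ‖g‖^2) := by positivity
    nlinarith

theorem A3main [FiniteDimensional ℝ H] (h : HeckeSys n q R) (hq4 : 4 ≤ q) (hn : 2 ≤ n) (x : H)
    (hT : TT R n x = (- q ^ (n * n - n)) • x) :
    ∃ f : ℕ → H, x = ∑ k ∈ Finset.range n, f k ∧ ∀ k < n, Good n q R k (f k) := by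
  obtain ⟨g, gs, hx, hg, hgs, hgT⟩ := min_decomp h x hT
  obtain ⟨d, hd, hs⟩ := elim_Psi h n g le_rfl hg
  simp only [Nat.sub_self, zero_add] at hs
  refine ⟨fun k => Psi n q R k (d k) + if k = 0 then gs else 0, ?_, ?_⟩
  · rw [Finset.sum_add_distrib, Finset.sum_ite_eq', if_pos (Finset.mem_range.2 (by omega)), ← hs, hx]
  · intro k hk
    rcases Nat.eq_zero_or_pos k with h0 | h0
    · subst h0; simp only [if_true]
      exact Good_zero h hq4 hn (hd 0 hk) hgs hgT
    · beta_reduce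
      rw [if_neg (by omega), add_zero]
      exact Good_of_pos h hq4 hk h0 (hd k hk)

end Hk


namespace Gm
variable {F V : Type} [Field F] [AddCommGroup V] [Module F V]

/-- symplectic space of dimension `2n` -/
structure Sp (B : V →ₗ[F] V →ₗ[F] F) (n : ℕ) : Prop where
  alt : IsAltForm B
  nd : NondegForm B
  fd : FiniteDimensional F V
  fr : Module.finrank F V = 2 * n

variable {B : V →ₗ[F] V →ₗ[F] F} {n : ℕ}

lemma mem_bperp {W : Submodule F V} {v : V} : v ∈ bperp B W ↔ ∀ w ∈ W, B w v = 0 := by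
  simp [bperp, Submodule.mem_iInf]

lemma bperp_anti {U W : Submodule F V} (h : U ≤ W) : bperp B W ≤ bperp B U := by
  intro v hv; rw [mem_bperp] at *; exact fun w hw => hv w (h hw)

lemma tiso_iff {W : Submodule F V} : IsTotIso B W ↔ W ≤ bperp B W := by
  constructor
  · intro h v hv; rw [mem_bperp]; exact fun w hw => h w hw v hv
  · intro h u hu w hw; exact mem_bperp.1 (h hw) u hu

lemma tiso_mono {U W : Submodule F V} (h : U ≤ W) (hW : IsTotIso B W) : IsTotIso B U :=
  fun u hu w hw => hW u (h hu) w (h hw)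

lemma Sp.swap (hB : Sp B n) {u v : V} (h : B u v = 0) : B v u = 0 := by
  have h1 := hB.alt (u + v)
  simp only [map_add, LinearMap.add_apply, hB.alt u, hB.alt v, h] at h1
  simpa using h1

lemma Sp.le_comm (hB : Sp B n) {U W : Submodule F V} (h : U ≤ bperp B W) : W ≤ bperp B U := by
  intro w hw; rw [mem_bperp]; intro u hu
  exact hB.swap (mem_bperp.1 (h hu) w hw)

lemma bperp_sup {U W : Submodule F V} : bperp B (U ⊔ W) = bperp B U ⊓ bperp B W := by
  apply le_antisymm
  · exact le_inf (bperp_anti le_sup_left) (bperp_anti le_sup_right)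
  · intro v hv
    rw [Submodule.mem_inf, mem_bperp, mem_bperp] at hv
    rw [mem_bperp]
    intro w hw
    obtain ⟨a, ha, b, hb, rfl⟩ := Submodule.mem_sup.1 hw
    rw [map_add, LinearMap.add_apply, hv.1 a ha, hv.2 b hb, add_zero]

lemma Sp.refl (hB : Sp B n) : LinearMap.IsRefl B := fun _ _ h => hB.swap h

lemma bperp_eq (W : Submodule F V) : bperp B W = LinearMap.BilinForm.orthogonal B W := by
  ext v
  rw [mem_bperp, LinearMap.BilinForm.mem_orthogonal_iff]

lemma Sp.nondeg (hB : Sp B n) : LinearMap.BilinForm.Nondegenerate B := by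
  refine ⟨fun v hv => hB.nd v hv, fun v hv => hB.nd v fun w => hB.swap (hv w)⟩

lemma Sp.finrank_perp (hB : Sp B n) (W : Submodule F V) :
    finrank F (bperp B W) = 2 * n - finrank F W := by
  have := hB.fd
  rw [bperp_eq, LinearMap.BilinForm.finrank_orthogonal hB.nondeg, hB.fr]

lemma Sp.perp_perp (hB : Sp B n) (W : Submodule F V) : bperp B (bperp B W) = W := by
  have := hB.fd
  rw [bperp_eq, bperp_eq, LinearMap.BilinForm.orthogonal_orthogonal hB.nondeg hB.refl]

lemma Sp.finrank_le (hB : Sp B n) (W : Submodule F V) : finrank F W ≤ 2 * n := by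
  have := hB.fd
  rw [← hB.fr]; exact Submodule.finrank_le W

lemma Sp.tiso_le (hB : Sp B n) {W : Submodule F V} (h : IsTotIso B W) : finrank F W ≤ n := by
  have := hB.fd
  have h1 := Submodule.finrank_mono (tiso_iff.1 h)
  rw [hB.finrank_perp] at h1
  have := hB.finrank_le W
  omega

lemma Sp.perp_gen (hB : Sp B n) {W : Submodule F V} (h : IsTotIso B W) (hW : finrank F W = n) :
    bperp B W = W := by
  have := hB.fd
  refine (Submodule.eq_of_le_of_finrank_eq (tiso_iff.1 h) ?_).symm
  rw [hB.finrank_perp]; omega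

lemma tiso_bot : IsTotIso B (⊥ : Submodule F V) := by
  intro u hu w _; rw [Submodule.mem_bot] at hu; subst hu; simp

/-- sup of mutually perpendicular totally isotropic spaces -/
lemma Sp.tiso_sup (hB : Sp B n) {U W : Submodule F V} (hU : IsTotIso B U) (hW : IsTotIso B W)
    (h : W ≤ bperp B U) : IsTotIso B (U ⊔ W) := by
  rw [tiso_iff, bperp_sup]
  refine sup_le (le_inf (tiso_iff.1 hU) (hB.le_comm h)) (le_inf h (tiso_iff.1 hW))

/-- one-dimensional extension inside the perp is t.i. -/
lemma Sp.tiso_ext (hB : Sp B n) {U X : Submodule F V} (hU : IsTotIso B U) (hUX : U ≤ X)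
    (hX : X ≤ bperp B U) (hf : finrank F X = finrank F U + 1) : IsTotIso B X := by
  have := hB.fd
  have hlt : U < X := lt_of_le_of_ne hUX (fun h => by rw [h] at hf; omega)
  obtain ⟨x, hxX, hxU⟩ := SetLike.exists_of_lt hlt
  have hxs : F ∙ x ≤ X := by rwa [Submodule.span_singleton_le_iff_mem]
  have e : X = U ⊔ F ∙ x := by
    refine (Submodule.eq_of_le_of_finrank_le (sup_le hUX hxs) ?_).symm
    have : U < U ⊔ F ∙ x := by
      refine lt_of_le_of_ne le_sup_left fun h => hxU ?_
      rw [h]; exact Submodule.mem_sup_right (Submodule.mem_span_singleton_self x)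
    have := Submodule.finrank_lt_finrank_of_lt this
    omega
  rw [e]
  refine hB.tiso_sup hU ?_ (hxs.trans hX)
  intro u hu w hw
  obtain ⟨a, rfl⟩ := Submodule.mem_span_singleton.1 hu
  obtain ⟨b, rfl⟩ := Submodule.mem_span_singleton.1 hw
  simp [hB.alt x]

/-- chambers -/
abbrev Ch (B : V →ₗ[F] V →ₗ[F] F) (n : ℕ) := SFlag B (Finset.Icc 1 n)

lemma ch_zero (C : Ch B n) : C.space 0 = ⊥ := C.eq_bot 0 (by simp)

lemma ch_fr (C : Ch B n) {i : ℕ} (hi : i ≤ n) : finrank F (C.space i) = i := by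
  rcases Nat.eq_zero_or_pos i with h | h
  · subst h; rw [ch_zero]; simp
  · exact C.finrank_eq i (Finset.mem_Icc.2 ⟨h, hi⟩)

lemma ch_ti (C : Ch B n) (i : ℕ) : IsTotIso B (C.space i) := by
  by_cases h : i ∈ Finset.Icc 1 n
  · exact C.isotropic i h
  · rw [C.eq_bot i h]; exact tiso_bot

lemma ch_mono (C : Ch B n) {i j : ℕ} (hij : i ≤ j) (hj : j ≤ n) : C.space i ≤ C.space j := by
  rcases Nat.eq_zero_or_pos i with h | h
  · subst h; rw [ch_zero]; exact bot_le
  · exact C.mono i (Finset.mem_Icc.2 ⟨h, by omega⟩) j (Finset.mem_Icc.2 ⟨by omega, hj⟩) hij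

lemma ch_ext {C D : Ch B n} (h : ∀ i, 1 ≤ i → i ≤ n → C.space i = D.space i) : C = D := by
  have hs : C.space = D.space := by
    funext i
    by_cases hi : i ∈ Finset.Icc 1 n
    · rw [Finset.mem_Icc] at hi; exact h i hi.1 hi.2
    · rw [C.eq_bot i hi, D.eq_bot i hi]
  cases C; cases D; simp only at hs; subst hs; rfl

lemma exists_ch (s : ℕ → Submodule F V) (h1 : ∀ i, 1 ≤ i → i ≤ n → finrank F (s i) = i)
    (h2 : ∀ i, 1 ≤ i → i ≤ n → IsTotIso B (s i)) (h3 : ∀ i, 1 ≤ i → i < n → s i ≤ s (i+1)) :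
    ∃ C : Ch B n, ∀ i, 1 ≤ i → i ≤ n → C.space i = s i := by
  refine ⟨⟨fun i => if i ∈ Finset.Icc 1 n then s i else ⊥, ?_, ?_, ?_, ?_⟩, ?_⟩
  · intro i hi; beta_reduce; rw [if_pos hi]; rw [Finset.mem_Icc] at hi; exact h2 i hi.1 hi.2
  · intro i hi; beta_reduce; rw [if_pos hi]; rw [Finset.mem_Icc] at hi; exact h1 i hi.1 hi.2
  · intro i hi j hj hij
    beta_reduce
    rw [if_pos hi, if_pos hj]
    rw [Finset.mem_Icc] at hi hj
    induction j, hij using Nat.le_induction with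
    | base => exact le_rfl
    | succ j hij ih => exact (ih ⟨by omega, by omega⟩).trans (h3 j (by omega) (by omega))
  · intro i hi; beta_reduce; rw [if_neg hi]
  · intro i h4 h5
    change (if i ∈ Finset.Icc 1 n then s i else ⊥) = s i
    rw [if_pos (Finset.mem_Icc.2 ⟨h4, h5⟩)]

/-- panel surgery -/
lemma exists_upd (C : Ch B n) {i : ℕ} (hi1 : 1 ≤ i) (hi : i ≤ n) {X : Submodule F V}
    (hX : IsTotIso B X) (hf : finrank F X = i) (h1 : C.space (i-1) ≤ X)
    (h2 : i < n → X ≤ C.space (i+1)) :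
    ∃ D : Ch B n, D.space i = X ∧ ∀ j, j ≠ i → D.space j = C.space j := by
  obtain ⟨D, hD⟩ := exists_ch (B := B) (n := n) (fun j => if j = i then X else C.space j)
    (by intro j hj1 hj; beta_reduce; by_cases h : j = i
        · rw [if_pos h, hf, h]
        · rw [if_neg h]; exact ch_fr C hj)
    (by intro j hj1 hj; beta_reduce; by_cases h : j = i
        · rw [if_pos h]; exact hX
        · rw [if_neg h]; exact ch_ti C j)
    (by intro j hj1 hj; beta_reduce
        by_cases h : j = i
        · subst h; rw [if_pos rfl, if_neg (by omega)]; exact h2 hj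
        · rw [if_neg h]
          by_cases h' : j + 1 = i
          · subst h'; rw [if_pos rfl]; exact h1
          · rw [if_neg h']; exact ch_mono C (by omega) (by omega))
  refine ⟨D, ?_, ?_⟩
  · rw [hD i hi1 hi, if_pos rfl]
  · intro j hj
    by_cases hjI : j ∈ Finset.Icc 1 n
    · rw [Finset.mem_Icc] at hjI
      rw [hD j hjI.1 hjI.2, if_neg hj]
    · rw [D.eq_bot j hjI, C.eq_bot j hjI]

/-- agreement off a single index -/
def eqv (i : ℕ) (C D : Ch B n) : Prop := ∀ j, j ≠ i → C.space j = D.space j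
/-- adjacency -/
def adj (i : ℕ) (C D : Ch B n) : Prop := eqv i C D ∧ C ≠ D

lemma eqv_symm {i : ℕ} {C D : Ch B n} (h : eqv i C D) : eqv i D C := fun j hj => (h j hj).symm
lemma eqv_trans {i : ℕ} {C D E : Ch B n} (h : eqv i C D) (h' : eqv i D E) : eqv i C E :=
  fun j hj => (h j hj).trans (h' j hj)
lemma adj_symm {i : ℕ} {C D : Ch B n} (h : adj i C D) : adj i D C := ⟨eqv_symm h.1, h.2.symm⟩
lemma eqv_eq {i : ℕ} {C D : Ch B n} (h : eqv i C D) (h' : C.space i = D.space i) : C = D :=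
  ch_ext fun j _ _ => if hj : j = i then hj ▸ h' else h j hj
lemma adj_ne {i : ℕ} {C D : Ch B n} (h : adj i C D) : C.space i ≠ D.space i :=
  fun h' => h.2 (eqv_eq h.1 h')
lemma adj_of {i : ℕ} {C D : Ch B n} (h : eqv i C D) (h' : C.space i ≠ D.space i) : adj i C D :=
  ⟨h, fun e => h' (by rw [e])⟩

/-- two distinct `i`-spaces in an `(i+1)`-space -/
lemma sup_eq_of_ne [FiniteDimensional F V] {X Y Z : Submodule F V} {i : ℕ} (hX : finrank F X = i)
    (hY : finrank F Y = i) (hZ : finrank F Z = i + 1) (hXZ : X ≤ Z) (hYZ : Y ≤ Z) (hne : X ≠ Y) :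
    X ⊔ Y = Z := by
  refine Submodule.eq_of_le_of_finrank_le (sup_le hXZ hYZ) ?_
  have : X < X ⊔ Y := by
    refine lt_of_le_of_ne le_sup_left fun h => hne ?_
    have : Y ≤ X := by rw [h]; exact le_sup_right
    exact (Submodule.eq_of_le_of_finrank_eq this (by omega)).symm
  have := Submodule.finrank_lt_finrank_of_lt this
  omega

lemma inf_eq_of_ne [FiniteDimensional F V] {X Y Z : Submodule F V} {i : ℕ} 
    (hX : finrank F X = i + 1)
    (hY : finrank F Y = i + 1) (hZ : finrank F Z = i) (hXZ : Z ≤ X) (hYZ : Z ≤ Y) (hne : X ≠ Y) :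
    X ⊓ Y = Z := by
  symm
  refine Submodule.eq_of_le_of_finrank_le (le_inf hXZ hYZ) ?_
  have : X ⊓ Y < X := by
    refine lt_of_le_of_ne inf_le_left fun h => hne ?_
    have : X ≤ Y := by rw [← h]; exact inf_le_right
    exact Submodule.eq_of_le_of_finrank_eq this (by omega)
  have := Submodule.finrank_lt_finrank_of_lt this
  omega

end Gm


namespace Gm
variable {F V : Type} [Field F] [AddCommGroup V] [Module F V]
variable {B : V →ₗ[F] V →ₗ[F] F} {n : ℕ}

lemma fr_span_le (x : V) : finrank F (F ∙ x) ≤ 1 := by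
  have := finrank_span_le_card (R := F) ({x} : Set V)
  simpa using this

/-- gallery relation for the Jucys-Murphy elements -/
def ell : ℕ → Ch B n → Ch B n → Prop
  | 0, C, D => adj n C D
  | m+1, C, D => ∃ C1 D1, adj (n-(m+1)) C C1 ∧ ell m C1 D1 ∧ adj (n-(m+1)) D1 D

/-- gallery relation for the longest element -/
def tt : ℕ → Ch B n → Ch B n → Prop
  | 0, C, D => C = D
  | m+1, C, D => ∃ E, ell m C E ∧ tt m E D

/-- geometric description of `ell` -/
structure Rel (j : ℕ) (C D : Ch B n) : Prop where
  low : ∀ i ≤ j, D.space i = C.space i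
  up : ∀ i, j < i → i ≤ n → D.space i ≤ C.space i ⊔ D.space (j+1)
  opp : ¬ D.space (j+1) ≤ bperp B (C.space (j+1))

lemma rel_of_ell (hB : Sp B n) (m : ℕ) : ∀ (j : ℕ) (C D : Ch B n), j + m + 1 = n → ell m C D →
    Rel j C D := by
  have := hB.fd
  induction m with
  | zero =>
    intro j C D hj h
    obtain rfl : n = j + 1 := by omega
    change adj (j+1) C D at h
    refine ⟨fun i hi => (h.1 i (by omega)).symm, fun i h1 h2 => ?_, fun h1 => ?_⟩
    · obtain rfl : i = j + 1 := by omega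
      exact le_sup_right
    · rw [hB.perp_gen (ch_ti C _) (ch_fr C le_rfl)] at h1
      exact adj_ne h (Submodule.eq_of_le_of_finrank_eq h1
        (by rw [ch_fr C le_rfl, ch_fr D le_rfl])).symm
  | succ m ih =>
    rintro j C D hj ⟨C1, D1, h1, h2, h3⟩
    rw [show n - (m+1) = j+1 by omega] at h1 h3
    have h4 := ih (j+1) C1 D1 (by omega) h2
    have hU : D1.space (j+1) = C1.space (j+1) := h4.low (j+1) le_rfl
    have hC2 : C1.space (j+2) = C.space (j+2) := (h1.1 (j+2) (by omega)).symm
    have hD2 : D1.space (j+2) = D.space (j+2) := h3.1 (j+2) (by omega)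
    have hDs : D1.space (j+1) ⊔ D.space (j+1) = D.space (j+2) :=
      sup_eq_of_ne (ch_fr D1 (by omega)) (ch_fr D (by omega)) (ch_fr D (by omega))
        (hD2 ▸ ch_mono D1 (by omega) (by omega)) (ch_mono D (by omega) (by omega)) (adj_ne h3)
    have hCs : C.space (j+1) ⊔ C1.space (j+1) = C.space (j+2) :=
      sup_eq_of_ne (ch_fr C (by omega)) (ch_fr C1 (by omega)) (ch_fr C (by omega))
        (ch_mono C (by omega) (by omega)) (hC2 ▸ ch_mono C1 (by omega) (by omega)) (adj_ne h1)
    refine ⟨fun i hi => ?_, fun i h5 h6 => ?_, fun h5 => ?_⟩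
    · rw [← h3.1 i (by omega), h4.low i (by omega), h1.1 i (by omega)]
    · rcases Nat.lt_or_ge (j+1) i with h7 | h7
      · have h8 := h4.up i h7 h6
        rw [h3.1 i (by omega), ← h1.1 i (by omega), show j+1+1 = j+2 by omega, hD2, ← hDs, hU] at h8
        refine h8.trans (sup_le le_sup_left (sup_le ?_ le_sup_right))
        refine le_trans ?_ le_sup_left
        refine le_trans ?_ (ch_mono C (show j+2 ≤ i by omega) h6)
        rw [← hCs]; exact le_sup_right
      · obtain rfl : i = j+1 := by omega
        exact le_sup_right
    · apply h4.opp
      rw [show j+1+1 = j+2 by omega, hD2, hC2, ← hDs, ← hCs, bperp_sup, hU]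
      have hUC : C1.space (j+1) ≤ C.space (j+2) := by rw [← hCs]; exact le_sup_right
      have hUD : C1.space (j+1) ≤ D.space (j+2) := by rw [← hDs, hU]; exact le_sup_left
      have hCt := tiso_iff.1 (ch_ti C (j+2))
      have hDt := tiso_iff.1 (ch_ti D (j+2))
      refine sup_le (le_inf ?_ ?_) (le_inf h5 ?_)
      · exact hUC.trans (hCt.trans (bperp_anti (ch_mono C (by omega) (by omega))))
      · exact hUC.trans (hCt.trans (bperp_anti hUC))
      · exact (ch_mono D (by omega) (by omega)).trans (hDt.trans (bperp_anti hUD))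

lemma exists_sup_span (hB : Sp B n) {C D : Ch B n} {j : ℕ} (hj : j < n) (h : D.space j = C.space j) :
    ∃ x, D.space (j+1) = C.space j ⊔ F ∙ x := by
  have := hB.fd
  have hlt : C.space j < D.space (j+1) := by
    rw [← h]
    refine lt_of_le_of_ne (ch_mono D (by omega) (by omega)) fun e => ?_
    have h1 := ch_fr D (show j ≤ n by omega)
    have h2 := ch_fr D (show j + 1 ≤ n by omega)
    rw [e] at h1; omega
  obtain ⟨x, hx, hx'⟩ := SetLike.exists_of_lt hlt
  refine ⟨x, (Submodule.eq_of_le_of_finrank_le (sup_le hlt.le ?_) ?_).symm⟩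
  · rwa [Submodule.span_singleton_le_iff_mem]
  · have : C.space j < C.space j ⊔ F ∙ x := by
      refine lt_of_le_of_ne le_sup_left fun h => hx' ?_
      rw [h]; exact Submodule.mem_sup_right (Submodule.mem_span_singleton_self x)
    have := Submodule.finrank_lt_finrank_of_lt this
    rw [ch_fr C (by omega)] at this
    rw [ch_fr D (by omega)]; omega

/-- `Rel` is deterministic -/
lemma rel_det (hB : Sp B n) {j : ℕ} (hj : j < n) {C D D' : Ch B n} (h : Rel j C D)
    (h' : Rel j C D') (hX : D.space (j+1) = D'.space (j+1)) : D = D' := by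
  have := hB.fd
  refine ch_ext fun i hi1 hi => ?_
  rcases Nat.lt_or_ge j i with h1 | h1
  swap
  · rw [h.low i h1, h'.low i h1]
  obtain ⟨x, hx⟩ := exists_sup_span hB hj (h.low j le_rfl)
  set X := D.space (j+1) with hXdef
  set Z := (C.space i ⊔ X) ⊓ bperp B X with hZ
  have hZr : finrank F Z ≤ i := by
    have hlt : Z < C.space i ⊔ X := by
      refine lt_of_le_of_ne inf_le_left fun e => ?_
      have : C.space (j+1) ≤ bperp B X :=
        ((ch_mono C (by omega) hi).trans le_sup_left).trans
          (by rw [← e]; exact inf_le_right)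
      exact h.opp (hB.le_comm this)
    have h2 := Submodule.finrank_lt_finrank_of_lt hlt
    have h3 : C.space i ⊔ X = C.space i ⊔ F ∙ x := by
      rw [hx, ← sup_assoc, sup_eq_left.2 (ch_mono C (by omega) hi)]
    have h4 := Submodule.finrank_add_le_finrank_add_finrank (C.space i) (F ∙ x)
    have h5 : finrank F (F ∙ x) ≤ 1 := fr_span_le x
    rw [h3] at h2
    rw [ch_fr C hi] at h4
    omega
  have key : ∀ E : Ch B n, Rel j C E → E.space (j+1) = X → E.space i = Z := by
    intro E hE hEX
    refine Submodule.eq_of_le_of_finrank_le (le_inf ?_ ?_) (by rw [ch_fr E hi]; exact hZr)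
    · rw [← hEX]; exact hE.up i h1 hi
    · rw [← hEX]
      exact (tiso_iff.1 (ch_ti E i)).trans (bperp_anti (ch_mono E (by omega) hi))
  rw [key D h rfl, key D' h' hX.symm]

/-- geometric description of `tt` -/
structure Opp (j : ℕ) (C D : Ch B n) : Prop where
  low : ∀ i ≤ j, D.space i = C.space i
  opp : ∀ i, j ≤ i → i ≤ n → D.space i ⊓ bperp B (C.space i) ≤ C.space j

lemma opp_of_tt (hB : Sp B n) (m : ℕ) : ∀ (j : ℕ) (C D : Ch B n), j + m = n → tt m C D →
    Opp j C D := by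
  have := hB.fd
  induction m with
  | zero =>
    intro j C D hj h
    obtain rfl : C = D := h
    refine ⟨fun _ _ => rfl, fun i h1 h2 => ?_⟩
    obtain rfl : i = j := by omega
    exact inf_le_left
  | succ m ih =>
    rintro j C D hj ⟨E, h1, h2⟩
    have r := rel_of_ell hB m j C E (by omega) h1
    have o := ih (j+1) E D (by omega) h2
    refine ⟨fun i hi => (o.low i (by omega)).trans (r.low i hi), fun i h3 h4 => ?_⟩
    rcases Nat.lt_or_ge j i with h5 | h5
    swap
    · obtain rfl : i = j := by omega
      refine inf_le_left.trans ?_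
      rw [o.low i (by omega), r.low i le_rfl]
    have h6 : D.space i ⊓ bperp B (C.space i) ≤ E.space (j+1) := by
      refine le_trans (le_inf inf_le_left ?_) (o.opp i h5 h4)
      refine le_trans ?_ (bperp_anti (r.up i h5 h4))
      rw [bperp_sup]
      refine le_inf inf_le_right (inf_le_left.trans ?_)
      rw [← o.low (j+1) le_rfl]
      exact (tiso_iff.1 (ch_ti D i)).trans (bperp_anti (ch_mono D (by omega) h4))
    have h7 : E.space (j+1) ⊓ bperp B (C.space (j+1)) = C.space j := by
      symm
      refine Submodule.eq_of_le_of_finrank_le (le_inf ?_ ?_) ?_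
      · rw [← r.low j le_rfl]; exact ch_mono E (by omega) (by omega)
      · exact (ch_mono C (by omega) (by omega)).trans (tiso_iff.1 (ch_ti C (j+1)))
      · have hlt : E.space (j+1) ⊓ bperp B (C.space (j+1)) < E.space (j+1) :=
          lt_of_le_of_ne inf_le_left fun e => r.opp (e ▸ inf_le_right)
        have := Submodule.finrank_lt_finrank_of_lt hlt
        rw [ch_fr E (by omega)] at this
        rw [ch_fr C (by omega)]; omega
    rw [← h7]
    exact le_inf h6 (inf_le_right.trans (bperp_anti (ch_mono C (by omega) h4)))

lemma flagOpp_of_tt (hB : Sp B n) {C D : Ch B n} (h : tt n C D) : FlagOpp C D := by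
  have o := opp_of_tt hB n 0 C D (by omega) h
  intro i hi
  rw [Finset.mem_Icc] at hi
  have := o.opp i (by omega) hi.2
  rw [ch_zero, inf_comm] at this
  exact le_bot_iff.1 this

lemma ell_exists (hB : Sp B n) (m : ℕ) : ∀ (j : ℕ) (C : Ch B n) (X : Submodule F V), j + m + 1 = n →
    IsTotIso B X → finrank F X = j + 1 → C.space j ≤ X → ¬ X ≤ bperp B (C.space (j+1)) →
    ∃ D, ell m C D ∧ D.space (j+1) = X := by
  have := hB.fd
  induction m with
  | zero =>
    intro j C X hj h1 h2 h3 h4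
    obtain rfl : n = j + 1 := by omega
    obtain ⟨D, hD, hD'⟩ := exists_upd C (i := j+1) (by omega) le_rfl h1 h2 h3 (by omega)
    refine ⟨D, adj_of (fun i hi => (hD' i hi).symm) ?_, hD⟩
    rw [hD]
    intro e
    apply h4
    rw [e]; exact tiso_iff.1 h1
  | succ m ih =>
    intro j C X hj h1 h2 h3 h4
    have h4' : ¬ C.space (j+1) ≤ bperp B X := fun h => h4 (hB.le_comm h)
    have hCjX : C.space j ≤ bperp B X := h3.trans (tiso_iff.1 h1)
    set U := C.space (j+2) ⊓ bperp B X with hU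
    have hUC : U ≤ C.space (j+2) := inf_le_left
    have hUX : U ≤ bperp B X := inf_le_right
    have hCjU : C.space j ≤ U := le_inf (ch_mono C (by omega) (by omega)) hCjX
    have hlt : U < C.space (j+2) := lt_of_le_of_ne hUC fun e =>
      h4' ((ch_mono C (by omega) (by omega)).trans (e ▸ hUX))
    have hUr : finrank F U = j + 1 := by
      have e1 := Submodule.finrank_lt_finrank_of_lt hlt
      rw [ch_fr C (by omega)] at e1
      -- codimension at most one
      have hXlt : C.space j < X := by
        refine lt_of_le_of_ne h3 fun e => ?_
        have := ch_fr C (show j ≤ n by omega)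
        rw [e] at this; omega
      obtain ⟨x, hx, hx'⟩ := SetLike.exists_of_lt hXlt
      have hXe : X = C.space j ⊔ F ∙ x := by
        refine (Submodule.eq_of_le_of_finrank_le (sup_le hXlt.le ?_) ?_).symm
        · rwa [Submodule.span_singleton_le_iff_mem]
        · have : C.space j < C.space j ⊔ F ∙ x := by
            refine lt_of_le_of_ne le_sup_left fun h => hx' ?_
            rw [h]; exact Submodule.mem_sup_right (Submodule.mem_span_singleton_self x)
          have := Submodule.finrank_lt_finrank_of_lt this
          rw [ch_fr C (by omega)] at this
          omega
      have hUe : U = C.space (j+2) ⊓ bperp B (F ∙ x) := by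
        have hle : C.space (j+2) ≤ bperp B (C.space j) :=
          (tiso_iff.1 (ch_ti C (j+2))).trans (bperp_anti (ch_mono C (show j ≤ j+2 by omega) (by omega)))
        rw [hU, hXe, bperp_sup, ← inf_assoc, inf_eq_left.2 hle]
      have e2 := Submodule.finrank_sup_add_finrank_inf_eq (C.space (j+2)) (bperp B (F ∙ x))
      have e3 : finrank F (F ∙ x) ≤ 1 := fr_span_le x
      rw [← hUe, hB.finrank_perp, ch_fr C (by omega)] at e2
      have e4 := hB.finrank_le (C.space (j+2) ⊔ bperp B (F ∙ x))
      omega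
    have hUt : IsTotIso B U := tiso_mono hUC (ch_ti C _)
    have hUne : U ≠ C.space (j+1) := fun e => h4' (e ▸ hUX)
    obtain ⟨C1, hC1, hC1'⟩ := exists_upd C (i := j+1) (by omega) (by omega) hUt hUr hCjU
      (fun _ => hUC)
    have hXU : ¬ X ≤ U := fun h => h4 ((h.trans hUC).trans
      ((tiso_iff.1 (ch_ti C (j+2))).trans (bperp_anti (ch_mono C (by omega) (by omega)))))
    have hX't : IsTotIso B (U ⊔ X) := hB.tiso_sup hUt h1 (hB.le_comm hUX)
    have hX'r : finrank F ↥(U ⊔ X) = j + 1 + 1 := by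
      have e2 := Submodule.finrank_sup_add_finrank_inf_eq U X
      have e3 : C.space j ≤ U ⊓ X := le_inf hCjU h3
      have e4 := Submodule.finrank_mono e3
      have e5 : U < U ⊔ X := lt_of_le_of_ne le_sup_left fun e => hXU (by rw [e]; exact le_sup_right)
      have e6 := Submodule.finrank_lt_finrank_of_lt e5
      rw [ch_fr C (by omega)] at e4
      omega
    obtain ⟨D1, hD1, hD1'⟩ := ih (j+1) C1 (U ⊔ X) (by omega) hX't hX'r (by rw [hC1]; exact le_sup_left)
      (fun h => h4 (by
        rw [hC1' (j+1+1) (by omega)] at h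
        exact (le_sup_right.trans h).trans (bperp_anti (ch_mono C (by omega) (by omega)))))
    have r := rel_of_ell hB m (j+1) C1 D1 (by omega) hD1
    obtain ⟨D, hD, hD'⟩ := exists_upd D1 (i := j+1) (by omega) (by omega) h1 h2
      (by rw [show j + 1 - 1 = j by omega, r.low j (by omega), hC1' j (by omega)]; exact h3)
      (fun _ => by rw [hD1']; exact le_sup_right)
    refine ⟨D, ⟨C1, D1, ?_, hD1, ?_⟩, hD⟩
    · rw [show n - (m+1) = j+1 by omega]
      exact adj_of (fun i hi => (hC1' i hi).symm) (by rw [hC1]; exact hUne.symm)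
    · rw [show n - (m+1) = j+1 by omega]
      refine adj_of (fun i hi => (hD' i hi).symm) ?_
      rw [hD, r.low (j+1) le_rfl, hC1]
      exact fun e => hXU (e ▸ le_rfl)

/-- uniqueness of the intermediate chambers in `ell` -/
lemma ell_mid (hB : Sp B n) {m j : ℕ} (hj : j + (m + 1) + 1 = n) {C C1 D1 D : Ch B n}
    (h1 : adj (j+1) C C1) (h2 : ell m C1 D1) (h3 : adj (j+1) D1 D) :
    C1.space (j+1) = C.space (j+2) ⊓ D.space (j+2) ∧
    D1.space (j+1) = C.space (j+2) ⊓ D.space (j+2) := by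
  have := hB.fd
  have r := rel_of_ell hB m (j+1) C1 D1 (by omega) h2
  have hC2 : C1.space (j+2) = C.space (j+2) := (h1.1 (j+2) (by omega)).symm
  have hD2 : D1.space (j+2) = D.space (j+2) := h3.1 (j+2) (by omega)
  have hne : C.space (j+2) ≠ D.space (j+2) := by
    intro e
    apply r.opp
    rw [show j+1+1 = j+2 by omega, hC2, hD2, e]
    exact tiso_iff.1 (ch_ti D _)
  have : C.space (j+2) ⊓ D.space (j+2) = C1.space (j+1) := by
    refine inf_eq_of_ne (i := j+1) (ch_fr C (by omega)) (ch_fr D (by omega)) (ch_fr C1 (by omega)) ?_ ?_ hne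
    · rw [← hC2]; exact ch_mono C1 (by omega) (by omega)
    · rw [← hD2, ← r.low (j+1) le_rfl]; exact ch_mono D1 (by omega) (by omega)
  rw [this]
  exact ⟨rfl, r.low (j+1) le_rfl⟩

end Gm

set_option linter.unusedSectionVars false

namespace Gm

section mat
variable {ι : Type} [Fintype ι]

/-- 0/1 matrix of a relation -/
noncomputable def relMat (r : ι → ι → Prop) : Matrix ι ι ℝ := Matrix.of fun a b => if r a b then 1 else 0

/-- operator of a matrix -/
noncomputable def op (M : Matrix ι ι ℝ) : Module.End ℝ (EuclideanSpace ℝ ι) :=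
  Matrix.toLpLinAlgEquiv 2 M

lemma op_mul (M N : Matrix ι ι ℝ) : op (M * N) = op M * op N := map_mul _ _ _
lemma op_one : op (1 : Matrix ι ι ℝ) = 1 := map_one _
lemma op_add (M N : Matrix ι ι ℝ) : op (M + N) = op M + op N := map_add _ _ _
lemma op_smul (c : ℝ) (M : Matrix ι ι ℝ) : op (c • M) = c • op M := map_smul _ _ _

lemma op_apply (M : Matrix ι ι ℝ) (v : EuclideanSpace ℝ ι) (a : ι) :
    op M v a = ∑ b, M a b * v b := by
  rfl

lemma op_rel_apply (r : ι → ι → Prop) (v : EuclideanSpace ℝ ι) (a : ι) :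
    op (relMat r) v a = ∑ b ∈ Finset.univ.filter (r a), v b := by
  rw [op_apply, Finset.sum_filter]
  refine Finset.sum_congr rfl fun b _ => ?_
  simp only [relMat, Matrix.of_apply]
  split_ifs <;> simp

lemma op_sym {M : Matrix ι ι ℝ} (h : M.transpose = M) : (op M).IsSymmetric := by
  refine (Matrix.isSymmetric_toEuclideanLin_iff (A := M)).2 ?_
  rw [Matrix.IsHermitian, Matrix.conjTranspose_eq_transpose_of_trivial, h]

lemma relMat_transpose (r : ι → ι → Prop) : (relMat r).transpose = relMat fun a b => r b a := by
  ext a b; rfl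

lemma relMat_mul {r s t : ι → ι → Prop} (h : ∀ a c, t a c ↔ ∃ b, r a b ∧ s b c)
    (hu : ∀ a b b' c, r a b → s b c → r a b' → s b' c → b = b') :
    relMat r * relMat s = relMat t := by
  ext a c
  rw [Matrix.mul_apply]
  simp only [relMat, Matrix.of_apply]
  by_cases ht : t a c
  · rw [if_pos ht]
    obtain ⟨b, h1, h2⟩ := (h a c).1 ht
    rw [Finset.sum_eq_single b]
    · simp [h1, h2]
    · intro b' _ hb'
      by_cases h3 : r a b'
      · rw [if_neg (fun h4 => hb' (hu a b' b c h3 h4 h1 h2)), mul_zero]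
      · rw [if_neg h3, zero_mul]
    · simp
  · rw [if_neg ht]
    refine Finset.sum_eq_zero fun b _ => ?_
    by_cases h3 : r a b
    · rw [if_neg (fun h4 => ht ((h a c).2 ⟨b, h3, h4⟩)), mul_zero]
    · rw [if_neg h3, zero_mul]

end mat

section cnt
variable {F V : Type} [Field F] [Fintype F] [AddCommGroup V] [Module F V]

lemma card_sub [FiniteDimensional F V] (U W : Submodule F V) (hUW : U ≤ W) :
    Nat.card {v : V // v ∈ W ∧ v ∉ U} = Fintype.card F ^ finrank F W - Fintype.card F ^ finrank F U := by
  have : Finite V := Module.finite_of_finite F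
  have h1 : Nat.card W = Fintype.card F ^ finrank F W := by
    rw [Module.natCard_eq_pow_finrank (K := F), Nat.card_eq_fintype_card]
  have h2 : Nat.card U = Fintype.card F ^ finrank F U := by
    rw [Module.natCard_eq_pow_finrank (K := F), Nat.card_eq_fintype_card]
  rw [← h1, ← h2]
  change Nat.card ((W : Set V) \ (U : Set V) : Set V) = Nat.card (W : Set V) - Nat.card (U : Set V)
  rw [Nat.card_coe_set_eq, Nat.card_coe_set_eq, Nat.card_coe_set_eq]
  exact Set.ncard_sdiff hUW

lemma fr_sup_span [FiniteDimensional F V] {U : Submodule F V} {x : V} (hx : x ∉ U) :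
    finrank F ↥(U ⊔ F ∙ x) = finrank F U + 1 := by
  have h1 : U < U ⊔ F ∙ x := by
    refine lt_of_le_of_ne le_sup_left fun h => hx ?_
    rw [h]; exact Submodule.mem_sup_right (Submodule.mem_span_singleton_self x)
  have h2 := Submodule.finrank_lt_finrank_of_lt h1
  have h3 := Submodule.finrank_add_le_finrank_add_finrank U (F ∙ x)
  have h4 := fr_span_le (F := F) x
  omega

lemma sup_span_eq [FiniteDimensional F V] {U X : Submodule F V} {x : V} (hx : x ∉ U) (hxX : x ∈ X)
    (hU : U ≤ X) (hf : finrank F X = finrank F U + 1) : U ⊔ F ∙ x = X :=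
  Submodule.eq_of_le_of_finrank_eq (sup_le hU (by rwa [Submodule.span_singleton_le_iff_mem]))
    (by rw [fr_sup_span hx, hf])

lemma card_between [FiniteDimensional F V] (U W : Submodule F V) (hUW : U ≤ W) (j : ℕ)
    (hU : finrank F U = j) :
    Nat.card {X : Submodule F V // U ≤ X ∧ X ≤ W ∧ finrank F X = j + 1} *
      (Fintype.card F ^ (j+1) - Fintype.card F ^ j) =
      Fintype.card F ^ finrank F W - Fintype.card F ^ j := by
  have : Finite V := Module.finite_of_finite F
  have : Finite (Submodule F V) := Finite.of_injective (fun W => (W : Set V)) SetLike.coe_injective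
  have h1 := card_sub U W hUW
  rw [hU] at h1
  rw [← h1]
  let f : {v : V // v ∈ W ∧ v ∉ U} → {X : Submodule F V // U ≤ X ∧ X ≤ W ∧ finrank F X = j + 1} :=
    fun v => ⟨U ⊔ F ∙ v.1, le_sup_left, sup_le hUW
      (by rw [Submodule.span_singleton_le_iff_mem]; exact v.2.1), by rw [fr_sup_span v.2.2, hU]⟩
  rw [← Nat.card_congr (Equiv.sigmaFiberEquiv f)]
  have := Fintype.ofFinite {X : Submodule F V // U ≤ X ∧ X ≤ W ∧ finrank F X = j + 1}
  rw [Nat.card_sigma]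
  rw [Finset.sum_congr rfl (g := fun _ => Fintype.card F ^ (j+1) - Fintype.card F ^ j), Finset.sum_const,
    Finset.card_univ, smul_eq_mul, Nat.card_eq_fintype_card]
  rintro ⟨X, hX1, hX2, hX3⟩ _
  have h2 := card_sub U X hX1
  rw [hU, hX3] at h2
  rw [← h2]
  refine Nat.card_congr ⟨fun v => ⟨v.1.1, ?_, v.1.2.2⟩, fun v => ⟨⟨v.1, hX2 v.2.1, v.2.2⟩, ?_⟩, ?_, ?_⟩
  · have h3 := congrArg Subtype.val v.2
    simp only [f] at h3
    exact h3.le (Submodule.mem_sup_right (Submodule.mem_span_singleton_self _))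
  · apply Subtype.ext
    exact sup_span_eq v.2.2 v.2.1 hX1 (by rw [hX3, hU])
  · intro v; rfl
  · intro v; rfl

end cnt
end Gm

set_option linter.unusedSectionVars false

namespace Gm
variable {F V : Type} [Field F] [AddCommGroup V] [Module F V]
variable {B : V →ₗ[F] V →ₗ[F] F} {n : ℕ}

lemma adj_zero {C D : Ch B n} : ¬ adj 0 C D := by
  intro h
  exact adj_ne h (by rw [ch_zero, ch_zero])

lemma comm_half {i j : ℕ} (hj1 : 1 ≤ j) (hj : j ≤ n) (hij : i ≠ j)
    (h1 : i + 1 ≠ j) (h2 : j + 1 ≠ i) {C E D : Ch B n} (hCE : adj i C E) (hED : adj j E D) :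
    ∃ E', adj j C E' ∧ adj i E' D := by
  obtain ⟨E', hE, hE'⟩ := exists_upd C (i := j) hj1 hj (ch_ti D j) (ch_fr D hj)
    (by rw [hCE.1 (j-1) (by omega), hED.1 (j-1) (by omega)]; exact ch_mono D (by omega) hj)
    (fun h => by
      rw [hCE.1 (j+1) (by omega), hED.1 (j+1) (by omega)]; exact ch_mono D (by omega) h)
  refine ⟨E', adj_of (fun k hk => (hE' k hk).symm) ?_, adj_of (fun k hk => ?_) ?_⟩
  · rw [hE, hCE.1 j (by omega)]; exact adj_ne hED
  · by_cases h : k = j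
    · rw [h, hE]
    · rw [hE' k h, hCE.1 k hk, hED.1 k h]
  · rw [hE' i hij, ← hED.1 i hij]; exact adj_ne hCE

lemma comm_uniq {i j : ℕ} (hij : i ≠ j) {C E E' D : Ch B n} (hCE : adj i C E) (hED : adj j E D)
    (hCE' : adj i C E') (hED' : adj j E' D) : E = E' := by
  refine ch_ext fun k _ _ => ?_
  by_cases h : k = i
  · rw [h, hED.1 i hij, hED'.1 i hij]
  · rw [← hCE.1 k h, ← hCE'.1 k h]

lemma comm_mat [Fintype (Ch B n)] {i j : ℕ} (hi1 : 1 ≤ i) (hj1 : 1 ≤ j) (hi : i ≤ n) (hj : j ≤ n)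
    (h1 : i + 2 ≤ j) :
    relMat (adj (B := B) (n := n) i) * relMat (adj j) = relMat (adj j) * relMat (adj i) := by
  rw [relMat_mul (t := fun C D => ∃ E, adj i C E ∧ adj j E D) (fun _ _ => Iff.rfl)
    (fun a b b' c => comm_uniq (by omega)),
    relMat_mul (t := fun C D => ∃ E, adj i C E ∧ adj j E D) _ (fun a b b' c => comm_uniq (by omega))]
  intro a c
  constructor
  · rintro ⟨E, h2, h3⟩
    exact comm_half hj1 hj (by omega) (by omega) (by omega) h2 h3
  · rintro ⟨E, h2, h3⟩
    exact comm_half hi1 hi (by omega) (by omega) (by omega) h2 h3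

/-- common description of both braid products -/
def br (i : ℕ) (C D : Ch B n) : Prop := (∀ k, k ≠ i → k ≠ i + 1 → C.space k = D.space k) ∧
  ¬ D.space i ≤ C.space (i+1) ∧ ¬ C.space i ≤ D.space (i+1)

lemma br1 (hB : Sp B n) {i : ℕ} (hi : i + 2 ≤ n) {C E E' D : Ch B n} (h1 : adj i C E)
    (h2 : adj (i+1) E E') (h3 : adj i E' D) :
    br i C D ∧ E.space i = C.space (i+1) ⊓ D.space (i+1) := by
  have := hB.fd
  have e1 : C.space (i+1) = E.space (i+1) := h1.1 _ (by omega)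
  have e2 : E'.space (i+1) = D.space (i+1) := h3.1 _ (by omega)
  have e3 : E.space i = E'.space i := h2.1 _ (by omega)
  have hne : C.space (i+1) ≠ D.space (i+1) := by rw [e1, ← e2]; exact adj_ne h2
  have hU : C.space (i+1) ⊓ D.space (i+1) = E.space i := by
    refine inf_eq_of_ne (i := i) (ch_fr C (by omega)) (ch_fr D (by omega)) (ch_fr E (by omega)) ?_ ?_ hne
    · rw [e1]; exact ch_mono E (by omega) (by omega)
    · rw [← e2, e3]; exact ch_mono E' (by omega) (by omega)
  refine ⟨⟨fun k hk hk' => ?_, fun h => ?_, fun h => ?_⟩, hU.symm⟩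
  · rw [h1.1 k hk, h2.1 k hk', h3.1 k hk]
  · have : D.space i ≤ E.space i := by rw [← hU]; exact le_inf h (ch_mono D (by omega) (by omega))
    have := Submodule.eq_of_le_of_finrank_eq this (by rw [ch_fr D (by omega), ch_fr E (by omega)])
    exact adj_ne h3 (by rw [this, e3])
  · have : C.space i ≤ E.space i := by rw [← hU]; exact le_inf (ch_mono C (by omega) (by omega)) h
    have := Submodule.eq_of_le_of_finrank_eq this (by rw [ch_fr C (by omega), ch_fr E (by omega)])
    exact adj_ne h1 this

lemma br2 (hB : Sp B n) {i : ℕ} (hi : i + 2 ≤ n) {C E E' D : Ch B n} (h1 : adj (i+1) C E)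
    (h2 : adj i E E') (h3 : adj (i+1) E' D) :
    br i C D ∧ E.space (i+1) = C.space i ⊔ D.space i := by
  have := hB.fd
  have e1 : C.space i = E.space i := h1.1 _ (by omega)
  have e2 : E'.space i = D.space i := h3.1 _ (by omega)
  have e3 : E.space (i+1) = E'.space (i+1) := h2.1 _ (by omega)
  have hne : C.space i ≠ D.space i := by rw [e1, ← e2]; exact adj_ne h2
  have hU : C.space i ⊔ D.space i = E.space (i+1) := by
    refine sup_eq_of_ne (i := i) (ch_fr C (by omega)) (ch_fr D (by omega)) (ch_fr E (by omega)) ?_ ?_ hne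
    · rw [e1]; exact ch_mono E (by omega) (by omega)
    · rw [← e2, e3]; exact ch_mono E' (by omega) (by omega)
  refine ⟨⟨fun k hk hk' => ?_, fun h => ?_, fun h => ?_⟩, hU.symm⟩
  · rw [h1.1 k hk', h2.1 k hk, h3.1 k hk']
  · have : E.space (i+1) ≤ C.space (i+1) := by rw [← hU]; exact sup_le (ch_mono C (by omega) (by omega)) h
    have := Submodule.eq_of_le_of_finrank_eq this (by rw [ch_fr C (by omega), ch_fr E (by omega)])
    exact adj_ne h1 this.symm
  · have : E.space (i+1) ≤ D.space (i+1) := by rw [← hU]; exact sup_le h (ch_mono D (by omega) (by omega))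
    have := Submodule.eq_of_le_of_finrank_eq this (by rw [ch_fr D (by omega), ch_fr E (by omega)])
    exact adj_ne h3 (by rw [← e3, this])

lemma br1' (hB : Sp B n) {i : ℕ} (hi1 : 1 ≤ i) (hi : i + 2 ≤ n) {C D : Ch B n} (h : br i C D) :
    ∃ E E', adj i C E ∧ adj (i+1) E E' ∧ adj i E' D := by
  have := hB.fd
  obtain ⟨h0, h1, h2⟩ := h
  have hne : C.space (i+1) ≠ D.space (i+1) := fun e => h1 (e ▸ ch_mono D (by omega) (by omega))
  have h3 := h0 (i+2) (by omega) (by omega)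
  have hs : C.space (i+1) ⊔ D.space (i+1) = C.space (i+2) :=
    sup_eq_of_ne (ch_fr C (by omega)) (ch_fr D (by omega)) (ch_fr C (by omega))
      (ch_mono C (by omega) (by omega)) (h3 ▸ ch_mono D (by omega) (by omega)) hne
  have hd := Submodule.finrank_sup_add_finrank_inf_eq (C.space (i+1)) (D.space (i+1))
  rw [hs, ch_fr C (by omega), ch_fr C (by omega), ch_fr D (by omega)] at hd
  have hlow := h0 (i-1) (by omega) (by omega)
  have hl : C.space (i-1) ≤ C.space (i+1) ⊓ D.space (i+1) :=
    le_inf (ch_mono C (by omega) (by omega)) (hlow ▸ ch_mono D (by omega) (by omega))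
  have hUt : IsTotIso B (C.space (i+1) ⊓ D.space (i+1)) := tiso_mono inf_le_left (ch_ti C _)
  obtain ⟨E, hE, hE'⟩ := exists_upd C (i := i) hi1 (by omega) hUt (by omega) hl (fun _ => inf_le_left)
  obtain ⟨G, hG, hG'⟩ := exists_upd D (i := i) hi1 (by omega) hUt (by omega) (hlow ▸ hl)
    (fun _ => inf_le_right)
  refine ⟨E, G, adj_of (fun k hk => (hE' k hk).symm) ?_, adj_of (fun k hk => ?_) ?_,
    adj_of (fun k hk => hG' k hk) ?_⟩
  · rw [hE]; exact fun e => h2 (e ▸ inf_le_right)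
  · by_cases hki : k = i
    · rw [hki, hE, hG]
    · rw [hE' k hki, hG' k hki, h0 k hki hk]
  · rw [hE' _ (by omega), hG' _ (by omega)]; exact hne
  · rw [hG]; exact fun e => h1 (e ▸ inf_le_left)

lemma br2' (hB : Sp B n) {i : ℕ} (hi1 : 1 ≤ i) (hi : i + 2 ≤ n) {C D : Ch B n} (h : br i C D) :
    ∃ E E', adj (i+1) C E ∧ adj i E E' ∧ adj (i+1) E' D := by
  have := hB.fd
  obtain ⟨h0, h1, h2⟩ := h
  have hne : C.space i ≠ D.space i := fun e => h1 (e ▸ ch_mono C (by omega) (by omega))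
  have h3 := h0 (i+2) (by omega) (by omega)
  have hlow := h0 (i-1) (by omega) (by omega)
  have hs : C.space i ⊓ D.space i = C.space (i-1) :=
    inf_eq_of_ne (i := i-1) (by rw [ch_fr C (by omega)]; omega) (by rw [ch_fr D (by omega)]; omega)
      (ch_fr C (by omega))
      (ch_mono C (by omega) (by omega)) (hlow ▸ ch_mono D (by omega) (by omega)) hne
  have hd := Submodule.finrank_sup_add_finrank_inf_eq (C.space i) (D.space i)
  rw [hs, ch_fr C (by omega), ch_fr C (by omega), ch_fr D (by omega)] at hd
  have hl : C.space i ⊔ D.space i ≤ C.space (i+2) :=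
    sup_le (ch_mono C (by omega) (by omega)) (h3 ▸ ch_mono D (by omega) (by omega))
  have hUt : IsTotIso B (C.space i ⊔ D.space i) := tiso_mono hl (ch_ti C _)
  obtain ⟨E, hE, hE'⟩ := exists_upd C (i := i+1) (by omega) (by omega) hUt (by omega) le_sup_left
    (fun _ => hl)
  obtain ⟨G, hG, hG'⟩ := exists_upd D (i := i+1) (by omega) (by omega) hUt (by omega) le_sup_right
    (fun _ => h3 ▸ hl)
  refine ⟨E, G, adj_of (fun k hk => (hE' k hk).symm) ?_, adj_of (fun k hk => ?_) ?_,
    adj_of (fun k hk => hG' k hk) ?_⟩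
  · rw [hE]; exact fun e => h1 (e ▸ le_sup_right)
  · by_cases hki : k = i+1
    · rw [hki, hE, hG]
    · rw [hE' k hki, hG' k hki, h0 k hk hki]
  · rw [hE' _ (by omega), hG' _ (by omega)]; exact hne
  · rw [hG]; exact fun e => h2 (e ▸ le_sup_left)

lemma relMat_mul3 {ι : Type} [Fintype ι] {r s u t : ι → ι → Prop}
    (h : ∀ a d, t a d ↔ ∃ b c, r a b ∧ s b c ∧ u c d)
    (hu : ∀ a b c b' c' d, r a b → s b c → u c d → r a b' → s b' c' → u c' d → b = b')
    (hu2 : ∀ b c c' d, s b c → u c d → s b c' → u c' d → c = c') :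
    relMat r * relMat s * relMat u = relMat t := by
  rw [mul_assoc, relMat_mul (r := s) (s := u) (t := fun b d => ∃ c, s b c ∧ u c d) (fun _ _ => Iff.rfl),
    relMat_mul (t := t)]
  · intro a d; rw [h]; constructor
    · rintro ⟨b, c, h1, h2, h3⟩; exact ⟨b, h1, c, h2, h3⟩
    · rintro ⟨b, h1, c, h2, h3⟩; exact ⟨b, c, h1, h2, h3⟩
  · rintro a b b' d h1 ⟨c, h2, h3⟩ h1' ⟨c', h2', h3'⟩
    exact (hu a b c b' c' d h1 h2 h3 h1' h2' h3')
  · exact hu2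

lemma braid_mat (hB : Sp B n) [Fintype (Ch B n)] {i : ℕ} (hi1 : 1 ≤ i) (hi : i + 2 ≤ n) :
    relMat (adj (B := B) (n := n) (i+1)) * relMat (adj i) * relMat (adj (i+1))
     = relMat (adj i) * relMat (adj (i+1)) * relMat (adj i) := by
  rw [relMat_mul3 (t := br i), relMat_mul3 (t := br i)]
  · intro C D
    constructor
    · exact br1' hB hi1 hi
    · rintro ⟨E, E', h1, h2, h3⟩; exact (br1 hB hi h1 h2 h3).1
  · intro C E E' G G' D h1 h2 h3 h1' h2' h3'
    refine eqv_eq (eqv_trans (eqv_symm h1.1) h1'.1) ?_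
    rw [(br1 hB hi h1 h2 h3).2, (br1 hB hi h1' h2' h3').2]
  · exact fun a b b' c => comm_uniq (by omega)
  · intro C D
    constructor
    · exact br2' hB hi1 hi
    · rintro ⟨E, E', h1, h2, h3⟩; exact (br2 hB hi h1 h2 h3).1
  · intro C E E' G G' D h1 h2 h3 h1' h2' h3'
    refine eqv_eq (eqv_trans (eqv_symm h1.1) h1'.1) ?_
    rw [(br2 hB hi h1 h2 h3).2, (br2 hB hi h1' h2' h3').2]
  · exact fun a b b' c => comm_uniq (by omega)

/-- the generators -/
noncomputable def RR (B : V →ₗ[F] V →ₗ[F] F) (n : ℕ) [Fintype (Ch B n)] (k : ℕ) :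
    Module.End ℝ (EuclideanSpace ℝ (Ch B n)) := op (relMat (adj (n-k)))

lemma LL_mat (hB : Sp B n) [Fintype (Ch B n)] {m : ℕ} (hm : m < n) :
    Hk.LL (RR B n) m = op (relMat (ell m)) := by
  induction m with
  | zero => rfl
  | succ m ih =>
    obtain ⟨j, hj⟩ : ∃ j, j + (m+1) + 1 = n := ⟨n - (m+1) - 1, by omega⟩
    have e : n - (m+1) = j + 1 := by omega
    rw [Hk.LL, ih (by omega), RR, ← op_mul, ← op_mul, relMat_mul3 (t := ell (m+1))]
    · intro C D; rfl
    · rw [e]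
      intro C C1 D1 C2 D2 D h1 h2 h3 h1' h2' h3'
      refine eqv_eq (eqv_trans (eqv_symm h1.1) h1'.1) ?_
      rw [(ell_mid hB hj h1 h2 h3).1, (ell_mid hB hj h1' h2' h3').1]
    · rw [e]
      intro C D1 D2 D h1 h2 h1' h2'
      refine eqv_eq (eqv_trans h2.1 (eqv_symm h2'.1)) ?_
      rw [(rel_of_ell hB m (j+1) C D1 (by omega) h1).low _ le_rfl,
        (rel_of_ell hB m (j+1) C D2 (by omega) h1').low _ le_rfl]

lemma TT_mat (hB : Sp B n) [Fintype (Ch B n)] {m : ℕ} (hm : m ≤ n) :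
    Hk.TT (RR B n) m = op (relMat (tt m)) := by
  induction m with
  | zero =>
    rw [Hk.TT, ← op_one]
    congr 1
  | succ m ih =>
    obtain ⟨j, hj⟩ : ∃ j, j + m + 1 = n := ⟨n - m - 1, by omega⟩
    rw [Hk.TT, ih (by omega), LL_mat hB (by omega), ← op_mul, relMat_mul (t := tt (m+1))]
    · intro C D; rfl
    · intro C E E' D h1 h2 h1' h2'
      refine rel_det hB (j := j) (by omega) (rel_of_ell hB m j _ _ hj h1)
        (rel_of_ell hB m j _ _ hj h1') ?_
      rw [← (opp_of_tt hB m (j+1) _ _ (by omega) h2).low _ le_rfl,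
        ← (opp_of_tt hB m (j+1) _ _ (by omega) h2').low _ le_rfl]

lemma fr_inf_perp (hB : Sp B n) {X Y : Submodule F V} (h : finrank F X = finrank F Y) :
    finrank F ↥(X ⊓ bperp B Y) = finrank F ↥(Y ⊓ bperp B X) := by
  have := hB.fd
  have h1 := Submodule.finrank_sup_add_finrank_inf_eq X (bperp B Y)
  have h2 : bperp B (X ⊔ bperp B Y) = Y ⊓ bperp B X := by
    rw [bperp_sup, hB.perp_perp, inf_comm]
  rw [← h2, hB.finrank_perp]
  rw [hB.finrank_perp] at h1
  have h3 := hB.finrank_le Y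
  have h4 := hB.finrank_le (X ⊔ bperp B Y)
  omega

lemma Opp.symm (hB : Sp B n) {j : ℕ} {C D : Ch B n} (hj : j ≤ n) (h : Opp j C D) : Opp j D C := by
  have := hB.fd
  refine ⟨fun i hi => (h.low i hi).symm, fun i h1 h2 => ?_⟩
  have e1 := fr_inf_perp hB (X := D.space i) (Y := C.space i) (by rw [ch_fr D h2, ch_fr C h2])
  have e2 := Submodule.finrank_mono (h.opp i h1 h2)
  rw [ch_fr C hj] at e2
  have e3 : D.space j ≤ C.space i ⊓ bperp B (D.space i) := by
    refine le_inf ?_ ((ch_mono D h1 h2).trans (tiso_iff.1 (ch_ti D i)))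
    rw [h.low j le_rfl]; exact ch_mono C h1 h2
  exact (Submodule.eq_of_le_of_finrank_le e3 (by rw [ch_fr D hj]; omega)).ge

lemma tt2_of_opp (hB : Sp B n) {j : ℕ} (hj : j + 2 = n) {C D : Ch B n} (h : Opp j C D) : tt 2 C D := by
  have := hB.fd
  have hX : ¬ D.space (j+1) ≤ bperp B (C.space (j+1)) := by
    intro e
    have h1 := h.opp (j+1) (by omega) (by omega)
    rw [inf_eq_left.2 e] at h1
    have := Submodule.finrank_mono h1
    rw [ch_fr C (by omega), ch_fr D (by omega)] at this
    omega
  obtain ⟨E, hE, hE'⟩ := ell_exists hB 1 j C (D.space (j+1)) (by omega) (ch_ti D _) (ch_fr D (by omega))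
    (by rw [← h.low j le_rfl]; exact ch_mono D (by omega) (by omega)) hX
  have r := rel_of_ell hB 1 j C E (by omega) hE
  refine ⟨E, hE, D, ?_, rfl⟩
  change adj n E D
  refine adj_of (fun k hk => ?_) fun e => ?_
  · rcases Nat.lt_or_ge k (j+1) with h1 | h1
    · rw [r.low k (by omega), h.low k (by omega)]
    · rcases Nat.lt_or_ge k (j+2) with h2 | h2
      · obtain rfl : k = j+1 := by omega
        exact hE'
      · have : k ∉ Finset.Icc 1 n := by rw [Finset.mem_Icc]; omega
        rw [E.eq_bot k this, D.eq_bot k this]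
  · have h1 := r.up n (by omega) le_rfl
    rw [e] at h1
    obtain ⟨x, hx⟩ := exists_sup_span hB (j := j) (by omega) (r.low j le_rfl)
    rw [hx, ← sup_assoc, sup_eq_left.2 (ch_mono C (by omega) le_rfl)] at h1
    have h2 : C.space n ⊔ D.space n ≤ C.space n ⊔ F ∙ x := sup_le le_sup_left h1
    have h3 := Submodule.finrank_mono h2
    have h4 := Submodule.finrank_add_le_finrank_add_finrank (C.space n) (F ∙ x)
    have h5 := fr_span_le (F := F) x
    have h6 := Submodule.finrank_sup_add_finrank_inf_eq (C.space n) (D.space n)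
    have h7 := h.opp n (by omega) le_rfl
    rw [hB.perp_gen (ch_ti C n) (ch_fr C le_rfl), inf_comm] at h7
    have h8 := Submodule.finrank_mono h7
    rw [ch_fr C (by omega)] at h8
    rw [ch_fr C le_rfl] at h4 h6
    rw [ch_fr D le_rfl] at h6
    omega

lemma b2_mat (hB : Sp B n) [Fintype (Ch B n)] (hn : 1 < n) :
    RR B n 0 * RR B n 1 * RR B n 0 * RR B n 1 = RR B n 1 * RR B n 0 * RR B n 1 * RR B n 0 := by
  have h1 : RR B n 1 * RR B n 0 * RR B n 1 * RR B n 0 = op (relMat (tt 2)) := by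
    rw [← TT_mat hB (by omega)]
    simp only [Hk.TT, Hk.LL, mul_one, mul_assoc, Nat.zero_add]
  have h2 : relMat (tt (B := B) (n := n) 2) = (relMat (tt 2)).transpose := by
    rw [relMat_transpose]
    congr 1
    funext C D
    obtain ⟨j, hj⟩ : ∃ j, j + 2 = n := ⟨n - 2, by omega⟩
    apply propext
    constructor
    · exact fun h => tt2_of_opp hB hj ((opp_of_tt hB 2 j _ _ hj h).symm hB (by omega))
    · exact fun h => tt2_of_opp hB hj ((opp_of_tt hB 2 j _ _ hj h).symm hB (by omega))
  have hs : ∀ i, (relMat (adj (B := B) (n := n) i)).transpose = relMat (adj i) := by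
    intro i; rw [relMat_transpose]; congr 1; funext C D
    exact propext ⟨adj_symm, adj_symm⟩
  have h3 : relMat (tt (B := B) (n := n) 2) = relMat (adj (n-1)) * relMat (adj (n-0)) *
      relMat (adj (n-1)) * relMat (adj (n-0)) := by
    apply (Matrix.toLpLinAlgEquiv (R := ℝ) (n := Ch B n) 2).injective
    change op _ = op _
    rw [← h1, op_mul, op_mul, op_mul]; rfl
  rw [h1, h2, h3]
  simp only [Matrix.transpose_mul, hs, op_mul, ← mul_assoc]
  rfl

lemma class_card [Fintype F] (hB : Sp B n) [Fintype (Ch B n)] {i : ℕ} (hi1 : 1 ≤ i) (hi : i ≤ n)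
    (C : Ch B n) : (Finset.univ.filter (eqv i C)).card = Fintype.card F + 1 := by
  have := hB.fd
  obtain ⟨j, rfl⟩ : ∃ j, i = j + 1 := ⟨i - 1, by omega⟩
  obtain ⟨W, hW1, hW2, hW3, hW4⟩ : ∃ W : Submodule F V, C.space j ≤ W ∧ finrank F W = j + 2 ∧
      W ≤ bperp B (C.space j) ∧
      ∀ X : Submodule F V, finrank F X = j+1 → C.space j ≤ X → X ≤ bperp B (C.space j) →
        (X ≤ W ↔ (j + 1 < n → X ≤ C.space (j+2))) := by
    rcases Nat.lt_or_ge (j+1) n with h | h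
    · refine ⟨C.space (j+2), ch_mono C (by omega) (by omega), ch_fr C (by omega), 
        (tiso_iff.1 (ch_ti C (j+2))).trans (bperp_anti (ch_mono C (by omega) (by omega))), ?_⟩
      intro X _ _ _; simp [h]
    · refine ⟨bperp B (C.space j), tiso_iff.1 (ch_ti C j), ?_, le_rfl, fun X _ _ h1 => ?_⟩
      · rw [hB.finrank_perp, ch_fr C (by omega)]; omega
      · constructor
        · intro _ h'; omega
        · intro _; exact h1
  have hc := card_between (C.space j) W hW1 j (ch_fr C (by omega))
  rw [hW2] at hc
  have e : (Finset.univ.filter (eqv (j+1) C)).card =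
      Nat.card {X : Submodule F V // C.space j ≤ X ∧ X ≤ W ∧ finrank F X = j + 1} := by
    rw [← Fintype.card_coe, ← Nat.card_eq_fintype_card]
    refine Nat.card_congr (Equiv.ofBijective (fun D => ⟨D.1.space (j+1), ?_, ?_, ?_⟩) ⟨?_, ?_⟩)
    · have := (Finset.mem_filter.1 D.2).2 j (by omega)
      rw [this]; exact ch_mono D.1 (by omega) (by omega)
    · have h0 := (Finset.mem_filter.1 D.2).2 
      refine (hW4 _ (ch_fr D.1 (by omega)) ?_ ?_).2 ?_
      · rw [h0 j (by omega)]; exact ch_mono D.1 (by omega) (by omega)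
      · rw [h0 j (by omega)]
        exact (tiso_iff.1 (ch_ti D.1 (j+1))).trans (bperp_anti (ch_mono D.1 (by omega) (by omega)))
      · intro h; rw [h0 (j+2) (by omega)]; exact ch_mono D.1 (by omega) (by omega)
    · exact ch_fr D.1 (by omega)
    · intro D D' h
      have h' := congrArg Subtype.val h
      exact Subtype.ext (eqv_eq (eqv_trans (eqv_symm (Finset.mem_filter.1 D.2).2)
        (Finset.mem_filter.1 D'.2).2) h')
    · rintro ⟨X, h1, h2, h3⟩
      have h4 : IsTotIso B X := hB.tiso_ext (ch_ti C j) h1 (h2.trans hW3) (by rw [h3, ch_fr C (by omega)])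
      obtain ⟨D, hD, hD'⟩ := exists_upd C (i := j+1) (by omega) hi h4 h3 h1
        ((hW4 X h3 h1 (h2.trans hW3)).1 h2)
      exact ⟨⟨D, Finset.mem_filter.2 ⟨Finset.mem_univ _, fun k hk => (hD' k hk).symm⟩⟩, Subtype.ext hD⟩
  rw [e]
  have hq : 1 < Fintype.card F := Fintype.one_lt_card
  have h1 : Fintype.card F ^ (j+1) - Fintype.card F ^ j = Fintype.card F ^ j * (Fintype.card F - 1) := by
    rw [Nat.mul_sub, mul_one, pow_succ]
  have h2 : Fintype.card F ^ (j+2) - Fintype.card F ^ j =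
      (Fintype.card F + 1) * (Fintype.card F ^ j * (Fintype.card F - 1)) := by
    obtain ⟨p, hp⟩ : ∃ p, Fintype.card F = p + 1 := ⟨Fintype.card F - 1, by omega⟩
    rw [hp]
    apply Nat.sub_eq_of_eq_add
    simp only [Nat.add_sub_cancel]; ring
  rw [h1, h2] at hc
  exact Nat.eq_of_mul_eq_mul_right (Nat.mul_pos (pow_pos (by omega) _) (by omega)) hc

lemma quad_mat [Fintype F] (hB : Sp B n) [Fintype (Ch B n)] {i : ℕ} (hi1 : 1 ≤ i) (hi : i ≤ n) :
    relMat (adj (B := B) (n := n) i) * relMat (adj i) =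
      ((Fintype.card F : ℝ) - 1) • relMat (adj i) + (Fintype.card F : ℝ) • 1 := by
  have h1 : relMat (adj (B := B) (n := n) i) = relMat (eqv i) - 1 := by
    ext C D
    simp only [relMat, Matrix.of_apply, Matrix.sub_apply, Matrix.one_apply, adj]
    by_cases h : C = D
    · subst h
      have : eqv i C C := fun _ _ => rfl
      simp [this]
    · simp [h]
  have h2 : relMat (eqv (B := B) (n := n) i) * relMat (eqv i) =
      ((Fintype.card F : ℝ) + 1) • relMat (eqv i) := by
    ext C D
    rw [Matrix.mul_apply, Matrix.smul_apply]
    simp only [relMat, Matrix.of_apply]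
    by_cases h : eqv i C D
    · rw [if_pos h, smul_eq_mul, mul_one]
      have : ∀ E, ((if eqv i C E then (1:ℝ) else 0) * if eqv i E D then 1 else 0) =
          if eqv i C E then 1 else 0 := by
        intro E
        by_cases h' : eqv i C E
        · rw [if_pos h', if_pos (eqv_trans (eqv_symm h') h), mul_one]
        · rw [if_neg h', zero_mul]
      rw [Finset.sum_congr rfl fun E _ => this E, Finset.sum_boole, class_card hB hi1 hi]
      push_cast; rfl
    · rw [if_neg h, smul_zero]
      refine Finset.sum_eq_zero fun E _ => ?_
      by_cases h' : eqv i C E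
      · rw [if_neg (fun h3 => h (eqv_trans h' h3)), mul_zero]
      · rw [if_neg h', zero_mul]
  rw [h1, sub_mul, mul_sub, h2]
  simp only [mul_one, one_mul]
  module

theorem hecke [Fintype F] (hB : Sp B n) [Fintype (Ch B n)] :
    Hk.HeckeSys n (Fintype.card F : ℝ) (RR B n) := by
  refine ⟨?_, ?_, ?_, ?_, ?_, b2_mat hB⟩
  · exact_mod_cast Fintype.one_lt_card
  · intro k hk
    refine op_sym ?_
    rw [relMat_transpose]; congr 1; funext C D
    exact propext ⟨adj_symm, adj_symm⟩
  · intro k hk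
    rw [RR, ← op_mul, quad_mat hB (by omega) (by omega), op_add, op_smul, op_smul, op_one]
  · intro j k hjk hk
    rw [RR, RR, ← op_mul, ← op_mul, comm_mat (i := n - k) (j := n - j)] <;> omega
  · intro k h1 h2
    obtain ⟨i, hi⟩ : ∃ i, n - (k+1) = i := ⟨_, rfl⟩
    rw [RR, RR, hi, show n - k = i + 1 by omega]
    rw [← op_mul, ← op_mul, ← op_mul, ← op_mul, braid_mat hB (by omega) (by omega)]

end Gm

set_option linter.unusedSectionVars false

namespace Gm
variable {F V : Type} [Field F] [Fintype F] [AddCommGroup V] [Module F V]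
variable {B : V →ₗ[F] V →ₗ[F] F} {n : ℕ}

lemma exists_tiso (hB : Sp B n) (i : ℕ) (hi : i ≤ n) : ∃ W : Submodule F V, IsTotIso B W ∧ finrank F W = i := by
  have := hB.fd
  induction i with
  | zero => exact ⟨⊥, tiso_bot, by simp⟩
  | succ i ih =>
    obtain ⟨W, h1, h2⟩ := ih (by omega)
    have hlt : W < bperp B W := by
      refine lt_of_le_of_ne (tiso_iff.1 h1) fun e => ?_
      have := hB.finrank_perp W
      rw [← e, h2] at this; omega
    obtain ⟨x, hx, hx'⟩ := SetLike.exists_of_lt hlt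
    refine ⟨W ⊔ F ∙ x, hB.tiso_ext h1 le_sup_left
      (sup_le hlt.le (by rwa [Submodule.span_singleton_le_iff_mem])) (fr_sup_span hx'), ?_⟩
    rw [fr_sup_span hx', h2]

/-- a full flag in a space together with a transversal one -/
lemma exists_flags [FiniteDimensional F V] (G : Submodule F V) (hG : finrank F G = n) :
    ∃ d e : ℕ → Submodule F V, (∀ i ≤ n, finrank F (d i) = i) ∧ (∀ i ≤ n, finrank F (e i) = n - i) ∧
      Monotone d ∧ Antitone e ∧ d n = G ∧ e 0 = G ∧ ∀ i, d i ⊔ e i = G := by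
  let b := finBasisOfFinrankEq F G hG
  let w : Fin n → V := fun k => (b k : V)
  have hw : LinearIndependent F w := b.linearIndependent.map' G.subtype (by simp)
  have hsp : ∀ s : Set (Fin n), finrank F (Submodule.span F (w '' s)) = s.ncard := by
    intro s
    have h1 : LinearIndepOn F id (w '' s) := by
      have := hw.linearIndepOn_id
      exact this.mono (Set.image_subset_range _ _)
    rw [finrank_span_set_eq_card h1, Set.toFinset_card, ← Nat.card_eq_fintype_card, Nat.card_coe_set_eq,
      Set.ncard_image_of_injective _ hw.injective]
  have htop : Submodule.span F (w '' Set.univ) = G := by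
    rw [Set.image_univ]
    have : Set.range w = G.subtype '' Set.range b := by
      rw [← Set.range_comp]; rfl
    rw [this, Submodule.span_image, b.span_eq, Submodule.map_top, Submodule.range_subtype]
  have hc : ∀ i ≤ n, ({k : Fin n | (k : ℕ) < i}).ncard = i := by
    intro i hi
    have : {k : Fin n | (k : ℕ) < i} = Set.range (Fin.castLE hi) := by
      ext k; constructor
      · intro hk; exact ⟨⟨k, hk⟩, rfl⟩
      · rintro ⟨k, rfl⟩; exact k.2
    rw [this, ← Set.image_univ, Set.ncard_image_of_injective _ (Fin.castLE_injective hi), Set.ncard_univ]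
    simp
  have hcc : ∀ i ≤ n, ({k : Fin n | (k : ℕ) < i}ᶜ).ncard = n - i := by
    intro i hi
    have h1 := Set.ncard_add_ncard_compl {k : Fin n | (k : ℕ) < i}
    rw [hc i hi, Nat.card_eq_fintype_card, Fintype.card_fin] at h1
    omega
  clear_value w
  refine ⟨fun i => Submodule.span F (w '' {k : Fin n | (k : ℕ) < i}),
    fun i => Submodule.span F (w '' {k : Fin n | (k : ℕ) < i}ᶜ), ?_, ?_, ?_, ?_, ?_, ?_, ?_⟩
  · intro i hi; rw [hsp, hc i hi]
  · intro i hi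
    have h1 := hcc i hi
    change finrank F (Submodule.span F (w '' {k : Fin n | (k : ℕ) < i}ᶜ)) = n - i
    rw [hsp, h1]
  · intro i j hij
    exact Submodule.span_mono (Set.image_mono fun k hk => lt_of_lt_of_le hk hij)
  · intro i j hij
    exact Submodule.span_mono (Set.image_mono fun k hk hk' => hk (lt_of_lt_of_le hk' hij))
  · have h1 : {k : Fin n | (k : ℕ) < n} = Set.univ := by ext k; simp
    beta_reduce; rw [h1, htop]
  · have h1 : {k : Fin n | (k : ℕ) < 0}ᶜ = Set.univ := by ext k; simp
    beta_reduce; rw [h1, htop]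
  · intro i
    rw [← Submodule.span_union, ← Set.image_union, Set.union_compl_self, htop]

lemma ch_over (hB : Sp B n) {G : Submodule F V} (h1 : IsTotIso B G) (h2 : finrank F G = n) (hn : 1 ≤ n) :
    ∃ C : Ch B n, C.space n = G := by
  have := hB.fd
  obtain ⟨d, e, hd, he, md, me, dn, e0, hs⟩ := exists_flags G h2
  obtain ⟨C, hC⟩ := exists_ch (B := B) (n := n) d (fun i _ h => hd i h)
    (fun i _ h => tiso_mono (dn ▸ md h) h1) (fun i _ h => md (by omega))
  exact ⟨C, by rw [hC n hn le_rfl, dn]⟩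

lemma opp_over (hB : Sp B n) {G G' : Submodule F V} (h1 : IsTotIso B G) (h2 : finrank F G = n)
    (h1' : IsTotIso B G') (h2' : finrank F G' = n) (hn : 1 ≤ n) (ho : G ⊓ G' = ⊥) :
    ∃ C D : Ch B n, C.space n = G ∧ D.space n = G' ∧ FlagOpp C D := by
  have := hB.fd
  obtain ⟨d, e, hd, he, md, me, dn, e0, hs⟩ := exists_flags G h2
  obtain ⟨C, hC⟩ := exists_ch (B := B) (n := n) d (fun i _ h => hd i h)
    (fun i _ h => tiso_mono (dn ▸ md h) h1) (fun i _ h => md (by omega))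
  have hfr : ∀ i ≤ n, finrank F ↥(G' ⊓ bperp B (e i)) = i := by
    intro i hi
    have h3 := Submodule.finrank_sup_add_finrank_inf_eq G' (bperp B (e i))
    have h4 : G' ⊔ bperp B (e i) = ⊤ := by
      rw [eq_top_iff]
      have h5 : G ≤ bperp B (e i) := (tiso_iff.1 h1).trans (bperp_anti (e0 ▸ me (Nat.zero_le i)))
      have h6 : G ⊔ G' = ⊤ := by
        apply Submodule.eq_top_of_finrank_eq
        have := Submodule.finrank_sup_add_finrank_inf_eq G G'
        rw [ho, finrank_bot] at this
        rw [hB.fr]; omega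
      rw [← h6]
      exact sup_le (h5.trans le_sup_right) le_sup_left
    rw [h4, finrank_top, hB.fr, hB.finrank_perp, he i hi, h2'] at h3
    omega
  obtain ⟨D, hD⟩ := exists_ch (B := B) (n := n) (fun i => G' ⊓ bperp B (e i)) (fun i _ h => hfr i h)
    (fun i _ h => tiso_mono inf_le_left h1')
    (fun i _ h => inf_le_inf_left _ (bperp_anti (me (by omega))))
  refine ⟨C, D, by rw [hC n hn le_rfl, dn], ?_, ?_⟩
  · rw [hD n hn le_rfl]
    exact Submodule.eq_of_le_of_finrank_eq inf_le_left (by rw [hfr n le_rfl, h2'])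
  · intro i hi
    rw [Finset.mem_Icc] at hi
    rw [hC i hi.1 hi.2, hD i hi.1 hi.2, eq_bot_iff]
    intro v hv
    have h3 : v ∈ bperp B (d i ⊔ e i) := by
      rw [bperp_sup]; exact ⟨hv.1, hv.2.2⟩
    rw [hs i, hB.perp_gen h1 h2] at h3
    rw [← ho]; exact ⟨h3, hv.2.1⟩

lemma exists_ch' (hB : Sp B n) (hn : 1 ≤ n) : Nonempty (Ch B n) := by
  obtain ⟨G, h1, h2⟩ := exists_tiso hB n le_rfl
  obtain ⟨C, _⟩ := ch_over hB h1 h2 hn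
  exact ⟨C⟩

/-- a subspace over `U` opposite to two given ones -/
lemma exists_two (hB : Sp B n) {j : ℕ} {U X X' : Submodule F V} (hU : finrank F U = j)
    (hUt : IsTotIso B U) (hX : finrank F X = j + 1) (hX' : finrank F X' = j + 1)
    (hXt : IsTotIso B X) (h1 : U ≤ X) (_h2 : U ≤ X') :
    ∃ Y : Submodule F V, IsTotIso B Y ∧ finrank F Y = j + 1 ∧ U ≤ Y ∧ ¬ Y ≤ bperp B X ∧
      ¬ Y ≤ bperp B X' := by
  have := hB.fd
  have key : ∀ Z : Submodule F V, finrank F Z = j + 1 → ∃ a ∈ bperp B U, a ∉ bperp B Z := by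
    intro Z hZ
    by_contra hcon
    push Not at hcon
    have h3 : bperp B U ≤ bperp B Z := fun a ha => hcon a ha
    have h4 := Submodule.finrank_mono h3
    rw [hB.finrank_perp, hB.finrank_perp, hU, hZ] at h4
    have := hB.finrank_le Z
    omega
  obtain ⟨a, ha, ha'⟩ := key X hX
  obtain ⟨b, hb, hb'⟩ := key X' hX'
  obtain ⟨y, hy, hy1, hy2⟩ : ∃ y ∈ bperp B U, y ∉ bperp B X ∧ y ∉ bperp B X' := by
    by_cases h3 : a ∈ bperp B X'
    · by_cases h4 : b ∈ bperp B X
      · refine ⟨a + b, add_mem ha hb, fun h => ha' ?_, fun h => hb' ?_⟩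
        · simpa using sub_mem h h4
        · simpa using sub_mem h h3
      · exact ⟨b, hb, h4, hb'⟩
    · exact ⟨a, ha, ha', h3⟩
  have hyU : y ∉ U := fun h => hy1 (tiso_iff.1 hXt (h1 h))
  have hyY : y ∈ U ⊔ F ∙ y := Submodule.mem_sup_right (Submodule.mem_span_singleton_self y)
  refine ⟨U ⊔ F ∙ y, hB.tiso_ext hUt le_sup_left
    (sup_le (tiso_iff.1 hUt) (by rwa [Submodule.span_singleton_le_iff_mem])) (fr_sup_span hyU),
    by rw [fr_sup_span hyU, hU], le_sup_left, fun h => hy1 (h hyY), fun h => hy2 (h hyY)⟩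

/-- extension of partial flags -/
lemma ext_flag (hB : Sp B n) {j : ℕ} (hj : j < n) (C : Ch B n) {X : Submodule F V} (hX : IsTotIso B X)
    (hXr : finrank F X = j + 1) (hCX : C.space j ≤ X) :
    ∃ D : Ch B n, (∀ i ≤ j, D.space i = C.space i) ∧ D.space (j+1) = X := by
  obtain ⟨m, hm⟩ : ∃ m, j + m + 1 = n := ⟨n - j - 1, by omega⟩
  obtain ⟨Y, hY, hYr, hUY, h1, h2⟩ := exists_two hB (ch_fr C hj.le) (ch_ti C j)
    (ch_fr C (by omega)) hXr (ch_ti C (j+1)) (ch_mono C (by omega) (by omega)) hCX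
  obtain ⟨E, hE, hE'⟩ := ell_exists hB m j C Y hm hY hYr hUY h1
  have r := rel_of_ell hB m j C E hm hE
  obtain ⟨D, hD, hD'⟩ := ell_exists hB m j E X hm hX hXr (by rw [r.low j le_rfl]; exact hCX)
    (fun h => h2 (hB.le_comm (hE' ▸ h)))
  have r' := rel_of_ell hB m j E D hm hD
  exact ⟨D, fun i hi => (r'.low i hi).trans (r.low i hi), hD'⟩

lemma ell_inv {α : Type} (g : Ch B n → α) (m : ℕ)
    (hg : ∀ i, n - m ≤ i → i ≤ n → ∀ C D, adj i C D → g C = g D) :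
    ∀ C D, ell m C D → g C = g D := by
  induction m with
  | zero => intro C D h; exact hg n (by omega) le_rfl C D h
  | succ m ih =>
    rintro C D ⟨C1, D1, h1, h2, h3⟩
    rw [hg _ (by omega) (by omega) C C1 h1, ih (fun i h4 => hg i (by omega)) C1 D1 h2,
      hg _ (by omega) (by omega) D1 D h3]

/-- invariance under the upper panels -/
lemma conn_low (hB : Sp B n) {α : Type} (g : Ch B n → α) (m : ℕ) : ∀ k, k + m = n →
    (∀ i, k < i → i ≤ n → ∀ C D, adj i C D → g C = g D) →
    ∀ C D : Ch B n, (∀ i ≤ k, C.space i = D.space i) → g C = g D := by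
  induction m with
  | zero =>
    intro k hk hg C D h
    rw [ch_ext fun i _ hi => h i (by omega)]
  | succ m ih =>
    intro k hk hg C D h
    obtain ⟨Y, hY, hYr, hUY, h1, h2⟩ := exists_two hB (ch_fr C (show k ≤ n by omega)) (ch_ti C k)
      (ch_fr C (show k + 1 ≤ n by omega)) (ch_fr D (show k + 1 ≤ n by omega)) (ch_ti C (k+1))
      (ch_mono C (by omega) (by omega)) (by rw [h k le_rfl]; exact ch_mono D (by omega) (by omega))
    obtain ⟨E, hE, hE'⟩ := ell_exists hB m k C Y (by omega) hY hYr hUY h1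
    obtain ⟨G, hG, hG'⟩ := ell_exists hB m k D Y (by omega) hY hYr (by rw [← h k le_rfl]; exact hUY) h2
    have r := rel_of_ell hB m k C E (by omega) hE
    have r' := rel_of_ell hB m k D G (by omega) hG
    rw [ell_inv g m (fun i h4 => hg i (by omega)) C E hE, ell_inv g m (fun i h4 => hg i (by omega)) D G hG]
    refine ih (k+1) (by omega) (fun i hi => hg i (by omega)) E G fun i hi => ?_
    rcases Nat.lt_or_ge k i with h3 | h3
    · obtain rfl : i = k+1 := by omega
      rw [hE', hG']
    · rw [r.low i h3, r'.low i h3, h i h3]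

/-- invariance under the lower panels -/
lemma conn_top (hB : Sp B n) {α : Type} (g : Ch B n → α) (k : ℕ) : k < n →
    (∀ i, 1 ≤ i → i ≤ k → ∀ C D, adj i C D → g C = g D) →
    ∀ C D : Ch B n, (∀ i, k < i → i ≤ n → C.space i = D.space i) → g C = g D := by
  have := hB.fd
  induction k with
  | zero =>
    intro _ hg C D h
    rw [ch_ext fun i hi hi' => h i (by omega) hi']
  | succ k ih =>
    intro hk hg C D h
    have ih' := ih (by omega) (fun i h1 h2 => hg i h1 (by omega))
    by_cases hne : C.space (k+1) = D.space (k+1)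
    · refine ih' C D fun i h1 h2 => ?_
      rcases Nat.lt_or_ge (k+1) i with h3 | h3
      · exact h i h3 h2
      · obtain rfl : i = k+1 := by omega
        exact hne
    have h2 := h (k+2) (by omega) (by omega)
    have hs : C.space (k+1) ⊔ D.space (k+1) = C.space (k+2) :=
      sup_eq_of_ne (ch_fr C (by omega)) (ch_fr D (by omega)) (ch_fr C (by omega))
        (ch_mono C (by omega) (by omega)) (h2 ▸ ch_mono D (by omega) (by omega)) hne
    have hd := Submodule.finrank_sup_add_finrank_inf_eq (C.space (k+1)) (D.space (k+1))
    rw [hs, ch_fr C (by omega), ch_fr C (by omega), ch_fr D (by omega)] at hd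
    have hUr : finrank F ↥(C.space (k+1) ⊓ D.space (k+1)) = k := by omega
    obtain ⟨d, e, hdr, _, md, _, dn, _, _⟩ := exists_flags _ hUr
    have mk : ∀ A : Ch B n, C.space (k+1) ⊓ D.space (k+1) ≤ A.space (k+1) →
        ∃ E : Ch B n, (∀ i, k < i → i ≤ n → E.space i = A.space i) ∧ 
          (∀ i, 1 ≤ i → i ≤ k → E.space i = d i) := by
      intro A hA
      obtain ⟨E, hE⟩ := exists_ch (B := B) (n := n) (fun i => if i ≤ k then d i else A.space i)
        (fun i h1 h2 => by
          beta_reduce; by_cases h3 : i ≤ k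
          · rw [if_pos h3]; exact hdr i h3
          · rw [if_neg h3]; exact ch_fr A h2)
        (fun i h1 h2 => by
          beta_reduce; split_ifs with h3
          · exact tiso_mono ((dn ▸ md h3).trans hA) (ch_ti A _)
          · exact ch_ti A i)
        (fun i h1 h2 => by
          beta_reduce
          by_cases h3 : i + 1 ≤ k
          · rw [if_pos h3, if_pos (by omega)]; exact md (by omega)
          · rw [if_neg h3]
            split_ifs with h4
            · obtain rfl : i = k := by omega
              rw [dn]; exact hA
            · exact ch_mono A (by omega) (by omega))
      refine ⟨E, fun i h1 h2 => ?_, fun i h1 h2 => ?_⟩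
      · rw [hE i (by omega) h2, if_neg (by omega)]
      · rw [hE i h1 (by omega), if_pos h2]
    obtain ⟨E, hE, hE'⟩ := mk C inf_le_left
    obtain ⟨G, hG, hG'⟩ := mk D inf_le_right
    rw [ih' C E fun i h1 h2 => (hE i h1 h2).symm, ih' D G fun i h1 h2 => (hG i h1 h2).symm]
    refine hg (k+1) (by omega) le_rfl E G (adj_of (fun i hi => ?_) ?_)
    · by_cases h3 : i ∈ Finset.Icc 1 n
      · rw [Finset.mem_Icc] at h3
        rcases Nat.lt_or_ge (k+1) i with h4 | h4
        · rw [hE i (by omega) h3.2, hG i (by omega) h3.2, h i h4 h3.2]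
        · rw [hE' i h3.1 (by omega), hG' i h3.1 (by omega)]
      · rw [E.eq_bot i h3, G.eq_bot i h3]
    · rw [hE _ (by omega) (by omega), hG _ (by omega) (by omega)]; exact hne

end Gm

set_option linter.unusedSectionVars false

namespace Gm
variable {F V : Type} [Field F] [Fintype F] [AddCommGroup V] [Module F V]
variable {B : V →ₗ[F] V →ₗ[F] F} {n : ℕ}

/-- Gaussian integers -/
def gq (q m : ℕ) : ℕ := ∑ i ∈ Finset.range m, q ^ i

lemma gq_mul {q : ℕ} (hq : 1 < q) (m : ℕ) : gq q m * (q - 1) = q ^ m - 1 := by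
  obtain ⟨r, rfl⟩ : ∃ r, q = r + 1 := ⟨q - 1, by omega⟩
  have := geom_sum_mul_add r m
  rw [gq, Nat.add_sub_cancel]; omega

lemma gq_pos {q m : ℕ} (hm : 1 ≤ m) : 1 ≤ gq q m := by
  obtain ⟨k, rfl⟩ : ∃ k, m = k + 1 := ⟨m - 1, by omega⟩
  rw [gq, Finset.sum_range_succ']; simp

lemma gq_succ (q m : ℕ) : gq q (m+1) = 1 + q * gq q m := by
  rw [gq, Finset.sum_range_succ', gq, Finset.mul_sum, add_comm]
  simp [pow_succ, mul_comm]

lemma gq_two (q m : ℕ) : gq q (2*m) = gq q m * (q ^ m + 1) := by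
  rw [gq, two_mul, Finset.sum_range_add]
  simp only [pow_add, ← Finset.mul_sum, gq]; ring

lemma gq_le {q : ℕ} (hq : 1 < q) (m : ℕ) : (gq q (m+1) : ℝ) * (1 - 1/q) ≤ (q:ℝ) ^ m := by
  have h1 : (gq q (m+1) : ℝ) * (q - 1) = q ^ (m+1) - 1 := by
    rw [gq]; push_cast; exact geom_sum_mul _ _
  have hq0 : (0:ℝ) < q := by positivity
  have : (gq q (m+1) : ℝ) * (1 - 1/q) = (gq q (m+1) : ℝ) * (q - 1) / q := by field_simp
  rw [this, h1, div_le_iff₀ hq0, pow_succ]; linarith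

/-- number of extensions -/
def pq (q m : ℕ) : ℕ := ∏ t ∈ Finset.range m, gq q (2*(t+1))

lemma pq_succ (q m : ℕ) : pq q (m+1) = pq q m * gq q (2*(m+1)) := Finset.prod_range_succ _ _

lemma pq_pos (q m : ℕ) : 1 ≤ pq q m := Nat.one_le_iff_ne_zero.2
  (Finset.prod_ne_zero_iff.2 fun t _ => by have := gq_pos (q := q) (show 1 ≤ 2*(t+1) by omega); omega)

lemma pq_coprime (q m : ℕ) : Nat.Coprime (pq q m) q := by
  refine Nat.Coprime.prod_left fun t _ => ?_
  rw [show 2*(t+1) = 2*t+1+1 by ring, gq_succ]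
  simp

lemma pq_le {q : ℕ} (hq : 1 < q) (m : ℕ) : (pq q m : ℝ) * (1 - 1/q)^m ≤ (q:ℝ) ^ (m*m) := by
  induction m with
  | zero => simp [pq]
  | succ m ih =>
    rw [pq, Finset.prod_range_succ, ← pq]
    have h1 := gq_le hq (2*m+1)
    have h2 : (0:ℝ) ≤ 1 - 1/q := by
      have : (1:ℝ) < q := by exact_mod_cast hq
      rw [sub_nonneg, div_le_one (by positivity)]; exact this.le
    calc ((pq q m * gq q (2*(m+1)) : ℕ) : ℝ) * (1 - 1/q)^(m+1) 
        = ((pq q m : ℝ) * (1 - 1/q)^m) * ((gq q (2*m+1+1) : ℝ) * (1 - 1/q)) := by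
          rw [show 2*(m+1) = 2*m+1+1 by ring]; push_cast; ring
      _ ≤ (q:ℝ) ^ (m*m) * (q:ℝ)^(2*m+1) := by gcongr
      _ = _ := by rw [← pow_add]; congr 1; ring

lemma fin_sub (hB : Sp B n) : Finite (Submodule F V) := by
  have := hB.fd
  have : Finite V := Module.finite_of_finite F
  exact Finite.of_injective (fun W => (W : Set V)) SetLike.coe_injective

lemma fin_ch (hB : Sp B n) : Finite (Ch B n) := by
  have := fin_sub hB
  refine Finite.of_injective (fun (C : Ch B n) (i : Fin (n+1)) => C.space i) fun C D h => ch_ext fun i _ hi => ?_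
  exact congrFun h ⟨i, by omega⟩

lemma cnt_between (hB : Sp B n) {U W : Submodule F V} (hUW : U ≤ W) {j m : ℕ} (hU : finrank F U = j)
    (hW : finrank F W = j + m) :
    Nat.card {X : Submodule F V // U ≤ X ∧ X ≤ W ∧ finrank F X = j + 1} = gq (Fintype.card F) m := by
  have := hB.fd
  have h := card_between U W hUW j hU
  have hq : 1 < Fintype.card F := Fintype.one_lt_card
  have h1 : Fintype.card F ^ (j+1) - Fintype.card F ^ j = Fintype.card F ^ j * (Fintype.card F - 1) := by
    rw [Nat.mul_sub, mul_one, pow_succ]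
  have h2 : Fintype.card F ^ (j+m) - Fintype.card F ^ j = Fintype.card F ^ j * (Fintype.card F ^ m - 1) := by
    rw [Nat.mul_sub, mul_one, pow_add]
  rw [hW, h1, h2, ← gq_mul hq m] at h
  have hp : 0 < Fintype.card F ^ j * (Fintype.card F - 1) := Nat.mul_pos (pow_pos (by omega) _) (by omega)
  refine Nat.eq_of_mul_eq_mul_right hp ?_
  rw [h]; ring

lemma cnt_ch (hB : Sp B n) [Fintype (Ch B n)] (m : ℕ) : ∀ k, k + m = n → ∀ C : Ch B n,
    (Finset.univ.filter fun D : Ch B n => ∀ i ≤ k, D.space i = C.space i).card = pq (Fintype.card F) m := by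
  induction m with
  | zero =>
    intro k hk C
    rw [pq, Finset.range_zero, Finset.prod_empty, Finset.card_eq_one]
    refine ⟨C, ?_⟩
    ext D
    simp only [Finset.mem_filter, Finset.mem_univ, true_and, Finset.mem_singleton]
    constructor
    · intro h; exact ch_ext fun i _ hi => h i (by omega)
    · rintro rfl; exact fun _ _ => rfl
  | succ m ih =>
    intro k hk C
    have := fin_sub hB
    have := Fintype.ofFinite (Submodule F V)
    let T : Finset (Submodule F V) := Finset.univ.filter fun X => C.space k ≤ X ∧
      X ≤ bperp B (C.space k) ∧ finrank F X = k + 1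
    have hT : T.card = gq (Fintype.card F) (2*(m+1)) := by
      rw [← cnt_between hB (tiso_iff.1 (ch_ti C k)) (ch_fr C (by omega)) (m := 2*(m+1)),
        Nat.card_eq_fintype_card, Fintype.card_subtype]
      rw [hB.finrank_perp, ch_fr C (by omega)]; omega
    rw [Finset.card_eq_sum_card_fiberwise (f := fun D => D.space (k+1)) (t := T)]
    · rw [Finset.sum_congr rfl (g := fun _ => pq (Fintype.card F) m), Finset.sum_const, hT, pq_succ,
        smul_eq_mul, mul_comm]
      intro X hX
      obtain ⟨h1, h2, h3⟩ := (Finset.mem_filter.1 hX).2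
      obtain ⟨D, hD, hD'⟩ := ext_flag hB (j := k) (by omega) C
        (hB.tiso_ext (ch_ti C k) h1 h2 (by rw [h3, ch_fr C (by omega)])) h3 h1
      rw [← ih (k+1) (by omega) D]
      congr 1
      ext E
      simp only [Finset.mem_filter, Finset.mem_univ, true_and]
      constructor
      · rintro ⟨h4, h5⟩ i hi
        rcases Nat.lt_or_ge k i with h6 | h6
        · obtain rfl : i = k+1 := by omega
          rw [h5, hD']
        · rw [h4 i h6, hD i h6]
      · intro h
        refine ⟨fun i hi => by rw [h i (by omega), hD i hi], by rw [h _ le_rfl, hD']⟩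
    · intro D hD
      have hD := (Finset.mem_filter.1 hD).2
      refine Finset.mem_filter.2 ⟨Finset.mem_univ _, ?_, ?_, ch_fr D (by omega)⟩
      · rw [← hD k le_rfl]; exact ch_mono D (by omega) (by omega)
      · rw [← hD k le_rfl]; exact (tiso_iff.1 (ch_ti D _)).trans (bperp_anti (ch_mono D (by omega) (by omega)))

lemma tiso_pt (hB : Sp B n) {X : Submodule F V} (h : finrank F X = 1) : IsTotIso B X :=
  hB.tiso_ext tiso_bot bot_le (by
    intro v _; rw [mem_bperp]; intro w hw; rw [Submodule.mem_bot] at hw; subst hw; simp) (by rw [h]; simp)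

lemma ch_pt (hB : Sp B n) (hn : 1 ≤ n) {X : Submodule F V} (h : finrank F X = 1) :
    ∃ C : Ch B n, C.space 1 = X := by
  obtain ⟨C⟩ := exists_ch' hB hn
  obtain ⟨D, _, hD⟩ := ext_flag hB (j := 0) (by omega) C (tiso_pt hB h) h (by rw [ch_zero]; exact bot_le)
  exact ⟨D, hD⟩

lemma cnt_pt (hB : Sp B n) [Fintype (Ch B n)] (hn : 1 ≤ n) {X : Submodule F V} (h : finrank F X = 1) :
    (Finset.univ.filter fun D : Ch B n => D.space 1 = X).card = pq (Fintype.card F) (n-1) := by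
  obtain ⟨C, hC⟩ := ch_pt hB hn h
  rw [← cnt_ch hB (n-1) 1 (by omega) C]
  congr 1
  ext D
  simp only [Finset.mem_filter, Finset.mem_univ, true_and]
  constructor
  · intro h1 i hi
    rcases Nat.eq_zero_or_pos i with h2 | h2
    · subst h2; rw [ch_zero, ch_zero]
    · obtain rfl : i = 1 := by omega
      rw [h1, hC]
  · intro h1; rw [h1 1 le_rfl, hC]

lemma cnt_sub (hB : Sp B n) [Fintype (Ch B n)] (hn : 1 ≤ n) (W : Submodule F V) :
    (Finset.univ.filter fun D : Ch B n => D.space 1 ≤ W).card =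
      gq (Fintype.card F) (finrank F W) * pq (Fintype.card F) (n-1) := by
  have := fin_sub hB
  have := Fintype.ofFinite (Submodule F V)
  have hf : finrank F (⊥ : Submodule F V) = 0 := by simp
  let T : Finset (Submodule F V) := Finset.univ.filter fun X => ⊥ ≤ X ∧ X ≤ W ∧ finrank F X = 0 + 1
  have hT : T.card = gq (Fintype.card F) (finrank F W) := by
    rw [← cnt_between hB (bot_le : ⊥ ≤ W) hf (m := finrank F W) (by omega),
        Nat.card_eq_fintype_card, Fintype.card_subtype]
  rw [Finset.card_eq_sum_card_fiberwise (f := fun D => D.space 1) (t := T)]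
  · rw [Finset.sum_congr rfl (g := fun _ => pq (Fintype.card F) (n-1)), Finset.sum_const, hT, smul_eq_mul]
    intro X hX
    obtain ⟨h1, h2, h3⟩ := (Finset.mem_filter.1 hX).2
    rw [← cnt_pt hB hn (by omega : finrank F X = 1)]
    congr 1
    ext E
    simp only [Finset.mem_filter, Finset.mem_univ, true_and]
    constructor
    · exact fun h => h.2
    · exact fun h => ⟨h ▸ h2, h⟩
  · intro D hD
    exact Finset.mem_filter.2 ⟨Finset.mem_univ _, bot_le, (Finset.mem_filter.1 hD).2, ch_fr D (by omega)⟩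

lemma cnt_all (hB : Sp B n) [Fintype (Ch B n)] (hn : 1 ≤ n) : Fintype.card (Ch B n) = pq (Fintype.card F) n := by
  obtain ⟨C⟩ := exists_ch' hB hn
  rw [← cnt_ch hB n 0 (by omega) C, ← Finset.card_univ]
  congr 1
  ext D
  simp only [Finset.mem_filter, Finset.mem_univ, true_and, true_iff]
  intro i hi
  obtain rfl : i = 0 := by omega
  rw [ch_zero, ch_zero]

lemma pq_n (q : ℕ) (hn : 1 ≤ n) : pq q n = gq q (2*n) * pq q (n-1) := by
  obtain ⟨k, rfl⟩ : ∃ k, n = k + 1 := ⟨n - 1, by omega⟩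
  rw [pq, Finset.prod_range_succ, mul_comm]; rfl

lemma gen_le (hB : Sp B n) [Fintype (Ch B n)] (hn : 1 ≤ n) {G G' : Submodule F V}
    (hG : finrank F G = n) (hG' : finrank F G' = n) (hGt' : IsTotIso B G') :
    (Finset.univ.filter fun D : Ch B n => D.space n = G).card ≤
      (Finset.univ.filter fun D : Ch B n => D.space n = G').card := by
  have := hB.fd
  let e : G ≃ₗ[F] G' := LinearEquiv.ofFinrankEq G G' (by rw [hG, hG'])
  obtain ⟨f, hf⟩ := LinearMap.exists_extend (G'.subtype ∘ₗ e.toLinearMap)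
  have hfe : ∀ x : G, f x = e x := fun x => by
    have := LinearMap.congr_fun hf x
    simpa using this
  have hinj : ∀ x ∈ G, ∀ y ∈ G, f x = f y → x = y := by
    intro x hx y hy h
    have h1 := hfe ⟨x, hx⟩
    have h2 := hfe ⟨y, hy⟩
    simp only at h1 h2
    rw [h1, h2] at h
    have := e.injective (Subtype.ext h)
    exact congrArg Subtype.val this
  have hmap : Submodule.map f G = G' := by
    apply le_antisymm
    · rintro _ ⟨x, hx, rfl⟩
      have := hfe ⟨x, hx⟩
      simp only at this; rw [this]; exact (e _).2
    · intro y hy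
      refine ⟨e.symm ⟨y, hy⟩, (e.symm ⟨y, hy⟩).2, ?_⟩
      rw [hfe]; simp
  have hfr : ∀ X ≤ G, finrank F (Submodule.map f X) = finrank F X := by
    intro X hX
    have : Submodule.map f X = LinearMap.range (f ∘ₗ X.subtype) := by
      rw [LinearMap.range_comp, Submodule.range_subtype]
    rw [this]
    refine LinearMap.finrank_range_of_inj fun a b h => Subtype.ext (hinj a (hX a.2) b (hX b.2) h)
  have mk : ∀ C : Ch B n, ∃ D : Ch B n, C.space n = G →
      ∀ i, 1 ≤ i → i ≤ n → D.space i = Submodule.map f (C.space i) := by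
    intro C
    by_cases h : C.space n = G
    · obtain ⟨D, hD⟩ := exists_ch (B := B) (n := n) (fun i => Submodule.map f (C.space i))
        (fun i h1 h2 => by rw [hfr _ (h ▸ ch_mono C h2 le_rfl), ch_fr C h2])
        (fun i h1 h2 => tiso_mono (hmap ▸ Submodule.map_mono (h ▸ ch_mono C h2 le_rfl)) hGt')
        (fun i h1 h2 => Submodule.map_mono (ch_mono C (by omega) (by omega)))
      exact ⟨D, fun _ => hD⟩
    · exact ⟨C, fun h' => absurd h' h⟩
  choose g hg using mk
  refine Finset.card_le_card_of_injOn g ?_ ?_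
  · intro C hC
    have hC := (Finset.mem_filter.1 hC).2
    refine Finset.mem_filter.2 ⟨Finset.mem_univ _, ?_⟩
    rw [hg C hC n hn le_rfl, hC, hmap]
  · intro C hC D hD h
    have hC := (Finset.mem_filter.1 hC).2
    have hD := (Finset.mem_filter.1 hD).2
    refine ch_ext fun i h1 h2 => ?_
    have e1 := hg C hC i h1 h2
    rw [h, hg D hD i h1 h2] at e1
    have sub : ∀ X Y : Submodule F V, X ≤ G → Y ≤ G → Submodule.map f X = Submodule.map f Y → X ≤ Y := by
      intro X Y hX hY h x hx
      have : f x ∈ Submodule.map f Y := h ▸ Submodule.mem_map_of_mem hx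
      obtain ⟨y, hy, hxy⟩ := this
      rw [← hinj y (hY hy) x (hX hx) hxy]; exact hy
    exact le_antisymm (sub _ _ (hC ▸ ch_mono C h2 le_rfl) (hD ▸ ch_mono D h2 le_rfl) e1.symm)
      (sub _ _ (hD ▸ ch_mono D h2 le_rfl) (hC ▸ ch_mono C h2 le_rfl) e1)

/-- invariance and eigenvectors -/
lemma R_inv (hB : Sp B n) [Fintype (Ch B n)] {k : ℕ} (hk : k < n) (v : EuclideanSpace ℝ (Ch B n)) :
    RR B n k v = (Fintype.card F : ℝ) • v ↔ ∀ C D : Ch B n, adj (n-k) C D → v C = v D := by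
  have hcl : ∀ C : Ch B n, Finset.univ.filter (eqv (n-k) C) = insert C (Finset.univ.filter (adj (n-k) C)) := by
    intro C; ext D
    simp only [Finset.mem_filter, Finset.mem_univ, true_and, Finset.mem_insert, adj]
    constructor
    · intro h
      by_cases e : D = C
      · exact Or.inl e
      · exact Or.inr ⟨h, fun e' => e e'.symm⟩
    · rintro (rfl | h)
      · exact fun _ _ => rfl
      · exact h.1
  have hni : ∀ C : Ch B n, C ∉ Finset.univ.filter (adj (n-k) C) := by
    intro C h; exact (Finset.mem_filter.1 h).2.2 rfl
  constructor
  · intro h C D hCD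
    have h1 : ∀ E : Ch B n, ∑ A ∈ Finset.univ.filter (eqv (n-k) E), v A = ((Fintype.card F : ℝ) + 1) * v E := by
      intro E
      rw [hcl, Finset.sum_insert (hni E)]
      have := congrArg (fun w => w.ofLp E) h
      simp only [RR] at this
      rw [op_rel_apply] at this
      rw [this]
      simp only [PiLp.smul_apply, smul_eq_mul]; ring
    have h2 : Finset.univ.filter (eqv (n-k) C) = Finset.univ.filter (eqv (n-k) D) := by
      ext E; simp only [Finset.mem_filter, Finset.mem_univ, true_and]
      exact ⟨fun h => eqv_trans (eqv_symm hCD.1) h, fun h => eqv_trans hCD.1 h⟩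
    have h3 := h1 C
    rw [h2, h1 D] at h3
    have : (0:ℝ) < (Fintype.card F : ℝ) + 1 := by positivity
    exact (mul_left_cancel₀ this.ne' h3).symm
  · intro h
    ext C
    rw [RR, op_rel_apply, Finset.sum_congr rfl (g := fun _ => v C), Finset.sum_const]
    · have := class_card hB (i := n-k) (by omega) (by omega) C
      rw [hcl, Finset.card_insert_of_notMem (hni C)] at this
      rw [Nat.succ.inj this]
      simp
    · intro D hD; exact (h C D (Finset.mem_filter.1 hD).2).symm

end Gm


namespace Rg
variable {Ω : Type} [Fintype Ω]

/-- the one-sign case -/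
lemma rigid01 (r : Ω → Ω → Prop) (c Q n0 : ℕ) (hn0 : 0 < n0)
    (hN : Fintype.card Ω = n0 * (Q+1)) (hcop : Nat.Coprime n0 c) [Nonempty Ω]
    (φ : Ω → ℤ) (μ : ℝ) (f : Ω → ℝ) (hf : ∀ a, f a = φ a - μ) (h0 : ∑ a, f a = 0)
    (hT : ∀ a, (∑ b ∈ Finset.univ.filter (r a), (φ b : ℝ)) = c * ((Q+1) * μ - φ a))
    (h01 : ∀ a, φ a = 0 ∨ φ a = 1) (hs : (∑ a, φ a : ℝ) ≤ 1.06 * n0) :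
    (∀ a, f a = 0) ∨ ∃ S : Set Ω, ∀ a, f a = (if a ∈ S then 1 else 0) - 1/(Q+1) := by
  have hn0' : (0:ℝ) < n0 := by exact_mod_cast hn0
  have hQ' : (0:ℝ) < (Q:ℝ) + 1 := by positivity
  have hNr : (Fintype.card Ω : ℝ) = n0 * (Q+1) := by rw [hN]; push_cast; ring
  have hsum : (∑ a, φ a : ℝ) = n0 * ((Q+1) * μ) := by
    simp only [hf, Finset.sum_sub_distrib, Finset.sum_const, Finset.card_univ, nsmul_eq_mul, hNr] at h0
    linarith
  obtain ⟨a0⟩ := ‹Nonempty Ω›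
  obtain ⟨x, hx⟩ : ∃ x : ℤ, (c:ℝ) * ((Q+1) * μ) = x := by
    refine ⟨(∑ b ∈ Finset.univ.filter (r a0), φ b) + c * φ a0, ?_⟩
    have := hT a0
    push_cast; linarith
  obtain ⟨y, hy⟩ : ∃ y : ℤ, (n0:ℝ) * ((Q+1) * μ) = y := ⟨∑ a, φ a, by rw [← hsum]; push_cast; rfl⟩
  have hbez : (1:ℤ) = n0 * Nat.gcdA n0 c + c * Nat.gcdB n0 c := by
    rw [← Nat.gcd_eq_gcd_ab, hcop]; rfl
  obtain ⟨z, hz⟩ : ∃ z : ℤ, ((Q+1) * μ : ℝ) = z := by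
    refine ⟨y * Nat.gcdA n0 c + x * Nat.gcdB n0 c, ?_⟩
    push_cast
    rw [← hx, ← hy]
    have : (1:ℝ) = n0 * Nat.gcdA n0 c + c * Nat.gcdB n0 c := by exact_mod_cast hbez
    linear_combination ((Q+1) * μ) * this
  rw [hz] at hsum
  have hnn : ∀ a, (0:ℝ) ≤ φ a := fun a => by rcases h01 a with h | h <;> simp [h]
  have hz0 : 0 ≤ z := by
    have : (0:ℝ) ≤ n0 * z := by rw [← hsum]; exact Finset.sum_nonneg fun a _ => hnn a
    exact_mod_cast nonneg_of_mul_nonneg_right this hn0'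
  have hz1 : z < 2 := by
    rw [hsum] at hs
    have : (z:ℝ) < 2 := by nlinarith
    exact_mod_cast this
  rcases (by omega : z = 0 ∨ z = 1) with rfl | rfl
  · left
    have hμ : μ = 0 := by
      simp only [Int.cast_zero] at hz
      exact (mul_eq_zero.1 hz).resolve_left hQ'.ne'
    simp only [Int.cast_zero, mul_zero] at hsum
    have := (Finset.sum_eq_zero_iff_of_nonneg fun a _ => hnn a).1 hsum
    intro a; rw [hf, hμ, this a (Finset.mem_univ _)]; simp
  · right
    refine ⟨{a | φ a = 1}, fun a => ?_⟩
    have hμ : μ = 1/(Q+1) := by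
      rw [eq_div_iff hQ'.ne']; push_cast at hz; linarith
    rw [hf, hμ]
    rcases h01 a with h | h <;> simp [h]

set_option maxHeartbeats 1600000 in
lemma rigid (r : Ω → Ω → Prop) (c Q n0 : ℕ) (hQ : 450 ≤ Q) (hn0 : 0 < n0) (hc : 0 < c)
    (hN : Fintype.card Ω = n0 * (Q+1)) (hcop : Nat.Coprime n0 c) (hle : (n0:ℝ) ≤ 1.05 * c)
    (hcard : ∀ a, (Finset.univ.filter (r a)).card = c * Q)
    (ψ : Ω → ℤ) (t : ℝ) (f : Ω → ℝ) (hf' : ∀ a, f a = ψ a + t) (h0 : ∑ a, f a = 0)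
    (hT : ∀ a, ∑ b ∈ Finset.univ.filter (r a), f b = - c * f a)
    (hn : ∑ a, f a ^ 2 ≤ 1.05 * n0) :
    (∀ a, f a = 0) ∨ ∃ S : Set Ω, (∀ a, f a = (if a ∈ S then 1 else 0) - 1/(Q+1)) ∨
      (∀ a, f a = -((if a ∈ S then 1 else 0) - 1/(Q+1))) := by
  have hn0' : (0:ℝ) < n0 := by exact_mod_cast hn0
  have hc' : (0:ℝ) < c := by exact_mod_cast hc
  have hQr : (450:ℝ) ≤ Q := by exact_mod_cast hQ
  have hQ' : (0:ℝ) < (Q:ℝ) + 1 := by positivity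
  have hNr : (Fintype.card Ω : ℝ) = n0 * (Q+1) := by rw [hN]; push_cast; ring
  have : Nonempty Ω := by
    rw [← Fintype.card_pos_iff, hN]; positivity
  obtain ⟨φ, μ, hf, hμ⟩ : ∃ φ : Ω → ℤ, ∃ μ : ℝ, (∀ a, f a = φ a - μ) ∧ |μ| ≤ 1/2 := by
    refine ⟨fun a => ψ a + round t, round t - t, fun a => ?_, ?_⟩
    · rw [hf']; push_cast; ring
    · rw [abs_sub_comm]; exact abs_sub_round t
  have hsum : (∑ a, φ a : ℝ) = n0 * ((Q+1) * μ) := by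
    have h0 := h0
    simp only [hf, Finset.sum_sub_distrib, Finset.sum_const, Finset.card_univ, nsmul_eq_mul, hNr] at h0
    linarith
  have hTφ : ∀ a, (∑ b ∈ Finset.univ.filter (r a), (φ b : ℝ)) = c * ((Q+1) * μ - φ a) := by
    intro a
    have := hT a
    simp only [hf, Finset.sum_sub_distrib, Finset.sum_const, nsmul_eq_mul, hcard] at this
    push_cast at this
    linarith
  have hsq : (∑ a, (φ a : ℝ)^2) = ∑ a, f a ^ 2 + n0 * (Q+1) * μ^2 := by
    have : ∀ a, (φ a : ℝ)^2 = f a ^2 + 2 * μ * f a + μ^2 := fun a => by rw [hf]; ring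
    simp only [this, Finset.sum_add_distrib, ← Finset.mul_sum, h0, Finset.sum_const, Finset.card_univ,
      nsmul_eq_mul, hNr]
    ring
  have habs : ∀ a, |(φ a : ℝ)| ≤ (φ a : ℝ)^2 := by
    intro a
    have : |φ a| ≤ φ a ^ 2 := by
      rw [← sq_abs]
      have := abs_nonneg (φ a)
      nlinarith [sq_nonneg (|φ a|), Int.le_self_sq |φ a|]
    exact_mod_cast this
  have hA : ∑ a, |(φ a : ℝ)| ≤ ∑ a, (φ a : ℝ)^2 := Finset.sum_le_sum fun a _ => habs a
  have hμ1 : (Q+1) * |μ| ≤ 2.1 := by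
    have h1 : n0 * ((Q+1) * |μ|) ≤ ∑ a, |(φ a : ℝ)| := by
      have := Finset.abs_sum_le_sum_abs (fun a => (φ a : ℝ)) Finset.univ
      rw [hsum, abs_mul, abs_mul, abs_of_pos hn0', abs_of_pos hQ'] at this
      exact this
    have h2 : μ^2 ≤ |μ|/2 := by rw [← sq_abs]; nlinarith [abs_nonneg μ]
    have h3 : n0 * (Q+1) * μ^2 ≤ n0 * (Q+1) * (|μ|/2) := by gcongr
    have h4 : n0 * ((Q+1) * |μ|) ≤ n0 * 2.1 := by linarith
    exact le_of_mul_le_mul_left h4 hn0'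
  have hS : ∑ a, |(φ a : ℝ)| ≤ 1.06 * n0 := by
    have h1 : (Q+1) * μ^2 ≤ 0.01 := by
      have h2 : ((Q+1) * |μ|)^2 ≤ 2.1^2 := by gcongr
      have h3 : ((Q+1) * |μ|)^2 = (Q+1) * ((Q+1) * μ^2) := by rw [mul_pow, sq_abs]; ring
      rw [h3] at h2
      nlinarith [sq_nonneg μ]
    have : n0 * (Q+1) * μ^2 ≤ 0.01 * n0 := by nlinarith
    linarith
  set P : ℝ := ∑ a, max (φ a : ℝ) 0 with hP
  set M : ℝ := ∑ a, max (-(φ a : ℝ)) 0 with hM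
  have hP0 : 0 ≤ P := Finset.sum_nonneg fun a _ => le_max_right _ _
  have hM0 : 0 ≤ M := Finset.sum_nonneg fun a _ => le_max_right _ _
  have hPM : P + M ≤ 1.06 * n0 := by
    refine le_trans (le_of_eq ?_) hS
    rw [hP, hM, ← Finset.sum_add_distrib]
    refine Finset.sum_congr rfl fun a _ => ?_
    rcases le_total (φ a : ℝ) 0 with h | h
    · rw [max_eq_right h, max_eq_left (by linarith), abs_of_nonpos h]; ring
    · rw [max_eq_left h, max_eq_right (by linarith), abs_of_nonneg h]; ring
  have hPM' : P - M = n0 * ((Q+1) * μ) := by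
    rw [← hsum, hP, hM, ← Finset.sum_sub_distrib]
    refine Finset.sum_congr rfl fun a _ => ?_
    rcases le_total (φ a : ℝ) 0 with h | h
    · rw [max_eq_right h, max_eq_left (by linarith)]; ring
    · rw [max_eq_left h, max_eq_right (by linarith)]; ring
  have hup : ∀ a, (∑ b ∈ Finset.univ.filter (r a), (φ b : ℝ)) ≤ P := fun a =>
    (Finset.sum_le_sum fun b _ => le_max_left _ _).trans
      (Finset.sum_le_univ_sum_of_nonneg fun b => le_max_right _ _)
  have hlo : ∀ a, -M ≤ (∑ b ∈ Finset.univ.filter (r a), (φ b : ℝ)) := fun a => by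
    rw [neg_le, ← Finset.sum_neg_distrib]
    exact (Finset.sum_le_sum fun b _ => le_max_left _ _).trans
      (Finset.sum_le_univ_sum_of_nonneg fun b => le_max_right _ _)
  have k1 : ∀ a, n0 * (φ a : ℝ) ≤ P + 0.05 * M := by
    intro a
    have h1 := hlo a
    rw [hTφ] at h1
    have h2 : (φ a : ℝ) - (Q+1) * μ ≤ M / c := by rw [le_div_iff₀ hc']; linarith
    have h3 : n0 * (M / c) ≤ 1.05 * M := by
      rw [mul_div_assoc', div_le_iff₀ hc']; nlinarith
    nlinarith
  have k2 : ∀ a, n0 * (-(φ a : ℝ)) ≤ M + 0.05 * P := by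
    intro a
    have h1 := hup a
    rw [hTφ] at h1
    have h2 : (Q+1) * μ - (φ a : ℝ) ≤ P / c := by rw [le_div_iff₀ hc']; linarith
    have h3 : n0 * (P / c) ≤ 1.05 * P := by
      rw [mul_div_assoc', div_le_iff₀ hc']; nlinarith
    nlinarith
  have b1 : ∀ a, φ a ≤ 1 := by
    intro a
    have : (φ a : ℝ) < 2 := by
      by_contra h
      push Not at h
      have := k1 a; nlinarith
    have : φ a < 2 := by exact_mod_cast this
    omega
  have b2 : ∀ a, -1 ≤ φ a := by
    intro a
    have : (-2:ℝ) < φ a := by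
      by_contra h
      push Not at h
      have := k2 a; nlinarith
    have : -2 < φ a := by exact_mod_cast this
    omega
  have b3 : ∀ a b, φ a = 1 → φ b = -1 → False := by
    intro a b ha hb
    have h1 := k1 a
    have h2 := k2 b
    rw [ha] at h1
    rw [hb] at h2
    push_cast at h1 h2
    linarith
  by_cases hex : ∃ a, φ a = -1
  · obtain ⟨b, hb⟩ := hex
    have h01 : ∀ a, (-φ a) = 0 ∨ (-φ a) = 1 := by
      intro a
      have := b1 a; have := b2 a
      have : φ a ≠ 1 := fun h => b3 a b h hb
      omega
    rcases rigid01 r c Q n0 hn0 hN hcop (fun a => -φ a) (-μ) (fun a => - f a)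
      (fun a => by rw [hf]; push_cast; ring) (by rw [Finset.sum_neg_distrib, h0, neg_zero])
      (fun a => by push_cast; rw [Finset.sum_neg_distrib, hTφ]; ring) h01
      (le_trans (Finset.sum_le_sum fun a _ => by push_cast; exact neg_le_abs _) hS) with h | ⟨S, h⟩
    · left; intro a; have := h a; linarith
    · right; exact ⟨S, Or.inr fun a => by rw [← h a]; ring⟩
  · have h01 : ∀ a, φ a = 0 ∨ φ a = 1 := by
      intro a
      have := b1 a; have := b2 a
      have : φ a ≠ -1 := fun h => hex ⟨a, h⟩
      omega
    rcases rigid01 r c Q n0 hn0 hN hcop φ μ f hf h0 hTφ h01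
      (le_trans (Finset.sum_le_sum fun a _ => le_abs_self _) hS) with h | ⟨S, h⟩
    · exact Or.inl h
    · right; exact ⟨S, Or.inl h⟩
end Rg

set_option linter.unusedSectionVars false

namespace Hk
variable {H : Type*} [NormedAddCommGroup H] [InnerProductSpace ℝ H] {n : ℕ} {q : ℝ} {R : ℕ → Module.End ℝ H}

lemma TT_inv_vec {m : ℕ} {u : H} (hu : ∀ j < m, R j u = q • u) :
    TT R m u = (q ^ (m*m)) • u := by
  induction m with
  | zero => simp [TT]
  | succ m ih =>
    rw [TT, Module.End.mul_apply, ih (fun j hj => hu j (by omega)), map_smul,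
      LL_inv_vec (q := q) (fun j hj => hu j (by omega)), smul_smul, ← pow_add]
    congr 2; ring

lemma TT_sym_comm (h : HeckeSys n q R) (m : ℕ) (hm : m ≤ n) :
    (TT R m).IsSymmetric ∧ ∀ k < n, Commute (LL R k) (TT R m) := by
  induction m with
  | zero => exact ⟨fun x y => rfl, fun k _ => Commute.one_right _⟩
  | succ m ih =>
    obtain ⟨h1, h2⟩ := ih (by omega)
    refine ⟨fun x y => ?_, fun k hk => ?_⟩
    · have hc : LL R m * TT R m = TT R m * LL R m := h2 m (by omega)
      calc inner ℝ (TT R (m+1) x) y = inner ℝ ((LL R m * TT R m) x) y := rfl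
        _ = inner ℝ (LL R m (TT R m x)) y := rfl
        _ = inner ℝ x (TT R m (LL R m y)) := by
          rw [LL_sym h m (by omega), h1]
        _ = inner ℝ x ((TT R m * LL R m) y) := rfl
        _ = inner ℝ x (TT R (m+1) y) := by rw [← hc]; rfl
    · exact (LL_comm h k m hk (by omega)).mul_right (h2 k hk)
end Hk

namespace Gm
variable {F V : Type} [Field F] [Fintype F] [AddCommGroup V] [Module F V]
variable {B : V →ₗ[F] V →ₗ[F] F} {n : ℕ}

lemma inn {ι : Type} [Fintype ι] (x y : EuclideanSpace ℝ ι) : inner ℝ x y = ∑ a, x a * y a := by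
  rw [PiLp.inner_apply]
  refine Finset.sum_congr rfl fun a _ => ?_
  exact mul_comm _ _

lemma nsq {ι : Type} [Fintype ι] (x : EuclideanSpace ℝ ι) : ‖x‖^2 = ∑ a, x a ^ 2 := by
  rw [← real_inner_self_eq_norm_sq, inn]
  exact Finset.sum_congr rfl fun a _ => (sq _).symm

/-- vector of a function -/
noncomputable def vec {ι : Type} (f : ι → ℝ) : EuclideanSpace ℝ ι := WithLp.toLp 2 f

@[simp] lemma vec_apply {ι : Type} (f : ι → ℝ) (a : ι) : vec f a = f a := rfl

variable [Fintype (Ch B n)]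

lemma T_apply (hB : Sp B n) (v : EuclideanSpace ℝ (Ch B n)) (C : Ch B n) :
    Hk.TT (RR B n) n v C = ∑ D ∈ Finset.univ.filter (tt n C), v D := by
  rw [TT_mat hB le_rfl, op_rel_apply]

lemma L_apply (hB : Sp B n) {m : ℕ} (hm : m < n) (v : EuclideanSpace ℝ (Ch B n)) (C : Ch B n) :
    Hk.LL (RR B n) m v C = ∑ D ∈ Finset.univ.filter (ell m C), v D := by
  rw [LL_mat hB hm, op_rel_apply]

lemma const_of_inv (hB : Sp B n) {v : EuclideanSpace ℝ (Ch B n)}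
    (h : ∀ j < n, RR B n j v = (Fintype.card F : ℝ) • v) (C D : Ch B n) : v C = v D := by
  refine conn_low hB (fun C => v C) n 0 (by omega) (fun i h1 h2 C D hCD => ?_) C D ?_
  · exact (R_inv hB (k := n - i) (by omega) v).1 (h _ (by omega)) C D (by
      rwa [show n - (n - i) = i by omega])
  · intro i hi
    obtain rfl : i = 0 := by omega
    rw [ch_zero, ch_zero]

lemma pt_of_inv (hB : Sp B n) (hn : 1 ≤ n) {v : EuclideanSpace ℝ (Ch B n)}
    (h : ∀ j < n - 1, RR B n j v = (Fintype.card F : ℝ) • v) {C D : Ch B n}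
    (hCD : C.space 1 = D.space 1) : v C = v D := by
  refine conn_low hB (fun C => v C) (n-1) 1 (by omega) (fun i h1 h2 C D hCD => ?_) C D ?_
  · exact (R_inv hB (k := n - i) (by omega) v).1 (h _ (by omega)) C D (by
      rwa [show n - (n - i) = i by omega])
  · intro i hi
    rcases Nat.eq_zero_or_pos i with h2 | h2
    · subst h2; rw [ch_zero, ch_zero]
    · obtain rfl : i = 1 := by omega
      exact hCD

lemma gen_of_inv (hB : Sp B n) (hn : 1 ≤ n) {v : EuclideanSpace ℝ (Ch B n)}
    (h : ∀ j, 1 ≤ j → j < n → RR B n j v = (Fintype.card F : ℝ) • v) {C D : Ch B n}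
    (hCD : C.space n = D.space n) : v C = v D := by
  refine conn_top hB (fun C => v C) (n-1) (by omega) (fun i h1 h2 C D hCD => ?_) C D ?_
  · exact (R_inv hB (k := n - i) (by omega) v).1 (h _ (by omega) (by omega)) C D (by
      rwa [show n - (n - i) = i by omega])
  · intro i h1 h2
    obtain rfl : i = n := by omega
    exact hCD

lemma inv_of_pt (hB : Sp B n) (v : EuclideanSpace ℝ (Ch B n))
    (h : ∀ C D : Ch B n, C.space 1 = D.space 1 → v C = v D) (j : ℕ) (hj : j < n - 1) :
    RR B n j v = (Fintype.card F : ℝ) • v :=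
  (R_inv hB (by omega) v).2 fun C D hCD => h C D (hCD.1 1 (by omega))

lemma inv_const (hB : Sp B n) (c : ℝ) (j : ℕ) (hj : j < n) :
    RR B n j (vec fun _ => c) = (Fintype.card F : ℝ) • (vec fun _ => c) :=
  (R_inv hB hj _).2 fun _ _ _ => rfl

lemma T_const (hB : Sp B n) (c : ℝ) :
    Hk.TT (RR B n) n (vec fun _ => c) = ((Fintype.card F : ℝ) ^ (n*n)) • (vec fun _ => c) :=
  Hk.TT_inv_vec (inv_const hB c)

lemma tt_card (hB : Sp B n) (C : Ch B n) :
    (Finset.univ.filter (tt n C)).card = Fintype.card F ^ (n*n) := by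
  have := congrArg (fun w => w.ofLp C) (T_const hB (1:ℝ))
  simp only [T_apply hB, vec_apply, Finset.sum_const, nsmul_eq_mul, mul_one] at this
  simp only [PiLp.smul_apply, vec_apply, smul_eq_mul, mul_one] at this
  exact_mod_cast this

lemma T_sym (hB : Sp B n) : (Hk.TT (RR B n) n).IsSymmetric := (Hk.TT_sym_comm (hecke hB) n le_rfl).1

lemma sum_T (hB : Sp B n) (v : EuclideanSpace ℝ (Ch B n)) :
    ∑ C, Hk.TT (RR B n) n v C = (Fintype.card F : ℝ) ^ (n*n) * ∑ C, v C := by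
  have := T_sym hB v (vec fun _ => 1)
  rw [T_const hB, inner_smul_right, inn, inn] at this
  simpa using this

/-- eigenvectors sum to zero -/
lemma sum_zero (hB : Sp B n) {v : EuclideanSpace ℝ (Ch B n)} {c : ℝ} (hc : 0 ≤ c)
    (h : Hk.TT (RR B n) n v = (-c) • v) : ∑ C, v C = 0 := by
  have h1 := sum_T hB v
  rw [h] at h1
  simp only [PiLp.smul_apply, smul_eq_mul, ← Finset.mul_sum] at h1
  have h2 : (0:ℝ) < (Fintype.card F : ℝ) ^ (n*n) := by
    have : 0 < Fintype.card F := Fintype.card_pos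
    positivity
  have : ((Fintype.card F : ℝ) ^ (n*n) + c) * ∑ C, v C = 0 := by linarith
  exact (mul_eq_zero.1 this).resolve_left (by positivity)

/-- indicator -/
noncomputable def ind {ι : Type} (S : Set ι) : EuclideanSpace ℝ ι := vec fun a => if a ∈ S then 1 else 0

lemma ind_mem {ι : Type} {S : Set ι} {a : ι} (h : a ∈ S) : ind S a = 1 := if_pos h
lemma ind_notMem {ι : Type} {S : Set ι} {a : ι} (h : a ∉ S) : ind S a = 0 := if_neg h
lemma ind_nonneg {ι : Type} (S : Set ι) (a : ι) : 0 ≤ ind S a := by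
  by_cases h : a ∈ S
  · rw [ind_mem h]; exact zero_le_one
  · rw [ind_notMem h]

lemma sum_ind {ι : Type} [Fintype ι] (S : Set ι) : ∑ a, ind S a = S.ncard := by
  have : S.ncard = (Finset.univ.filter (· ∈ S)).card := by
    rw [← Set.ncard_coe_finset]; congr 1; ext a; simp
  rw [this, Finset.card_filter]; push_cast; rfl

lemma T_ekr (hB : Sp B n) {S : Set (Ch B n)} (hS : IsEKRFlags S) {C : Ch B n} (hC : C ∈ S) :
    Hk.TT (RR B n) n (ind S) C = 0 := by
  rw [T_apply hB]
  refine Finset.sum_eq_zero fun D hD => ind_notMem fun h => ?_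
  exact hS C hC D h (flagOpp_of_tt hB (Finset.mem_filter.1 hD).2)

/-- Hoffman bound -/
lemma hoffman (hB : Sp B n) (hn : 1 ≤ n) {S : Set (Ch B n)} (hS : IsEKRFlags S) :
    S.ncard * (Fintype.card F ^ n + 1) ≤ Fintype.card (Ch B n) ∧
    (S.ncard * (Fintype.card F ^ n + 1) = Fintype.card (Ch B n) →
      Hk.TT (RR B n) n (ind S - vec fun _ => 1/((Fintype.card F : ℝ)^n+1)) =
      (-(Fintype.card F : ℝ)^(n*n-n)) • (ind S - vec fun _ => 1/((Fintype.card F : ℝ)^n+1))) := by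
  set q : ℝ := (Fintype.card F : ℝ) with hq
  have hq0 : (0:ℝ) < q := by rw [hq]; exact_mod_cast Fintype.card_pos (α := F)
  have hNpos : (0:ℝ) < Fintype.card (Ch B n) := by
    have := exists_ch' hB hn
    exact_mod_cast Fintype.card_pos
  set N : ℝ := (Fintype.card (Ch B n) : ℝ) with hN
  set s : ℝ := (S.ncard : ℝ) with hs
  have key : ∀ t : ℝ, inner ℝ (ind S - vec fun _ => t) (Hk.TT (RR B n) n (ind S - vec fun _ => t)) +
      q^(n*n-n) * ‖ind S - vec fun _ => t‖^2 =
      q^(n*n-n) * (q^n * (t^2 * N - 2 * t * s) + s - 2 * t * s + t^2 * N) := by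
    intro t
    have e1 : inner ℝ (ind S) (Hk.TT (RR B n) n (ind S)) = (0:ℝ) := by
      rw [inn]
      refine Finset.sum_eq_zero fun C _ => ?_
      by_cases h : C ∈ S
      · rw [T_ekr hB hS h, mul_zero]
      · rw [ind_notMem h, zero_mul]
    have e2 : inner ℝ (ind S) (vec fun _ => t) = t * s := by
      rw [inn]; simp only [vec_apply, ← Finset.sum_mul, sum_ind]; ring
    have e3 : inner ℝ (ind S) (ind S) = s := by
      rw [inn, hs, ← sum_ind]
      refine Finset.sum_congr rfl fun C _ => ?_
      by_cases h : C ∈ S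
      · rw [ind_mem h]; norm_num
      · rw [ind_notMem h]; norm_num
    have e4 : inner ℝ (vec fun _ => t) (vec fun _ : Ch B n => t) = t^2 * N := by
      rw [inn]; simp only [vec_apply, Finset.sum_const, Finset.card_univ, nsmul_eq_mul]; ring
    have e5 : inner ℝ (vec fun _ => t) (Hk.TT (RR B n) n (ind S)) = q^(n*n) * (t * s) := by
      rw [← T_sym hB, T_const hB, inner_smul_left, real_inner_comm, e2]; simp [hq]
    have e6 : q^(n*n) = q^(n*n-n) * q^n := by
      rw [← pow_add, Nat.sub_add_cancel (Nat.le_mul_self n)]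
    rw [← real_inner_self_eq_norm_sq, map_sub, T_const hB]
    simp only [inner_sub_left, inner_sub_right, inner_smul_right, e1, e2, e3, e4, e5,
      real_inner_comm (ind S) (vec fun _ => t)]
    rw [← hq, e6]; ring
  constructor
  · by_cases hs0 : S.ncard = 0
    · rw [hs0]; simp
    have hspos : 0 < s := by rw [hs]; exact_mod_cast Nat.pos_of_ne_zero hs0
    have h1 := (Hk.A1 (hecke hB) (ind S - vec fun _ => s/N)).1
    rw [← hq, key] at h1
    have h2 := nonneg_of_mul_nonneg_right h1 (by positivity)
    have h3 : q^n * ((s/N)^2 * N - 2 * (s/N) * s) + s - 2 * (s/N) * s + (s/N)^2 * N =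
      (s/N) * (N - s * (q^n+1)) := by field_simp; ring
    rw [h3] at h2
    have h4 := nonneg_of_mul_nonneg_right h2 (by positivity)
    have : s * (q^n+1) ≤ N := by linarith
    rw [hs, hN, hq] at this
    exact_mod_cast this
  · intro he
    have he' : s * (q^n+1) = N := by rw [hs, hN, hq]; exact_mod_cast he
    refine (Hk.A1 (hecke hB) _).2 ?_
    rw [← hq, key, ← he']
    have : (0:ℝ) < q^n+1 := by positivity
    field_simp
    ring

/-- the standard example -/
lemma example_ekr (hB : Sp B n) (hn : 1 ≤ n) : ∃ S : Set (Ch B n), IsEKRFlags S ∧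
    S.ncard * (Fintype.card F ^ n + 1) = Fintype.card (Ch B n) := by
  obtain ⟨C⟩ := exists_ch' hB hn
  refine ⟨{D | D.space 1 ≤ C.space n}, ?_, ?_⟩
  · intro D hD E hE h
    have h1 := h 1 (Finset.mem_Icc.2 ⟨le_rfl, hn⟩)
    have h2 : E.space 1 ≤ bperp B (D.space 1) :=
      le_trans hE ((tiso_iff.1 (ch_ti C n)).trans (bperp_anti hD))
    rw [inf_eq_right.2 h2] at h1
    have := ch_fr E hn
    rw [h1] at this; simp at this
  · have : ({D : Ch B n | D.space 1 ≤ C.space n} : Set (Ch B n)).ncard =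
        (Finset.univ.filter fun D : Ch B n => D.space 1 ≤ C.space n).card := by
      rw [← Set.ncard_coe_finset]; congr 1; ext a; simp
    rw [this, cnt_sub hB hn, ch_fr C le_rfl, cnt_all hB hn, pq_n _ hn, gq_two]; ring

end Gm

set_option linter.unusedSectionVars false

namespace Gm
variable {F V : Type} [Field F] [Fintype F] [AddCommGroup V] [Module F V]
variable {B : V →ₗ[F] V →ₗ[F] F} {n : ℕ}
variable [Fintype (Ch B n)]

lemma quad_eq {H : Type*} [NormedAddCommGroup H] [InnerProductSpace ℝ H] {A : Module.End ℝ H}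
    (hA : A.IsSymmetric) {q : ℝ} {x y z : H} (hz : A z = q • z) (hx : x = y + z) :
    inner ℝ (q • y - A y) y = inner ℝ (q • x - A x) x := by
  have e : q • x - A x = q • y - A y := by rw [hx, map_add, hz, smul_add]; abel
  rw [e, hx, inner_add_right]
  have : inner ℝ (q • y - A y) z = 0 := by
    rw [inner_sub_left, hA, hz, inner_smul_left, inner_smul_right]; simp
  rw [this, add_zero]

/-- arithmetic of the sizes -/
lemma sizes (hB : Sp B n) (hn : 3 ≤ n) (hq : 21 * n + 101 ≤ Fintype.card F) {n0 : ℕ}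
    (hs : n0 * (Fintype.card F ^ n + 1) = Fintype.card (Ch B n)) :
    0 < n0 ∧ Nat.Coprime n0 (Fintype.card F ^ (n*n-n)) ∧
    (n0:ℝ) ≤ 1.05 * ((Fintype.card F ^ (n*n-n) : ℕ) : ℝ) := by
  rw [cnt_all hB (by omega)] at hs
  set q := Fintype.card F
  have hp := pq_pos q n
  have h1 : (pq q n : ℝ) * (1 - 1/q)^n ≤ (q:ℝ)^(n*n) := pq_le (by omega) n
  have hq0 : (0:ℝ) < q := by
    have : 0 < q := by omega
    exact_mod_cast this
  have hqn : (21:ℝ) * n ≤ q := by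
    have : 21 * n ≤ q := by omega
    exact_mod_cast this
  refine ⟨?_, ?_, ?_⟩
  · rcases Nat.eq_zero_or_pos n0 with h | h
    · rw [h] at hs; omega
    · exact h
  · exact Nat.Coprime.pow_right _ (Nat.Coprime.coprime_dvd_left ⟨_, hs.symm⟩ (pq_coprime q n))
  · have hb : (20/21:ℝ) ≤ (1 - 1/q)^n := by
      have := one_add_mul_le_pow (a := -(1/(q:ℝ))) (by
        have : 1/(q:ℝ) ≤ 1 := by
          rw [div_le_one hq0]
          have : 1 ≤ q := by omega
          exact_mod_cast this
        linarith) n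
      refine le_trans ?_ (le_trans this (le_of_eq (by ring)))
      have : (n:ℝ) * (1/q) ≤ 1/21 := by
        rw [mul_one_div, div_le_div_iff₀ hq0 (by norm_num)]; linarith
      linarith
    have hNr : (pq q n : ℝ) = n0 * (q^n+1) := by rw [← hs]; push_cast; ring
    have e6 : (q:ℝ)^(n*n) = q^(n*n-n) * q^n := by
      rw [← pow_add, Nat.sub_add_cancel (Nat.le_mul_self n)]
    have hQ : (0:ℝ) < (q:ℝ)^n := by positivity
    have h2 : (n0:ℝ) * q^n * (20/21) ≤ q^(n*n-n) * q^n := by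
      rw [← e6]
      refine le_trans ?_ h1
      rw [hNr]
      have : (0:ℝ) ≤ n0 := by positivity
      gcongr
      linarith
    push_cast
    have h3 : (n0:ℝ) * (20/21) ≤ q^(n*n-n) := by
      refine le_of_mul_le_mul_right ?_ hQ
      linarith
    linarith

lemma pieces (hB : Sp B n) (hn : 3 ≤ n) (hq : 21 * n + 101 ≤ Fintype.card F) {S : Set (Ch B n)}
    (hs : S.ncard * (Fintype.card F ^ n + 1) = Fintype.card (Ch B n))
    (hT : Hk.TT (RR B n) n (ind S - vec fun _ => 1/((Fintype.card F : ℝ)^n+1)) =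
      (-(Fintype.card F : ℝ)^(n*n-n)) • (ind S - vec fun _ => 1/((Fintype.card F : ℝ)^n+1))) :
    ∃ f : ℕ → EuclideanSpace ℝ (Ch B n),
      (ind S - vec fun _ => 1/((Fintype.card F : ℝ)^n+1)) = ∑ k ∈ Finset.range n, f k ∧
      ∀ k < n, Hk.Good n (Fintype.card F : ℝ) (RR B n) k (f k) ∧
        ((∀ a, f k a = 0) ∨ ∃ S' : Set (Ch B n),
          (∀ a, f k a = ind S' a - 1/((Fintype.card F : ℝ)^n+1)) ∨
          (∀ a, f k a = -(ind S' a - 1/((Fintype.card F : ℝ)^n+1)))) := by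
  have hH := hecke hB
  obtain ⟨hn0, hcop, hle⟩ := sizes hB hn hq hs
  obtain ⟨C0⟩ := exists_ch' hB (by omega)
  set q : ℝ := (Fintype.card F : ℝ) with hqd
  have hqr : (101:ℝ) ≤ q := by
    have : 101 ≤ Fintype.card F := by omega
    rw [hqd]; exact_mod_cast this
  obtain ⟨f, hf, hg⟩ := Hk.A3main hH (by linarith) (by omega) _ hT
  refine ⟨f, hf, fun k hk => ⟨hg k hk, ?_⟩⟩
  -- the complement of the piece
  obtain ⟨z, hz, hSz⟩ : ∃ z, RR B n k z = q • z ∧ ind S = f k + z := by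
    refine ⟨(vec fun _ => 1/(q^n+1)) + ∑ j ∈ (Finset.range n).erase k, f j, ?_, ?_⟩
    · rw [map_add, inv_const hB _ k hk, smul_add, map_sum, Finset.smul_sum]
      congr 1
      refine Finset.sum_congr rfl fun j hj => ?_
      rw [Finset.mem_erase, Finset.mem_range] at hj
      exact (hg j hj.2).inv k hk (Ne.symm hj.1)
    · have := Finset.add_sum_erase (Finset.range n) f (Finset.mem_range.2 hk)
      rw [← hf] at this
      rw [add_left_comm, this]; abel
  have hE : inner ℝ (q • f k - RR B n k (f k)) (f k) ≤ q * S.ncard := by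
    rw [quad_eq (hH.sym k hk) hz hSz, inn, ← sum_ind, Finset.mul_sum]
    refine Finset.sum_le_sum fun C _ => ?_
    have h1 : 0 ≤ RR B n k (ind S) C := by
      rw [RR, op_rel_apply]; exact Finset.sum_nonneg fun D _ => ind_nonneg _ _
    simp only [PiLp.sub_apply, PiLp.smul_apply, smul_eq_mul]
    by_cases h : C ∈ S
    · rw [ind_mem h]; linarith
    · rw [ind_notMem h]; simp
  have hnorm : ∑ a, f k a ^ 2 ≤ 1.05 * (S.ncard:ℝ) := by
    rw [← nsq]
    have h1 := (hg k hk).nrm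
    have h2 : (1 + 4/q) * inner ℝ (q • f k - RR B n k (f k)) (f k) ≤ (1 + 4/q) * (q * S.ncard) := by gcongr
    have h3 : (1 + 4/q) * (q * S.ncard) = (q + 4) * S.ncard := by field_simp
    have h4 : (q - 1) * ‖f k‖^2 ≤ (q-1) * (1.05 * S.ncard) := by
      have : (0:ℝ) ≤ S.ncard := by positivity
      nlinarith
    exact le_of_mul_le_mul_left h4 (by linarith)
  have hfract : ∀ C D : Ch B n, Int.fract (f k C) = Int.fract (f k D) := by
    intro C D
    refine conn_low hB (fun C => Int.fract (f k C)) n 0 (by omega) (fun i h1 h2 C D hCD => ?_) C D ?_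
    · have hCD' : adj (n - (n - i)) C D := by rwa [show n - (n - i) = i by omega]
      by_cases hi : n - i = k
      · rw [hi] at hCD'
        have h3 := (R_inv hB hk z).1 hz C D hCD'
        have h4 : ∀ E, f k E = ind S E - z E := fun E => by rw [hSz]; simp
        refine Int.fract_eq_fract.2 ?_
        rw [h4, h4, h3]
        obtain ⟨x, hx⟩ : ∃ x : ℤ, (x:ℝ) = ind S C := by
          by_cases h : C ∈ S
          · rw [ind_mem h]; exact ⟨1, by simp⟩
          · rw [ind_notMem h]; exact ⟨0, by simp⟩
        obtain ⟨y, hy⟩ : ∃ x : ℤ, (x:ℝ) = ind S D := by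
          by_cases h : D ∈ S
          · rw [ind_mem h]; exact ⟨1, by simp⟩
          · rw [ind_notMem h]; exact ⟨0, by simp⟩
        exact ⟨x - y, by rw [← hx, ← hy]; push_cast; ring⟩
      · have h3 := (R_inv hB (by omega) (f k)).1 ((hg k hk).inv (n-i) (by omega) hi) C D hCD'
        simp only [h3]
    · intro i hi
      obtain rfl : i = 0 := by omega
      rw [ch_zero, ch_zero]
  have hc1 : 0 < Fintype.card F := by omega
  have hQ : 450 ≤ Fintype.card F ^ n := by
    calc 450 ≤ 101 ^ 3 := by norm_num
      _ ≤ Fintype.card F ^ 3 := Nat.pow_le_pow_left (by omega) _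
      _ ≤ _ := Nat.pow_le_pow_right hc1 hn
  have := Rg.rigid (tt n) (Fintype.card F ^ (n*n-n)) (Fintype.card F ^ n) S.ncard hQ hn0 (by positivity)
    hs.symm hcop hle (fun a => by rw [tt_card hB, ← pow_add, Nat.sub_add_cancel (Nat.le_mul_self n)])
    (fun C => ⌊f k C⌋) (Int.fract (f k C0)) (f k)
    (fun a => by rw [← hfract a C0]; exact (Int.floor_add_fract _).symm)
    (sum_zero hB (by positivity) (hg k hk).tt)
    (fun a => by
      rw [← T_apply hB, (hg k hk).tt]
      simp [hqd]) hnorm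
  rw [hqd]
  push_cast at this
  exact this

end Gm

set_option linter.unusedSectionVars false

namespace Gm
variable {F V : Type} [Field F] [Fintype F] [AddCommGroup V] [Module F V]
variable {B : V →ₗ[F] V →ₗ[F] F} {n : ℕ}

lemma ncard_filter {ι : Type} [Fintype ι] (p : ι → Prop) :
    ({a | p a} : Set ι).ncard = (Finset.univ.filter p).card := by
  rw [← Set.ncard_coe_finset]; congr 1; ext a; simp

lemma ind_sq {ι : Type} [Fintype ι] (S : Set ι) : ∑ a, ind S a ^ 2 = S.ncard := by
  rw [← sum_ind]
  refine Finset.sum_congr rfl fun C _ => ?_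
  by_cases h : C ∈ S
  · rw [ind_mem h]; norm_num
  · rw [ind_notMem h]; norm_num

lemma mid_arith {q P P' N a z2 f2 : ℝ} (hq : 101 ≤ q) (hP : 1 ≤ P) (hP0' : 0 ≤ P') (hP' : P' ≤ P) (hN : 0 < N) (hz0 : 0 ≤ z2)
    (h1 : f2 = N * (1/(P*q^2+1)) * (1 - 1/(P*q^2+1)))
    (h2 : f2 ≤ (1 + 4/q) * (P' * z2))
    (h3 : (P*q^2)^2 * a ≤ (q+1) * N)
    (h4 : z2 ≤ a + 1/(P*q+1) * (N * (1/(P*q^2+1)))) : False := by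
  have hq0 : (0:ℝ) < q := by linarith
  have hP0 : (0:ℝ) < P := by linarith
  have hQ : (101:ℝ) ≤ P * q^2 := by nlinarith
  set Q := P * q^2 with hQd
  have hδ : 1/(Q+1) ≤ 1/102 := one_div_le_one_div_of_le (by norm_num) (by linarith)
  have hδ0 : 0 < 1/(Q+1) := by positivity
  have h4q : 4/q ≤ 4/101 := by gcongr
  have g1 : N * (1/(Q+1)) * (101/102) ≤ f2 := by
    rw [h1]; gcongr; linarith
  have g2 : f2 ≤ (105/101) * (P * z2) := by
    refine h2.trans ?_
    have : (1 + 4/q) ≤ 105/101 := by linarith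
    gcongr
  have g3 : a ≤ 4 / (P*q) * (N * (1/(Q+1))) := by
    have e1 : a ≤ (q+1) * N / Q^2 := by rw [le_div_iff₀ (by positivity)]; linarith
    refine e1.trans ?_
    rw [div_mul_eq_mul_div, mul_one_div, mul_div_assoc', div_div, div_le_div_iff₀ (by positivity) (by positivity)]
    have e2 : (q+1) * (Q+1) * (P*q) ≤ 4 * Q^2 := by
      have : (q+1) * (P * q) ≤ 2 * Q := by rw [hQd]; nlinarith
      nlinarith
    nlinarith
  have g4 : 1/(P*q+1) * (N * (1/(Q+1))) ≤ 1/(P*q) * (N * (1/(Q+1))) := by gcongr; linarith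
  have g5 : P * z2 ≤ 5/q * (N * (1/(Q+1))) := by
    have : z2 ≤ (4 / (P*q) + 1/(P*q)) * (N * (1/(Q+1))) := by rw [add_mul]; linarith
    calc P * z2 ≤ P * ((4 / (P*q) + 1/(P*q)) * (N * (1/(Q+1)))) := by gcongr
      _ = _ := by field_simp; ring
  have g6 : 5/q * (N * (1/(Q+1))) ≤ 5/101 * (N * (1/(Q+1))) := by gcongr
  have : 0 < N * (1/(Q+1)) := by positivity
  linarith

variable [Fintype (Ch B n)]

lemma cross (hB : Sp B n) (hn : 1 ≤ n) (A Y : Set (Ch B n))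
    (h : ∀ C ∈ A, Hk.TT (RR B n) n (ind Y) C = 0) :
    ((Fintype.card F : ℝ)^n)^2 * (A.ncard * Y.ncard) ≤ (Fintype.card (Ch B n) : ℝ)^2 := by
  set q : ℝ := (Fintype.card F : ℝ) with hq
  have hq0 : (0:ℝ) < q := by rw [hq]; exact_mod_cast Fintype.card_pos (α := F)
  have hNpos : (0:ℝ) < Fintype.card (Ch B n) := by
    have := exists_ch' hB hn
    exact_mod_cast Fintype.card_pos
  set N : ℝ := (Fintype.card (Ch B n) : ℝ) with hN
  set a : ℝ := (A.ncard : ℝ) with ha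
  set y : ℝ := (Y.ncard : ℝ) with hy
  have ha0 : 0 ≤ a := by positivity
  have hy0 : 0 ≤ y := by positivity
  set v : EuclideanSpace ℝ (Ch B n) := ind Y - vec fun _ => y/N with hv
  have hsv : ∑ C, v C = 0 := by
    simp only [hv, PiLp.sub_apply, Finset.sum_sub_distrib, sum_ind, vec_apply, Finset.sum_const,
      Finset.card_univ, nsmul_eq_mul]
    rw [← hN, ← hy]; field_simp; ring
  have hnv : ‖v‖^2 ≤ y := by
    have : ‖v‖^2 = y - y^2/N := by
      rw [nsq]
      have : ∀ C, v C ^ 2 = ind Y C ^ 2 - 2 * (y/N) * ind Y C + (y/N)^2 := fun C => by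
        simp only [hv, PiLp.sub_apply, vec_apply]; ring
      simp only [this, Finset.sum_add_distrib, Finset.sum_sub_distrib, ← Finset.mul_sum, sum_ind, ind_sq,
        Finset.sum_const, Finset.card_univ, nsmul_eq_mul]
      rw [← hN, ← hy]; field_simp; ring
    rw [this]
    have : 0 ≤ y^2/N := by positivity
    linarith
  have hA2 := Hk.A2 (hecke hB) v (by
    intro u hu
    obtain ⟨C0⟩ := exists_ch' hB hn
    rw [inn, Finset.sum_congr rfl (g := fun C => v C * u C0) (fun C _ => by rw [const_of_inv hB hu C C0]),
      ← Finset.sum_mul, hsv, zero_mul])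
  have hin : inner ℝ (ind A) (Hk.TT (RR B n) n v) = -(q^(n*n) * (a * y / N)) := by
    rw [hv, map_sub, T_const hB, inner_sub_right, inner_smul_right]
    have e1 : inner ℝ (ind A) (Hk.TT (RR B n) n (ind Y)) = (0:ℝ) := by
      rw [inn]
      refine Finset.sum_eq_zero fun C _ => ?_
      by_cases hC : C ∈ A
      · rw [h C hC, mul_zero]
      · rw [ind_notMem hC, zero_mul]
    have e2 : inner ℝ (ind A) (vec fun _ => y/N) = a * y / N := by
      rw [inn]; simp only [vec_apply, ← Finset.sum_mul, sum_ind]; ring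
    rw [e1, e2]; ring
  have hna : ‖ind A‖^2 = a := by rw [nsq, ind_sq]
  have e6 : q^(n*n) = q^(n*n-n) * q^n := by
    rw [← pow_add, Nat.sub_add_cancel (Nat.le_mul_self n)]
  have hcs : q^(n*n) * (a * y / N) ≤ ‖ind A‖ * (q^(n*n-n) * ‖v‖) := by
    have h1 := abs_real_inner_le_norm (ind A) (Hk.TT (RR B n) n v)
    rw [hin, abs_neg, abs_of_nonneg (by positivity)] at h1
    exact h1.trans (by gcongr)
  have hc : 0 < q^(n*n-n) := by positivity
  have h2 : q^n * (a * y / N) ≤ ‖ind A‖ * ‖v‖ := by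
    refine le_of_mul_le_mul_left ?_ hc
    rw [e6] at hcs; linarith
  have h3 : (q^n * (a * y / N))^2 ≤ a * y := by
    calc (q^n * (a * y / N))^2 ≤ (‖ind A‖ * ‖v‖)^2 := by gcongr
      _ = a * ‖v‖^2 := by rw [mul_pow, hna]
      _ ≤ a * y := by gcongr
  rcases (mul_nonneg ha0 hy0).eq_or_lt with h0 | h0
  · rw [← h0]; simp; positivity
  · have h4 : (q^n * (a * y / N))^2 = ((q^n)^2 * (a*y)) * (a * y) / N^2 := by field_simp
    rw [h4, div_le_iff₀ (by positivity)] at h3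
    refine le_of_mul_le_mul_right ?_ h0
    linarith

lemma perp_card (hB : Sp B n) (hn : 1 ≤ n) (C : Ch B n) : Fintype.card (Ch B n) ≤
    (Fintype.card F + 1) * ({D : Ch B n | D.space 1 ≤ bperp B (C.space 1)} : Set (Ch B n)).ncard := by
  rw [ncard_filter, cnt_sub hB hn, hB.finrank_perp, ch_fr C hn, cnt_all hB hn, pq_n _ hn,
    show 2 * n = 2 * n - 1 + 1 by omega, gq_succ, ← mul_assoc]
  refine Nat.mul_le_mul_right _ ?_
  have := gq_pos (q := Fintype.card F) (show 1 ≤ 2 * n - 1 by omega)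
  simp only [Nat.add_sub_cancel]
  linarith

/-- moving to a perpendicular point -/
lemma move_pt (hB : Sp B n) (hn : 2 ≤ n) {C D : Ch B n} (h : D.space 1 ≤ bperp B (C.space 1))
    (hne : D.space 1 ≠ C.space 1) : ∃ E E' : Ch B n, E.space 1 = C.space 1 ∧ E'.space 1 = D.space 1 ∧ adj 1 E E' := by
  have := hB.fd
  have f1 := ch_fr C (show 1 ≤ n by omega)
  have f2 := ch_fr D (show 1 ≤ n by omega)
  have hinf : C.space 1 ⊓ D.space 1 = ⊥ := by
    by_contra hb
    have h1 : 1 ≤ finrank F ↥(C.space 1 ⊓ D.space 1) := by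
      rw [Nat.one_le_iff_ne_zero]
      intro h0; exact hb (Submodule.finrank_eq_zero.1 h0)
    have e1 := Submodule.eq_of_le_of_finrank_le (inf_le_left : C.space 1 ⊓ D.space 1 ≤ _) (by rw [f1]; exact h1)
    have e2 := Submodule.eq_of_le_of_finrank_le (inf_le_right : C.space 1 ⊓ D.space 1 ≤ _) (by rw [f2]; exact h1)
    exact hne (e2.symm.trans e1)
  have hfr : finrank F ↥(C.space 1 ⊔ D.space 1) = 2 := by
    have := Submodule.finrank_sup_add_finrank_inf_eq (C.space 1) (D.space 1)
    rw [hinf, f1, f2] at this; simpa using this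
  have hti : IsTotIso B (C.space 1 ⊔ D.space 1) := hB.tiso_sup (ch_ti C 1) (ch_ti D 1) h
  obtain ⟨E, hE, hE2⟩ := ext_flag hB (j := 1) (by omega) C hti hfr le_sup_left
  obtain ⟨E', h1, h2⟩ := exists_upd E (i := 1) le_rfl (by omega) (ch_ti D 1) f2
    (by rw [ch_zero]; exact bot_le) (by intro _; rw [hE2]; exact le_sup_right)
  refine ⟨E, E', hE 1 le_rfl, h1, adj_of (fun j hj => (h2 j hj).symm) ?_⟩
  rw [hE 1 le_rfl, h1]; exact hne.symm

lemma no_mid (hB : Sp B n) (hn : 3 ≤ n) (hq : 101 ≤ Fintype.card F) {k : ℕ} (hk1 : 1 ≤ k) (hk : k + 1 < n)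
    (S : Set (Ch B n)) (δ : ℝ) (hδ : δ = 1/((Fintype.card F : ℝ)^n+1)) (w z : EuclideanSpace ℝ (Ch B n))
    (hf : ∀ a, ind S a - δ = w a + z a)
    (hinv : RR B n (n-1) (ind S) = (Fintype.card F : ℝ) • ind S)
    (hs : ∑ a, (ind S a - δ) = 0)
    (hz : ∀ j < n - 1, RR B n j z = (Fintype.card F : ℝ) • z)
    (hTz : Hk.TT (RR B n) n z = (-(Fintype.card F : ℝ)^(n*n-n)) • z)
    (hLz : Hk.LL (RR B n) (n-1) z = (-(Fintype.card F : ℝ)^(n-1)) • z)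
    (hLw : Hk.LL (RR B n) (n-1) w = ((Fintype.card F : ℝ)^(2*n-2)) • w)
    (hw : ∀ u, (∀ j < n - 1, RR B n j u = (Fintype.card F : ℝ) • u) → inner ℝ w u = 0)
    (hnz : (∑ a, (ind S a - δ)^2) ≤
      (1 + 4/(Fintype.card F : ℝ)) * ((Fintype.card F : ℝ)^(n-1-k) * ‖z‖^2)) : False := by
  set q : ℝ := (Fintype.card F : ℝ) with hqd
  have hqr : (101:ℝ) ≤ q := by rw [hqd]; exact_mod_cast hq
  have hq0 : (0:ℝ) < q := by linarith
  obtain ⟨C0⟩ := exists_ch' hB (by omega : 1 ≤ n)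
  have hNpos : (0:ℝ) < Fintype.card (Ch B n) := by
    have : Nonempty (Ch B n) := ⟨C0⟩
    exact_mod_cast Fintype.card_pos
  set N : ℝ := (Fintype.card (Ch B n) : ℝ) with hN
  obtain ⟨P, hP⟩ : ∃ P, P = q^(n-2) := ⟨_, rfl⟩
  have hP1 : 1 ≤ P := by rw [hP]; exact one_le_pow₀ (by linarith)
  have eQ : q^n = P * q^2 := by rw [hP, ← pow_add]; congr 1; omega
  have eQ1 : q^(n-1) = P * q := by rw [hP, ← pow_succ]; congr 1; omega
  have eQ2 : q^(2*n-2) = P * q * (P * q) := by rw [← eQ1, ← pow_add]; congr 1; omega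
  have eQ3 : q^(2*(n-1)+1) = P * q^2 * (P * q) := by rw [← eQ1, ← eQ, ← pow_add]; congr 1; omega
  have hδQ : δ * (P * q^2 + 1) = 1 := by rw [hδ, eQ]; field_simp
  have hδ0 : 0 < δ := by rw [hδ]; positivity
  set g : Ch B n → ℝ := fun C => δ + z C with hg
  have hgpt : ∀ C D : Ch B n, C.space 1 = D.space 1 → g C = g D := fun C D h => by
    simp only [hg, pt_of_inv hB (by omega) hz h]
  -- averaging
  have havg : ∀ C : Ch B n, ∑ D ∈ Finset.univ.filter (fun D : Ch B n => D.space 1 = C.space 1), (ind S D - g D) = 0 := by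
    intro C
    have h1 := hw (ind {D : Ch B n | D.space 1 = C.space 1}) (inv_of_pt hB _ fun D E h => by
      by_cases hE : E.space 1 = C.space 1
      · rw [ind_mem (S := {D : Ch B n | D.space 1 = C.space 1}) (h.trans hE),
          ind_mem (S := {D : Ch B n | D.space 1 = C.space 1}) hE]
      · rw [ind_notMem (S := {D : Ch B n | D.space 1 = C.space 1}) (fun h' => hE (h.symm.trans h')),
          ind_notMem (S := {D : Ch B n | D.space 1 = C.space 1}) hE])
    rw [inn] at h1
    refine Eq.trans ?_ h1
    rw [Finset.sum_filter]
    refine Finset.sum_congr rfl fun D _ => ?_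
    have := hf D
    by_cases hD : D.space 1 = C.space 1
    · rw [if_pos hD, ind_mem (S := {D : Ch B n | D.space 1 = C.space 1}) hD]; simp only [hg]; linarith
    · rw [if_neg hD, ind_notMem (S := {D : Ch B n | D.space 1 = C.space 1}) hD]; simp
  have hind1 : ∀ C, ind S C ≤ 1 := fun C => by
    by_cases h : C ∈ S
    · rw [ind_mem h]
    · rw [ind_notMem h]; norm_num
  -- existence of extremes
  have hlow : ∀ C : Ch B n, ∃ D : Ch B n, D.space 1 = C.space 1 ∧ ind S D ≤ g C := by
    intro C
    by_contra hcon
    push Not at hcon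
    have : 0 < ∑ D ∈ Finset.univ.filter (fun D : Ch B n => D.space 1 = C.space 1), (ind S D - g D) := by
      refine Finset.sum_pos (fun D hD => ?_) ⟨C, by simp⟩
      have hD := (Finset.mem_filter.1 hD).2
      have := hcon D hD
      rw [hgpt D C hD]; linarith
    rw [havg] at this; exact lt_irrefl _ this
  have hhigh : ∀ C : Ch B n, ∃ D : Ch B n, D.space 1 = C.space 1 ∧ g C ≤ ind S D := by
    intro C
    by_contra hcon
    push Not at hcon
    have : ∑ D ∈ Finset.univ.filter (fun D : Ch B n => D.space 1 = C.space 1), (ind S D - g D) < 0 := by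
      refine Finset.sum_neg (fun D hD => ?_) ⟨C, by simp⟩
      have hD := (Finset.mem_filter.1 hD).2
      have := hcon D hD
      rw [hgpt D C hD]; linarith
    rw [havg] at this; exact lt_irrefl _ this
  have hg0 : ∀ C, 0 ≤ g C := fun C => by
    obtain ⟨D, _, h⟩ := hlow C
    exact (ind_nonneg S D).trans h
  have hg1 : ∀ C, g C ≤ 1 := fun C => by
    obtain ⟨D, _, h⟩ := hhigh C
    exact h.trans (hind1 D)
  have hpos : ∀ C ∈ S, 0 < g C := by
    intro C hC
    rcases (hg0 C).eq_or_lt with h | h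
    · exfalso
      have h1 := havg C
      rw [Finset.sum_congr rfl (g := fun D => ind S D) (fun D hD => by
        rw [hgpt D C (Finset.mem_filter.1 hD).2, ← h, sub_zero])] at h1
      have := (Finset.sum_eq_zero_iff_of_nonneg fun D _ => ind_nonneg S D).1 h1 C (by simp)
      rw [ind_mem hC] at this; exact one_ne_zero this
    · exact h
  have hheavy : ∀ C, g C = 1 → ∀ D : Ch B n, D.space 1 = C.space 1 → D ∈ S := by
    intro C hC D hD
    by_contra hDS
    have h1 := havg C
    have := (Finset.sum_eq_zero_iff_of_nonpos fun E hE => by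
      rw [hgpt E C (Finset.mem_filter.1 hE).2, hC]; linarith [hind1 E]).1 h1 D (by simp [hD])
    rw [ind_notMem hDS, hgpt D C hD, hC] at this
    norm_num at this
  -- small values
  have hsmall : ∀ C, g C ≠ 1 → g C ≤ 1/(P*q+1) := by
    intro C hC
    obtain ⟨D, hD, hDg⟩ := hlow C
    have hDS : D ∉ S := by
      intro h; rw [ind_mem h] at hDg; exact hC (le_antisymm (hg1 C) hDg)
    have hdec : ind S = (vec fun _ => δ) + w + z := by
      ext E; simp only [PiLp.add_apply, vec_apply]; linarith [hf E]
    have h1 : 0 ≤ Hk.LL (RR B n) (n-1) (ind S) D := by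
      rw [L_apply hB (by omega)]; exact Finset.sum_nonneg fun E _ => ind_nonneg S E
    have h2 : Hk.LL (RR B n) (n-1) (vec fun _ => δ) = (q^(2*(n-1)+1)) • (vec fun _ => δ) :=
      Hk.LL_inv_vec fun j hj => inv_const hB δ j (by omega)
    rw [hdec, map_add, map_add, h2, hLw, hLz] at h1
    simp only [PiLp.add_apply, PiLp.smul_apply, vec_apply, smul_eq_mul] at h1
    have h3 := hf D
    rw [ind_notMem hDS] at h3
    have h4 : z D = g C - δ := by rw [← hgpt D C hD]; simp only [hg]; ring
    have h5 : w D = - g C := by linarith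
    rw [h4, h5, eQ1, eQ2, eQ3] at h1
    have h6 : g C * (P * q + 1) * (P * q) ≤ 1 * (P * q) := by
      have : (P * q) * (δ * (P*q^2+1)) = P * q := by rw [hδQ, mul_one]
      linarith
    rw [le_div_iff₀ (by positivity)]
    exact le_of_mul_le_mul_right h6 (by positivity)
  set A : Set (Ch B n) := {C | g C = 1} with hA
  have hTg : ∀ C, ∑ D ∈ Finset.univ.filter (tt n C), g D = q^(n*n-n) * (1 - g C) := by
    intro C
    have e6 : q^(n*n) = q^(n*n-n) * q^n := by
      rw [← pow_add, Nat.sub_add_cancel (Nat.le_mul_self n)]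
    have h1 := congrArg (fun v => v.ofLp C) hTz
    simp only [T_apply hB, PiLp.smul_apply, smul_eq_mul] at h1
    simp only [hg, Finset.sum_add_distrib, h1, Finset.sum_const, tt_card hB, nsmul_eq_mul]
    push_cast
    rw [← hqd, e6, eQ]
    linear_combination (q^(n*n-n)) * hδQ
  have hAcard : (P*q^2)^2 * (A.ncard : ℝ) ≤ (q+1) * N := by
    rcases A.eq_empty_or_nonempty with h | ⟨C, hC⟩
    · rw [h]; simp; positivity
    set Y : Set (Ch B n) := {D : Ch B n | D.space 1 ≤ bperp B (C.space 1)} with hY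
    have hYpos : ∀ D ∈ Y, 0 < g D := by
      intro D hD
      by_cases hDC : D.space 1 = C.space 1
      · rw [hgpt D C hDC, hC]; norm_num
      · obtain ⟨E, E', h1, h2, h3⟩ := move_pt hB (by omega) hD hDC
        have hES := hheavy C hC E h1
        have h4 := (R_inv hB (by omega) (ind S)).1 hinv E E' (by rwa [show n - (n-1) = 1 by omega])
        rw [ind_mem hES] at h4
        have hE'S : E' ∈ S := by
          by_contra h5; rw [ind_notMem h5] at h4; norm_num at h4
        rw [← hgpt E' D h2]; exact hpos E' hE'S
    have hcr := cross hB (by omega) A Y (by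
      intro C' hC'
      have h1 := hTg C'
      rw [show g C' = 1 from hC', sub_self, mul_zero] at h1
      rw [T_apply hB]
      refine Finset.sum_eq_zero fun D hD => ind_notMem fun hDY => ?_
      have := (Finset.sum_eq_zero_iff_of_nonneg fun D _ => hg0 D).1 h1 D hD
      exact (hYpos D hDY).ne' this)
    have hYc : N ≤ (q+1) * (Y.ncard : ℝ) := by
      have := perp_card hB (by omega) C
      rw [hN, hqd]; exact_mod_cast this
    rw [← hqd, ← hN, eQ] at hcr
    have h7 : (P*q^2)^2 * (A.ncard : ℝ) * N ≤ (q+1) * N * N := by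
      calc (P*q^2)^2 * (A.ncard : ℝ) * N ≤ (P*q^2)^2 * (A.ncard : ℝ) * ((q+1) * (Y.ncard : ℝ)) := by gcongr
        _ = (q+1) * ((P*q^2)^2 * (A.ncard * Y.ncard)) := by ring
        _ ≤ (q+1) * N^2 := by gcongr
        _ = _ := by ring
    exact le_of_mul_le_mul_right h7 hNpos
  have hsz : ∑ C, z C = 0 := sum_zero hB (by positivity) hTz
  have hsg : ∑ C, g C = N * δ := by
    simp only [hg, Finset.sum_add_distrib, hsz, Finset.sum_const, Finset.card_univ, nsmul_eq_mul]; rw [← hN]; ring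
  have hsg2 : ∑ C, g C ^ 2 = N * δ^2 + ‖z‖^2 := by
    have : ∀ C, g C ^ 2 = δ^2 + 2 * δ * z C + z C ^ 2 := fun C => by simp only [hg]; ring
    simp only [this, Finset.sum_add_distrib, ← Finset.mul_sum, hsz, Finset.sum_const, Finset.card_univ,
      nsmul_eq_mul, nsq]
    rw [← hN]; ring
  have hz2 : ‖z‖^2 ≤ A.ncard + 1/(P*q+1) * (N * δ) := by
    have h1 : ∑ C, g C ^ 2 ≤ ∑ C, (ind A C + 1/(P*q+1) * g C) := by
      refine Finset.sum_le_sum fun C _ => ?_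
      have h0 := hg0 C
      by_cases hC : C ∈ A
      · rw [ind_mem hC]
        have : g C = 1 := hC
        have h2 : 0 ≤ 1/(P*q+1) * g C := by positivity
        rw [this] at h2 ⊢; linarith
      · rw [ind_notMem hC, zero_add, sq]
        exact mul_le_mul_of_nonneg_right (hsmall C hC) h0
    rw [Finset.sum_add_distrib, ← Finset.mul_sum, sum_ind, hsg, hsg2] at h1
    have : 0 ≤ N * δ^2 := by positivity
    linarith
  have hSc : (S.ncard : ℝ) = N * δ := by
    simp only [Finset.sum_sub_distrib, sum_ind, Finset.sum_const, Finset.card_univ, nsmul_eq_mul] at hs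
    rw [← hN] at hs; linarith
  have hf2 : (∑ a, (ind S a - δ)^2) = N * (1/(P*q^2+1)) * (1 - 1/(P*q^2+1)) := by
    have : ∀ a, (ind S a - δ)^2 = ind S a ^ 2 - 2 * δ * ind S a + δ^2 := fun a => by ring
    simp only [this, Finset.sum_add_distrib, Finset.sum_sub_distrib, ← Finset.mul_sum, ind_sq, sum_ind,
      Finset.sum_const, Finset.card_univ, nsmul_eq_mul]
    rw [← hN, hSc, ← eQ, ← hδ]; ring
  rw [hδ, eQ] at hz2
  exact mid_arith hqr hP1 (by positivity) (by
    rw [hP]; exact pow_le_pow_right₀ (by linarith) (by omega)) hNpos (by positivity) hf2 hnz hAcard hz2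

end Gm

set_option linter.unusedSectionVars false

namespace Gm
variable {F V : Type} [Field F] [Fintype F] [AddCommGroup V] [Module F V]
variable {B : V →ₗ[F] V →ₗ[F] F} {n : ℕ}

lemma eps_arith {δ e0 e1 b0 b1 x : ℝ} (hδ0 : 0 < δ) (hδ : δ < 1/4) (h0 : e0 = 0 ∨ e0 = 1 ∨ e0 = -1)
    (h1 : e1 = 0 ∨ e1 = 1 ∨ e1 = -1) (hb0 : b0 = 0 ∨ b0 = 1) (hb1 : b1 = 0 ∨ b1 = 1) (hx : x = 0 ∨ x = 1)
    (h : x - δ = e0 * (b0 - δ) + e1 * (b1 - δ)) : e0 = 0 ∨ e1 = 0 := by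
  rcases h0 with rfl | rfl | rfl
  · exact Or.inl rfl
  all_goals
    right
    rcases h1 with rfl | rfl | rfl
    · rfl
    all_goals
      exfalso
      rcases hb0 with rfl | rfl <;> rcases hb1 with rfl | rfl <;> rcases hx with rfl | rfl <;> linarith

variable [Fintype (Ch B n)]

lemma ind_01 {ι : Type} (S : Set ι) (a : ι) : ind S a = 0 ∨ ind S a = 1 := by
  by_cases h : a ∈ S
  · right; exact ind_mem h
  · left; exact ind_notMem h

lemma dich (hB : Sp B n) (hn : 3 ≤ n) (hq : 21 * n + 101 ≤ Fintype.card F) {S : Set (Ch B n)}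
    (hs : S.ncard * (Fintype.card F ^ n + 1) = Fintype.card (Ch B n))
    (hT : Hk.TT (RR B n) n (ind S - vec fun _ => 1/((Fintype.card F : ℝ)^n+1)) =
      (-(Fintype.card F : ℝ)^(n*n-n)) • (ind S - vec fun _ => 1/((Fintype.card F : ℝ)^n+1))) :
    (∀ j, 1 ≤ j → j < n → RR B n j (ind S) = (Fintype.card F : ℝ) • ind S) ∨
    (∀ j < n - 1, RR B n j (ind S) = (Fintype.card F : ℝ) • ind S) := by
  obtain ⟨f, hf, hp⟩ := pieces hB hn hq hs hT
  obtain ⟨C0⟩ := exists_ch' hB (by omega : 1 ≤ n)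
  obtain ⟨δ, hδ⟩ : ∃ δ : ℝ, δ = 1/((Fintype.card F : ℝ)^n+1) := ⟨_, rfl⟩
  have hqr : (101:ℝ) ≤ (Fintype.card F : ℝ) := by
    have : 101 ≤ Fintype.card F := by omega
    exact_mod_cast this
  have hδ0 : 0 < δ := by rw [hδ]; positivity
  have hδ4 : δ < 1/4 := by
    rw [hδ]
    refine one_div_lt_one_div_of_lt (by norm_num) ?_
    have : (Fintype.card F : ℝ)^1 ≤ (Fintype.card F : ℝ)^n := pow_le_pow_right₀ (by linarith) (by omega)
    linarith
  have hp' : ∀ k < n, Hk.Good n (Fintype.card F : ℝ) (RR B n) k (f k) ∧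
      ((∀ a, f k a = 0) ∨ ∃ S' : Set (Ch B n), (∀ a, f k a = ind S' a - δ) ∨
          (∀ a, f k a = -(ind S' a - δ))) := by rw [hδ]; exact hp
  rw [← hδ] at hf
  have hmid : ∀ k, 1 ≤ k → k + 1 < n → f k = 0 := by
    intro k hk1 hk
    obtain ⟨hg, h | ⟨S', h⟩⟩ := hp' k (by omega)
    · ext a; exact h a
    exfalso
    obtain ⟨w, z, e1, e2, e3, e4, e5, e6, e7⟩ := hg.mid hk1 hk
    have hsum := sum_zero hB (by positivity) hg.tt
    have hinv := (R_inv hB (by omega) _).1 (hg.inv (n-1) (by omega) (by omega))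
    rcases h with h | h
    · refine no_mid hB hn (by omega) hk1 hk S' δ hδ w z ?_ ?_ ?_ e2 e3 e4 e5 e6 ?_
      · intro a; rw [← h a, e1]; rfl
      · refine (R_inv hB (by omega) _).2 fun C D hCD => ?_
        have := hinv C D hCD
        rw [h, h] at this; linarith
      · rw [← hsum]; exact Finset.sum_congr rfl fun a _ => (h a).symm
      · refine le_trans (le_of_eq ?_) e7
        rw [nsq]; exact Finset.sum_congr rfl fun a _ => by rw [h a]
    · refine no_mid hB hn (by omega) hk1 hk S' δ hδ (-w) (-z) ?_ ?_ ?_ ?_ ?_ ?_ ?_ ?_ ?_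
      · intro a
        have := h a
        rw [e1] at this
        simp only [PiLp.add_apply, PiLp.neg_apply] at this ⊢
        linarith
      · refine (R_inv hB (by omega) _).2 fun C D hCD => ?_
        have := hinv C D hCD
        rw [h, h] at this; linarith
      · rw [← neg_inj, neg_zero, ← hsum, ← Finset.sum_neg_distrib]
        exact Finset.sum_congr rfl fun a _ => (h a).symm
      · intro j hj; rw [map_neg, e2 j hj, smul_neg]
      · rw [map_neg, e3, smul_neg]
      · rw [map_neg, e4, smul_neg]
      · rw [map_neg, e5, smul_neg]
      · intro u hu; rw [inner_neg_left, e6 u hu, neg_zero]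
      · rw [norm_neg]
        refine le_trans (le_of_eq ?_) e7
        rw [nsq]; exact Finset.sum_congr rfl fun a _ => by rw [h a]; ring
  have hsplit : ind S = (vec fun _ => δ) + (f 0 + f (n-1)) := by
    have : ∑ k ∈ Finset.range n, f k = f 0 + f (n-1) := by
      obtain ⟨m, rfl⟩ : ∃ m, n = m + 2 := ⟨n - 2, by omega⟩
      rw [Finset.sum_range_succ, Finset.sum_range_succ', Finset.sum_eq_zero, zero_add]
      · rfl
      · intro i hi
        rw [Finset.mem_range] at hi
        exact hmid (i+1) (by omega) (by omega)
    rw [← this, ← hf]; abel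
  have heps : ∀ k < n, ∃ (e : ℝ) (S' : Set (Ch B n)), (e = 0 ∨ e = 1 ∨ e = -1) ∧ ∀ a, f k a = e * (ind S' a - δ) := by
    intro k hk
    obtain ⟨_, h | ⟨S', h | h⟩⟩ := hp' k hk
    · exact ⟨0, ∅, Or.inl rfl, fun a => by rw [h]; ring⟩
    · exact ⟨1, S', Or.inr (Or.inl rfl), fun a => by rw [h]; ring⟩
    · exact ⟨-1, S', Or.inr (Or.inr rfl), fun a => by rw [h]; ring⟩
  obtain ⟨e0, S0, he0, h0⟩ := heps 0 (by omega)
  obtain ⟨e1, S1, he1, h1⟩ := heps (n-1) (by omega)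
  have hx : ind S C0 - δ = e0 * (ind S0 C0 - δ) + e1 * (ind S1 C0 - δ) := by
    rw [← h0, ← h1, hsplit]; simp
  rcases eps_arith hδ0 hδ4 he0 he1 (ind_01 S0 C0) (ind_01 S1 C0) (ind_01 S C0) hx with h | h
  · right
    have hz : f 0 = 0 := by ext a; rw [h0, h, zero_mul]; rfl
    intro j hj
    rw [hsplit, hz, zero_add, map_add, inv_const hB _ _ (by omega),
      (hp' (n-1) (by omega)).1.inv j (by omega) (by omega), smul_add]
  · left
    have hz : f (n-1) = 0 := by ext a; rw [h1, h, zero_mul]; rfl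
    intro j hj hj'
    rw [hsplit, hz, add_zero, map_add, inv_const hB _ _ (by omega),
      (hp' 0 (by omega)).1.inv j (by omega) (by omega), smul_add]

lemma mem_iff_of_ind {S : Set (Ch B n)} {C D : Ch B n} (h : ind S C = ind S D) (hC : C ∈ S) : D ∈ S := by
  by_contra hD
  rw [ind_mem hC, ind_notMem hD] at h
  exact one_ne_zero h

lemma blow {s K : ℕ} (hK : ∀ X : Submodule F V, IsTotIso B X → finrank F X = s →
    (Finset.univ.filter fun D : Ch B n => D.space s = X).card = K) (X : Set (Submodule F V)) (hfin : X.Finite)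
    (hX : ∀ Y ∈ X, IsTotIso B Y ∧ finrank F Y = s) :
    ({C : Ch B n | C.space s ∈ X} : Set (Ch B n)).ncard = X.ncard * K := by
  rw [ncard_filter, Finset.card_eq_sum_card_fiberwise (f := fun D => D.space s) (t := hfin.toFinset),
    Finset.sum_congr rfl (g := fun _ => K), Finset.sum_const, smul_eq_mul, Set.ncard_eq_toFinset_card X hfin]
  · intro Y hY
    rw [Set.Finite.mem_toFinset] at hY
    rw [← hK Y (hX Y hY).1 (hX Y hY).2]
    congr 1
    ext E
    simp only [Finset.mem_filter, Finset.mem_univ, true_and]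
    constructor
    · exact fun h => h.2
    · exact fun h => ⟨h ▸ hY, h⟩
  · intro D hD
    have := (Finset.mem_filter.1 hD).2
    simpa using this

lemma finish (hB : Sp B n) {s K : ℕ} (hs1 : 1 ≤ s) (hsn : s ≤ n) (hK0 : 0 < K)
    (hK : ∀ X : Submodule F V, IsTotIso B X → finrank F X = s →
      (Finset.univ.filter fun D : Ch B n => D.space s = X).card = K)
    (S : Set (Ch B n)) (hmax : ∀ G : Set (Ch B n), IsEKRFlags G → G.ncard ≤ S.ncard)
    (hdep : ∀ C D : Ch B n, C.space s = D.space s → C ∈ S → D ∈ S)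
    (hopp : ∀ C ∈ S, ∀ D ∈ S, ¬ SpaceOpp B (C.space s) (D.space s)) :
    ∃ Fs : Set (Submodule F V), IsEKRSpaces B s Fs ∧
      (∀ Gs : Set (Submodule F V), IsEKRSpaces B s Gs → Gs.ncard ≤ Fs.ncard) ∧
      S = {C : Ch B n | C.space s ∈ Fs} := by
  have := fin_sub hB
  have hE : IsEKRSpaces B s {X | ∃ C ∈ S, C.space s = X} := by
    refine ⟨?_, ?_⟩
    · rintro _ ⟨C, _, rfl⟩; exact ⟨ch_ti C s, ch_fr C hsn⟩
    · rintro _ ⟨C, hC, rfl⟩ _ ⟨D, hD, rfl⟩; exact hopp C hC D hD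
  have hS : S = {C : Ch B n | C.space s ∈ {X | ∃ C ∈ S, C.space s = X}} := by
    ext C
    constructor
    · intro h; exact ⟨C, h, rfl⟩
    · rintro ⟨D, hD, h⟩; exact hdep D C h hD
  refine ⟨_, hE, ?_, hS⟩
  intro Gs hGs
  have h1 := hmax {C : Ch B n | C.space s ∈ Gs} (by
    intro C hC D hD h
    exact hGs.2 _ hC _ hD (h s (Finset.mem_Icc.2 ⟨hs1, hsn⟩)))
  rw [hS, blow hK _ (Set.toFinite _) hE.1, blow hK _ (Set.toFinite _) hGs.1] at h1
  exact Nat.le_of_mul_le_mul_right h1 hK0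

theorem main (hB : Sp B n) (hn : 3 ≤ n) (hq : 21 * n + 101 ≤ Fintype.card F) (S : Set (Ch B n))
    (hS : IsEKRFlags S) (hmax : ∀ G : Set (Ch B n), IsEKRFlags G → G.ncard ≤ S.ncard) :
    ∃ s : ℕ, (s = 1 ∨ s = n) ∧ ∃ Fs : Set (Submodule F V), IsEKRSpaces B s Fs ∧
      (∀ Gs : Set (Submodule F V), IsEKRSpaces B s Gs → Gs.ncard ≤ Fs.ncard) ∧
      S = {C : Ch B n | C.space s ∈ Fs} := by
  have := hB.fd
  have hcard : S.ncard * (Fintype.card F ^ n + 1) = Fintype.card (Ch B n) := by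
    obtain ⟨S', h1, h2⟩ := example_ekr (n := n) hB (by omega)
    refine le_antisymm (hoffman hB (by omega) hS).1 ?_
    rw [← h2]; exact Nat.mul_le_mul_right _ (hmax S' h1)
  have hT := (hoffman hB (by omega) hS).2 hcard
  rcases dich hB hn hq hcard hT with h | h
  · refine ⟨n, Or.inr rfl, ?_⟩
    obtain ⟨C0⟩ := exists_ch' hB (by omega : 1 ≤ n)
    refine finish hB (K := (Finset.univ.filter fun D : Ch B n => D.space n = C0.space n).card) (by omega) le_rfl ?_ ?_ S hmax ?_ ?_
    · exact Finset.card_pos.2 ⟨C0, by simp⟩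
    · intro X hX hXr
      exact le_antisymm (gen_le hB (by omega) hXr (ch_fr C0 le_rfl) (ch_ti C0 n))
        (gen_le hB (by omega) (ch_fr C0 le_rfl) hXr hX)
    · intro C D hCD hC
      exact mem_iff_of_ind (gen_of_inv hB (by omega) h hCD) hC
    · intro C hC D hD ho
      rw [SpaceOpp, hB.perp_gen (ch_ti C n) (ch_fr C le_rfl)] at ho
      obtain ⟨C', D', e1, e2, e3⟩ := opp_over hB (ch_ti C n) (ch_fr C le_rfl) (ch_ti D n) (ch_fr D le_rfl)
        (by omega) ho
      exact hS C' (mem_iff_of_ind (gen_of_inv hB (by omega) h e1.symm) hC) D'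
        (mem_iff_of_ind (gen_of_inv hB (by omega) h e2.symm) hD) e3
  · refine ⟨1, Or.inl rfl, ?_⟩
    refine finish hB (K := pq (Fintype.card F) (n-1)) le_rfl (by omega) (pq_pos _ _) ?_ S hmax ?_ ?_
    · intro X hX hXr; exact cnt_pt hB (by omega) hXr
    · intro C D hCD hC
      exact mem_iff_of_ind (pt_of_inv hB (by omega) h hCD) hC
    · intro C hC D hD ho
      have hnl : ¬ D.space 1 ≤ bperp B (C.space 1) := by
        intro hle
        rw [SpaceOpp, inf_eq_right.2 hle] at ho
        have := ch_fr D (show 1 ≤ n by omega)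
        rw [ho] at this; simp at this
      obtain ⟨E, hE1, hE2⟩ := ell_exists hB (n-1) 0 C (D.space 1) (by omega) (ch_ti D 1)
        (ch_fr D (by omega)) (by rw [ch_zero]; exact bot_le) hnl
      have hES : E ∈ S := mem_iff_of_ind (pt_of_inv hB (by omega) h hE2.symm) hD
      have h1 := T_ekr hB hS hC
      have h2 : Hk.TT (RR B n) n (ind S) = ((Fintype.card F : ℝ)^((n-1)*(n-1))) • Hk.LL (RR B n) (n-1) (ind S) := by
        obtain ⟨m, rfl⟩ : ∃ m, n = m + 1 := ⟨n - 1, by omega⟩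
        rw [Hk.TT, Module.End.mul_apply, Hk.TT_inv_vec (q := (Fintype.card F : ℝ)) (fun j hj => h j (by omega)), map_smul]
        rfl
      rw [h2] at h1
      simp only [PiLp.smul_apply, smul_eq_mul] at h1
      have hq0 : (0:ℝ) < (Fintype.card F : ℝ) := by exact_mod_cast Fintype.card_pos (α := F)
      have h3 := (mul_eq_zero.1 h1).resolve_left (by positivity)
      rw [L_apply hB (by omega)] at h3
      have := (Finset.sum_eq_zero_iff_of_nonneg fun D _ => ind_nonneg S D).1 h3 E (by simp [hE1])
      rw [ind_mem hES] at this
      exact one_ne_zero this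

end Gm

/-- For large `q`, a maximum EKR-set of chambers of the symplectic polar
space of rank `n` is the blow-up of a maximum EKR-set of `s`-spaces with `s ∈ {1,n}`. -/
theorem stmt_0 (n : ℕ) (hn : 3 ≤ n) :
    ∃ q₀ : ℕ, ∀ (F V : Type) [Field F] [Fintype F] [AddCommGroup V] [Module F V],
      ∀ q : ℕ, Fintype.card F = q → q₀ ≤ q →
      ∀ B : V →ₗ[F] V →ₗ[F] F, IsAltForm B → NondegForm B →
      FiniteDimensional F V → Module.finrank F V = 2 * n →
      ∀ 𝓕 : Set (SFlag B (Finset.Icc 1 n)),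
        IsEKRFlags 𝓕 →
        (∀ 𝓖 : Set (SFlag B (Finset.Icc 1 n)), IsEKRFlags 𝓖 → 𝓖.ncard ≤ 𝓕.ncard) →
        ∃ s : ℕ, (s = 1 ∨ s = n) ∧
          ∃ 𝓕s : Set (Submodule F V),
            IsEKRSpaces B s 𝓕s ∧
            (∀ 𝓖s : Set (Submodule F V), IsEKRSpaces B s 𝓖s → 𝓖s.ncard ≤ 𝓕s.ncard) ∧
            𝓕 = {C : SFlag B (Finset.Icc 1 n) | C.space s ∈ 𝓕s} := by
  refine ⟨21*n+101, ?_⟩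
  intro F V _ _ _ _ q hq hq0 B hA hN hfd hfr 𝓕 hE hmax
  have hB : Gm.Sp B n := ⟨hA, hN, hfd, hfr⟩
  have := Gm.fin_ch hB
  have := Fintype.ofFinite (Gm.Ch B n)
  exact Gm.main hB hn (by omega) 𝓕 hE hmax
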